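/- arXiv:1807.02645 — 7 statements merged into one kernel-verified Lean document; each statement's English description precedes it below -/
import Mathlib

section
/- Let J : ℂⁿ → ℂⁿ be a real-linear map such that J_st + J is invertible, where J_st : v ↦ i·v, and set L := (J_st + J)⁻¹ ∘ (J_st − J) (a real-linear map). Then J ∘ J = −id if and only if L is conjugate-linear, i.e. L(i·v) = −i·L(v) for all v ∈ ℂⁿ. -/
noncomputable section

/-- The standard complex structure on `ℂⁿ` viewed as a real vector space:
multiplication by `i`, as a real-linear endomorphism. -/
noncomputable def JstC (n : ℕ) : Module.End ℝ (Fin n → ℂ) :=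
  { toFun := fun v => Complex.I • v
    map_add' := by intro v w; simp [smul_add]
    map_smul' := by intro c v; exact (smul_comm c Complex.I v).symm }

theorem aux_ring {R : Type*} [Ring R] [Module ℝ R] (S J U : R) (hS : S * S = -1)
    (h1 : (S + J) * U = 1) (h2 : U * (S + J) = 1) :
    J * J = -1 ↔ (U * (S - J)) * S = -(S * (U * (S - J))) := by
  constructor
  · intro hJ
    have e1 : (S + J) * S = J * (S + J) := by
      rw [add_mul, mul_add, hS, hJ, add_comm]
    have e2 : S * U = U * J := by
      calc S * U = (U * (S + J)) * S * U := by rw [h2, one_mul]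
        _ = U * ((S + J) * S) * U := by simp only [mul_assoc]
        _ = U * (J * (S + J)) * U := by rw [e1]
        _ = U * J * ((S + J) * U) := by simp only [mul_assoc]
        _ = U * J := by rw [h1, mul_one]
    have e3 : (S - J) * S = -(J * (S - J)) := by
      rw [sub_mul, mul_sub, hS, hJ]; abel
    rw [mul_assoc, e3, ← mul_assoc S, e2, mul_neg, mul_assoc]
  · intro hL
    have hB : (S + J) * (U * (S - J)) = S - J := by rw [← mul_assoc, h1, one_mul]
    have hP : 1 + U * (S - J) = U * S + U * S := by
      rw [← h2]; simp only [mul_add, mul_sub]; abel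
    generalize U * (S - J) = L at *
    have e1 : J * (1 + L) = (1 + L) * S := by
      rw [add_mul 1 L S, hL, mul_add, one_mul, mul_one]
      rw [add_mul] at hB
      have : J * L = S - J - S * L := by rw [← hB]; abel
      rw [this]; abel
    have e2 : J * J * (1 + L) = -(1 + L) := by
      rw [mul_assoc, e1, ← mul_assoc, e1, mul_assoc, hS, mul_neg, mul_one]
    have e3 : (1 + L) * (-S * (S + J)) = 1 + 1 := by
      have : U * S * (-S * (S + J)) = 1 := by
        calc U * S * (-S * (S + J)) = U * (-(S * S)) * (S + J) := by
              simp only [mul_assoc, neg_mul, mul_neg]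
          _ = 1 := by rw [hS, neg_neg, mul_one, h2]
      rw [hP, add_mul, this]
    have e4 : J * J * (1 + 1) = -(1 + 1) := by
      rw [← e3, ← mul_assoc, e2, neg_mul]
    have e5 : (2 : ℝ) • (J * J) = (2 : ℝ) • (-1 : R) := by
      rw [two_smul, two_smul]
      rw [mul_add, mul_one] at e4
      rw [e4]; abel
    exact smul_right_injective R (two_ne_zero : (2 : ℝ) ≠ 0) e5

/-- for a real-linear `J : ℂⁿ → ℂⁿ` with `J_st + J` invertible, and
`L := (J_st + J)⁻¹ ∘ (J_st − J)`, one has `J ∘ J = −id` iff `L` is conjugate-linear,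
i.e. `L(i·v) = −i·L(v)` for all `v`. -/
theorem square_neg_id_iff_conjugate_linear
    (n : ℕ) (J : Module.End ℝ (Fin n → ℂ))
    (hinv : IsUnit (JstC n + J)) :
    (J * J = -1) ↔
      (∀ v : Fin n → ℂ,
        (Ring.inverse (JstC n + J) * (JstC n - J)) (Complex.I • v) =
          -(Complex.I • (Ring.inverse (JstC n + J) * (JstC n - J)) v)) := by
  have hS : JstC n * JstC n = -1 := by
    refine LinearMap.ext fun v => ?_
    change Complex.I • (Complex.I • v) = -v
    rw [smul_smul, Complex.I_mul_I, neg_one_smul]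
  rw [aux_ring (JstC n) J (Ring.inverse (JstC n + J)) hS
    (Ring.mul_inverse_cancel _ hinv) (Ring.inverse_mul_cancel _ hinv)]
  exact LinearMap.ext_iff
end
end

section
/- Let Ω ⊂ ℂⁿ be open and let J assign to each z ∈ Ω a real-linear endomorphism J(z) of ℂⁿ with J(z)² = −id and J_st + J(z) invertible, where J_st : v ↦ i·v. Define L(z) := (J_st + J(z))⁻¹ ∘ (J_st − J(z)) (which is conjugate-linear), and let A(z) be the ℂ-linear map A(z) : w ↦ L(z)(w̄). Then a C¹ map z : 𝔻 → Ω, ζ = ξ+iη ↦ z(ζ), satisfies the Cauchy–Riemann equation ∂z/∂η = J(z(ζ))(∂z/∂ξ) on 𝔻 if and only if it satisfies ∂z/∂ζ̄ = A(z(ζ))·conj(∂z/∂ζ) on 𝔻. -/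
open Metric

noncomputable section

/-- Componentwise complex conjugation on `ℂⁿ`. -/
def conjVec {n : ℕ} (v : Fin n → ℂ) : Fin n → ℂ := fun i => (starRingEnd ℂ) (v i)

/-- `∂z/∂ζ` for a map `z : ℂ → ℂⁿ` (Wirtinger derivative). -/
noncomputable def wdz {n : ℕ} (z : ℂ → Fin n → ℂ) (ζ : ℂ) : Fin n → ℂ :=
  (1 / 2 : ℂ) • (fderiv ℝ z ζ 1 - Complex.I • fderiv ℝ z ζ Complex.I)

/-- `∂z/∂ζ̄` for a map `z : ℂ → ℂⁿ` (Wirtinger derivative). -/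
noncomputable def wdzbar {n : ℕ} (z : ℂ → Fin n → ℂ) (ζ : ℂ) : Fin n → ℂ :=
  (1 / 2 : ℂ) • (fderiv ℝ z ζ 1 + Complex.I • fderiv ℝ z ζ Complex.I)

/-- for an almost complex structure `J` on an open set `Ω ⊆ ℂⁿ` with
`J(z)² = −id` and `J_st + J(z)` invertible, with `L(z) := (J_st+J(z))⁻¹ ∘ (J_st−J(z))`
and complex matrix `A(z) : w ↦ L(z)(w̄)`, a `C¹` map `z : 𝔻 → Ω` satisfies
`∂z/∂η = J(z(ζ))(∂z/∂ξ)` on `𝔻` iff `∂z/∂ζ̄ = A(z(ζ))·conj(∂z/∂ζ)` on `𝔻`. -/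
theorem cauchy_riemann_iff_complex_matrix_equation
    (n : ℕ) (Ω : Set (Fin n → ℂ)) (hΩ : IsOpen Ω)
    (J : (Fin n → ℂ) → Module.End ℝ (Fin n → ℂ))
    (hJsq : ∀ w ∈ Ω, J w * J w = -1)
    (hJinv : ∀ w ∈ Ω, IsUnit (JstC n + J w))
    (L : (Fin n → ℂ) → Module.End ℝ (Fin n → ℂ))
    (hL : ∀ w, L w = Ring.inverse (JstC n + J w) * (JstC n - J w))
    (A : (Fin n → ℂ) → (Fin n → ℂ) → Fin n → ℂ)
    (hA : ∀ w v, A w v = L w (conjVec v))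
    (z : ℂ → Fin n → ℂ)
    (hz : ContDiffOn ℝ 1 z (ball (0 : ℂ) 1))
    (hzΩ : Set.MapsTo z (ball (0 : ℂ) 1) Ω) :
    (∀ ζ ∈ ball (0 : ℂ) 1, fderiv ℝ z ζ Complex.I = J (z ζ) (fderiv ℝ z ζ 1)) ↔
      (∀ ζ ∈ ball (0 : ℂ) 1, wdzbar z ζ = A (z ζ) (conjVec (wdz z ζ))) := by
  refine forall₂_congr fun ζ hζ => ?_
  have hu := hJinv _ (hzΩ hζ)
  rw [hA, hL]
  have hcc : conjVec (conjVec (wdz z ζ)) = wdz z ζ := by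
    funext i; simp [conjVec]
  rw [hcc]
  unfold wdz wdzbar
  generalize fderiv ℝ z ζ 1 = x
  generalize fderiv ℝ z ζ Complex.I = y
  generalize J (z ζ) = K at hu ⊢
  have hh : ∀ v : Fin n → ℂ, (1 / 2 : ℂ) • v = (1 / 2 : ℝ) • v := by
    intro v; funext i; simp
  rw [hh, hh, map_smul]
  have hI : ∀ v, JstC n v = Complex.I • v := fun v => rfl
  have key : (JstC n + K) (x + Complex.I • y) - (JstC n - K) (x - Complex.I • y)
      = (2 : ℝ) • (K x - y) := by
    simp only [LinearMap.add_apply, LinearMap.sub_apply, hI, map_add, map_sub, smul_add,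
      smul_sub, smul_smul, Complex.I_mul_I, two_smul, neg_smul, one_smul]
    abel
  have h1 : ∀ v, Ring.inverse (JstC n + K) ((JstC n + K) v) = v := fun v => by
    rw [← Module.End.mul_apply, Ring.inverse_mul_cancel _ hu, Module.End.one_apply]
  have h2 : ∀ v, (JstC n + K) (Ring.inverse (JstC n + K) v) = v := fun v => by
    rw [← Module.End.mul_apply, Ring.mul_inverse_cancel _ hu, Module.End.one_apply]
  rw [Module.End.mul_apply]
  constructor
  · intro h
    rw [h, sub_self, smul_zero, sub_eq_zero, ← h] at key
    rw [← key, h1]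
  · intro h
    have h3 := smul_right_injective (Fin n → ℂ) (by norm_num : (1 / 2 : ℝ) ≠ 0) h
    rw [h3, h2, sub_self] at key
    have h4 := (smul_eq_zero.mp key.symm).resolve_left (by norm_num)
    exact (sub_eq_zero.mp h4).symm
end
end

section
/- Let α ∈ (0,1) and let φ : ∂𝔻 → ℝ be α-Hölder. Then the Schwarz integral Sφ is holomorphic on 𝔻, extends continuously (indeed α-Hölder) to the closed disc 𝔻̄, its real part has boundary values Re Sφ(e^{iθ}) = φ(e^{iθ}) for all θ, its imaginary part vanishes at the origin, Im Sφ(0) = 0, and Sφ(0) = (1/2π)∫₀^{2π} φ(e^{iθ}) dθ. -/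
open Metric

noncomputable section

/-- The Schwarz integral of a (boundary) function `φ`:
`Sφ(ζ) = (1/2π)∫₀^{2π} ((e^{iθ}+ζ)/(e^{iθ}−ζ)) φ(e^{iθ}) dθ`. -/
noncomputable def schwarz (φ : ℂ → ℝ) (ζ : ℂ) : ℂ :=
  (1 / (2 * Real.pi) : ℂ) * ∫ θ in (0 : ℝ)..(2 * Real.pi),
    ((Complex.exp (θ * Complex.I) + ζ) / (Complex.exp (θ * Complex.I) - ζ)) *
      (φ (Complex.exp (θ * Complex.I)) : ℂ)

/-- `f` is `α`-Hölder on `K`. -/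
def HolderOn {E F : Type*} [NormedAddCommGroup E] [NormedAddCommGroup F]
    (α : ℝ) (f : E → F) (K : Set E) : Prop :=
  ∃ C : ℝ, ∀ x ∈ K, ∀ y ∈ K, ‖f x - f y‖ ≤ C * ‖x - y‖ ^ α

lemma aux_int (α d : ℝ) (hα : α < 1) (hd : 0 < d) :
    ∫ θ in (0:ℝ)..(2 * Real.pi), (d + θ) ^ (α - 2) ≤ d ^ (α - 1) / (1 - α) := by
  have hpi := Real.pi_pos
  have h0 : (0:ℝ) ∉ Set.uIcc d (d + 2 * Real.pi) := by
    rw [Set.uIcc_of_le (by linarith)]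
    intro h; linarith [h.1]
  have := intervalIntegral.integral_comp_add_left (a := 0) (b := 2 * Real.pi)
    (fun x : ℝ => x ^ (α - 2)) d
  rw [this, add_zero, integral_rpow (Or.inr ⟨by linarith, h0⟩)]
  have e : α - 2 + 1 = -(1 - α) := by ring
  have e' : α - 1 = -(1 - α) := by ring
  rw [e, e', div_neg, ← neg_div]
  have : 0 ≤ (d + 2 * Real.pi) ^ (-(1 - α)) := by positivity
  gcongr
  · linarith

lemma aux_lower (θ r : ℝ) (hθ : θ ∈ Set.Icc 0 (2 * Real.pi)) (hr0 : 0 ≤ r) (hr : r < 1) :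
    (1 - r) + min θ (2 * Real.pi - θ) ≤ (Real.pi + 1) * ‖Complex.exp (θ * Complex.I) - r‖ := by
  have hpi := Real.pi_pos
  have h1 : 1 - r ≤ ‖Complex.exp (θ * Complex.I) - r‖ := by
    have := norm_sub_norm_le (Complex.exp (θ * Complex.I)) (r : ℂ)
    rw [Complex.norm_exp_ofReal_mul_I, Complex.norm_real, Real.norm_of_nonneg hr0] at this
    exact this
  have h2 : ‖Complex.exp (θ * Complex.I) - 1‖ ≤ 2 * ‖Complex.exp (θ * Complex.I) - r‖ := by
    have : Complex.exp (θ * Complex.I) - 1 = (Complex.exp (θ * Complex.I) - r) - ((1 - r : ℝ) : ℂ) := by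
      push_cast; ring
    rw [this]
    refine (norm_sub_le _ _).trans ?_
    rw [Complex.norm_real, Real.norm_of_nonneg (by linarith)]
    linarith
  have h3 : 2 / Real.pi * min θ (2 * Real.pi - θ) ≤ ‖Complex.exp (θ * Complex.I) - 1‖ := by
    rw [mul_comm (θ : ℂ), Complex.norm_exp_I_mul_ofReal_sub_one, norm_mul]
    rw [Real.norm_of_nonneg (by norm_num : (0:ℝ) ≤ 2)]
    have hs : 0 ≤ Real.sin (θ / 2) := Real.sin_nonneg_of_nonneg_of_le_pi (by linarith [hθ.1]) (by linarith [hθ.2])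
    rw [Real.norm_of_nonneg hs]
    rcases le_total θ Real.pi with h | h
    · have := Real.mul_le_sin (x := θ / 2) (by linarith [hθ.1]) (by linarith)
      calc _ ≤ 2 / Real.pi * θ := by gcongr; exact min_le_left _ _
        _ = 2 * (2 / Real.pi * (θ/2)) := by ring
        _ ≤ _ := by linarith
    · have := Real.mul_le_sin (x := Real.pi - θ / 2) (by linarith [hθ.2]) (by linarith)
      rw [Real.sin_pi_sub] at this
      calc _ ≤ 2 / Real.pi * (2 * Real.pi - θ) := by gcongr; exact min_le_right _ _
        _ = 2 * (2 / Real.pi * (Real.pi - θ/2)) := by ring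
        _ ≤ _ := by linarith
  have h4 : min θ (2 * Real.pi - θ) ≤ Real.pi * ‖Complex.exp (θ * Complex.I) - r‖ := by
    have := h3.trans h2
    rw [div_mul_eq_mul_div, div_le_iff₀ hpi] at this
    nlinarith
  nlinarith

lemma sphere_sub_pos {ζ w : ℂ} (hζ : ζ ∈ sphere (0:ℂ) 1) (hw : w ∈ ball (0:ℂ) 1) :
    0 < 1 - ‖w‖ ∧ 1 - ‖w‖ ≤ ‖ζ - w‖ := by
  simp only [mem_sphere, mem_ball, dist_zero_right] at hζ hw
  refine ⟨by linarith, ?_⟩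
  have := norm_sub_norm_le ζ w
  linarith

lemma aux_ci (α : ℝ) {w : ℂ} (hw : w ∈ ball (0:ℂ) 1) :
    CircleIntegrable (fun ζ => ‖ζ - w‖ ^ (α - 2)) 0 1 := by
  apply ContinuousOn.circleIntegrable zero_le_one
  apply ContinuousOn.rpow_const (by fun_prop)
  intro x hx
  have := sphere_sub_pos hx hw
  left; linarith

lemma aux_kernel (α : ℝ) (hα : α ∈ Set.Ioo (0 : ℝ) 1) : ∃ C : ℝ, 0 ≤ C ∧ ∀ w ∈ ball (0:ℂ) 1,
    Real.circleAverage (fun ζ => ‖ζ - w‖ ^ (α - 2)) 0 1 ≤ C * (1 - ‖w‖) ^ (α - 1) := by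
  have hpi := Real.pi_pos
  obtain ⟨hα0, hα1⟩ := hα
  refine ⟨(2 * Real.pi)⁻¹ * ((Real.pi + 1) ^ (2 - α) * (2 / (1 - α))),
    by have : 0 < 1 - α := by linarith
       positivity, ?_⟩
  intro w hw
  have hr : ‖w‖ < 1 := by simpa using hw
  set d := 1 - ‖w‖ with hd
  have hd0 : 0 < d := by linarith
  rw [Real.circleAverage_eq_integral_add w.arg, smul_eq_mul, mul_assoc, mul_assoc]
  gcongr
  have I1 : IntervalIntegrable (fun θ : ℝ => (d + θ) ^ (α - 2)) MeasureTheory.volume 0 (2 * Real.pi) := by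
    apply ContinuousOn.intervalIntegrable
    apply ContinuousOn.rpow_const (by fun_prop)
    intro x hx
    rw [Set.uIcc_of_le (by linarith)] at hx
    left; linarith [hx.1]
  have I2 : IntervalIntegrable (fun θ : ℝ => (d + (2 * Real.pi - θ)) ^ (α - 2)) MeasureTheory.volume 0 (2 * Real.pi) := by
    apply ContinuousOn.intervalIntegrable
    apply ContinuousOn.rpow_const (by fun_prop)
    intro x hx
    rw [Set.uIcc_of_le (by linarith)] at hx
    left; linarith [hx.2]
  have E2 : ∫ θ in (0:ℝ)..(2 * Real.pi), (d + (2 * Real.pi - θ)) ^ (α - 2)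
      = ∫ θ in (0:ℝ)..(2 * Real.pi), (d + θ) ^ (α - 2) := by
    have := intervalIntegral.integral_comp_sub_left (a := 0) (b := 2 * Real.pi)
      (fun x : ℝ => (d + x) ^ (α - 2)) (2 * Real.pi)
    rw [this]; simp
  have hn : ∀ θ : ℝ, ‖circleMap 0 1 (θ + w.arg) - w‖ = ‖Complex.exp (θ * Complex.I) - (‖w‖ : ℝ)‖ := by
    intro θ
    have : circleMap 0 1 (θ + w.arg) - w = Complex.exp (w.arg * Complex.I) * (Complex.exp (θ * Complex.I) - (‖w‖ : ℝ)) := by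
      have h := Complex.norm_mul_exp_arg_mul_I w
      simp only [circleMap, zero_add, Complex.ofReal_one, one_mul, Complex.ofReal_add, add_mul, Complex.exp_add]
      linear_combination h
    rw [this, norm_mul, Complex.norm_exp_ofReal_mul_I, one_mul]
  calc _ ≤ ∫ θ in (0:ℝ)..(2 * Real.pi), (Real.pi + 1) ^ (2 - α) *
        ((d + θ) ^ (α - 2) + (d + (2 * Real.pi - θ)) ^ (α - 2)) := by
        apply intervalIntegral.integral_mono_on (by linarith)
        · apply Continuous.intervalIntegrable
          apply Continuous.rpow_const (by fun_prop)
          intro x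
          have := sphere_sub_pos (circleMap_mem_sphere (0:ℂ) zero_le_one (x + w.arg)) hw
          left; linarith
        · exact (I1.add I2).const_mul _
        · intro θ hθ
          rw [hn]
          have hl := aux_lower θ ‖w‖ hθ (norm_nonneg _) hr
          have hm : 0 ≤ min θ (2 * Real.pi - θ) := le_min hθ.1 (by linarith [hθ.2])
          have hX : (d + min θ (2 * Real.pi - θ)) / (Real.pi + 1) ≤ ‖Complex.exp (θ * Complex.I) - (‖w‖ : ℝ)‖ := by
            rw [div_le_iff₀ (by positivity)]; linarith
          have h1 := Real.rpow_le_rpow_of_nonpos (z := α - 2) (by positivity) hX (by linarith)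
          refine h1.trans ?_
          rw [Real.div_rpow (by positivity) (by positivity), div_eq_mul_inv, ← Real.rpow_neg (by positivity), mul_comm]
          have e : -(α - 2) = 2 - α := by ring
          rw [e]
          have p1 : 0 ≤ (d + θ) ^ (α - 2) := Real.rpow_nonneg (by linarith [hθ.1]) _
          have p2 : 0 ≤ (d + (2 * Real.pi - θ)) ^ (α - 2) := Real.rpow_nonneg (by linarith [hθ.2]) _
          gcongr
          rcases min_choice θ (2 * Real.pi - θ) with h | h <;> rw [h] <;> linarith
    _ = (Real.pi + 1) ^ (2 - α) * (2 * ∫ θ in (0:ℝ)..(2 * Real.pi), (d + θ) ^ (α - 2)) := by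
        rw [intervalIntegral.integral_const_mul, intervalIntegral.integral_add I1 I2, E2]
        ring
    _ ≤ _ := by
        have := aux_int α d hα1 hd0
        calc _ ≤ (Real.pi + 1) ^ (2 - α) * (2 * (d ^ (α - 1) / (1 - α))) := by gcongr
          _ = _ := by ring

lemma schwarz_eq (φ : ℂ → ℝ) : schwarz φ =
    fun w => Real.circleAverage (fun ζ => herglotzRieszKernel 0 w ζ • (φ ζ : ℂ)) 0 1 := by
  ext w
  simp [schwarz, Real.circleAverage_def, herglotzRieszKernel_def, circleMap]

lemma ci_ofReal {φ : ℂ → ℝ} (h : ContinuousOn φ (sphere (0:ℂ) 1)) :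
    CircleIntegrable (fun ζ => (φ ζ : ℂ)) 0 1 := by
  apply ContinuousOn.circleIntegrable zero_le_one
  exact Complex.continuous_ofReal.comp_continuousOn h

lemma avg_herglotz {w : ℂ} (hw : w ∈ ball (0:ℂ) 1) :
    Real.circleAverage (fun ζ => herglotzRieszKernel 0 w ζ) 0 1 = 1 := by
  have h1 : Real.circleAverage (fun z : ℂ => ((z - 0) / (z - w)) • (1:ℂ)) 0 1 = 1 :=
    DiffContOnCl.circleAverage_smul_div (f := fun _ => (1:ℂ)) (R := 1)
      diffContOnCl_const (by simpa using hw)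
  have hne : ∀ z ∈ sphere (0:ℂ) 1, z - w ≠ 0 := by
    intro z hz h
    have := sphere_sub_pos hz hw
    rw [h, norm_zero] at this; linarith
  have h2 : Real.circleAverage (fun ζ => herglotzRieszKernel 0 w ζ) 0 1 =
      Real.circleAverage (fun z : ℂ => (2:ℂ) • (((z - 0) / (z - w)) • (1:ℂ)) - 1) 0 1 := by
    apply Real.circleAverage_congr_sphere
    intro z hz
    rw [abs_one] at hz
    have := hne z hz
    simp only [herglotzRieszKernel_def, sub_zero, smul_eq_mul]
    field_simp
    ring
  rw [h2, Real.circleAverage_fun_sub, Real.circleAverage_fun_smul, h1, Real.circleAverage_const]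
  · norm_num
  · apply ContinuousOn.circleIntegrable zero_le_one
    fun_prop (disch := assumption)
  · exact circleIntegrable_const _ _ _

lemma schwarz_sub {φ : ℂ → ℝ} (h : ContinuousOn φ (sphere (0:ℂ) 1)) (c : ℝ) {w : ℂ}
    (hw : w ∈ ball (0:ℂ) 1) :
    schwarz (fun ζ => φ ζ - c) w = schwarz φ w - c := by
  have hk : ContinuousOn (herglotzRieszKernel 0 w) (sphere (0:ℂ) |1|) :=
    continuousOn_herglotzRieszKernel_sphere hw
  rw [schwarz_eq, schwarz_eq]
  have e : (fun ζ => herglotzRieszKernel 0 w ζ • ((φ ζ - c : ℝ) : ℂ)) =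
    fun ζ => herglotzRieszKernel 0 w ζ • (φ ζ : ℂ) - (c : ℂ) • herglotzRieszKernel 0 w ζ := by
    ext ζ; simp; ring
  simp only [e]
  rw [Real.circleAverage_fun_sub, Real.circleAverage_fun_smul, avg_herglotz hw]
  · simp
  · exact (ci_ofReal h).continuousOn_smul hk
  · rw [abs_one] at hk
    exact (hk.const_smul (c:ℂ)).circleIntegrable zero_le_one

lemma norm_avg_le {f : ℂ → ℂ} {g : ℂ → ℝ}
    (hg : CircleIntegrable g 0 1) (h : ∀ z ∈ sphere (0:ℂ) 1, ‖f z‖ ≤ g z) :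
    ‖Real.circleAverage f 0 1‖ ≤ Real.circleAverage g 0 1 := by
  have hpi := Real.pi_pos
  rw [Real.circleAverage_def, Real.circleAverage_def, norm_smul, smul_eq_mul,
    Real.norm_of_nonneg (by positivity)]
  gcongr
  apply intervalIntegral.norm_integral_le_of_norm_le (by positivity) _ hg
  filter_upwards with t _
  exact h _ (circleMap_mem_sphere _ zero_le_one _)

lemma holder_bound {α C : ℝ} (hα : 0 < α) (hC : 0 ≤ C) {φ : ℂ → ℝ}
    (hφ : ∀ x ∈ sphere (0:ℂ) 1, ∀ y ∈ sphere (0:ℂ) 1, ‖φ x - φ y‖ ≤ C * ‖x - y‖ ^ α)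
    {w η : ℂ} (hw : w ∈ ball (0:ℂ) 1) (hη : η ∈ sphere (0:ℂ) 1) (hwη : ‖w - η‖ ≤ 1 - ‖w‖)
    {ζ : ℂ} (hζ : ζ ∈ sphere (0:ℂ) 1) :
    ‖φ ζ - φ η‖ ≤ C * 2 ^ α * ‖ζ - w‖ ^ (α - 2) * ‖ζ - w‖ ^ 2 := by
  have hp := sphere_sub_pos hζ hw
  have h0 : 0 < ‖ζ - w‖ := by linarith
  have h1 : ‖ζ - η‖ ≤ 2 * ‖ζ - w‖ := by
    have : ζ - η = (ζ - w) + (w - η) := by ring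
    rw [this]
    refine (norm_add_le _ _).trans (by linarith)
  calc _ ≤ C * ‖ζ - η‖ ^ α := hφ _ hζ _ hη
    _ ≤ C * (2 * ‖ζ - w‖) ^ α := by gcongr
    _ = _ := by
      rw [Real.mul_rpow (by norm_num) h0.le, mul_assoc, mul_assoc, ← Real.rpow_natCast,
        ← Real.rpow_add h0]
      norm_num

lemma exists_eta (w : ℂ) (hw : w ∈ ball (0:ℂ) 1) : ∃ η ∈ sphere (0:ℂ) 1, ‖w - η‖ ≤ 1 - ‖w‖ := by
  have hr : ‖w‖ < 1 := by simpa using hw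
  refine ⟨Complex.exp (w.arg * Complex.I), by simp [Complex.norm_exp_ofReal_mul_I], ?_⟩
  have : w - Complex.exp (w.arg * Complex.I) = ((‖w‖ - 1 : ℝ) : ℂ) * Complex.exp (w.arg * Complex.I) := by
    have h := Complex.norm_mul_exp_arg_mul_I w
    push_cast
    linear_combination -h
  rw [this, norm_mul, Complex.norm_exp_ofReal_mul_I, mul_one, Complex.norm_real, Real.norm_eq_abs,
    abs_of_nonpos (by linarith)]
  linarith

lemma deriv_bound {α C : ℝ} (hα : α ∈ Set.Ioo (0:ℝ) 1) (hC : 0 ≤ C) {φ : ℂ → ℝ}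
    (hc : ContinuousOn φ (sphere (0:ℂ) 1))
    (hφ : ∀ x ∈ sphere (0:ℂ) 1, ∀ y ∈ sphere (0:ℂ) 1, ‖φ x - φ y‖ ≤ C * ‖x - y‖ ^ α) :
    ∃ M : ℝ, 0 ≤ M ∧ ∀ w ∈ ball (0:ℂ) 1, ∃ D, HasDerivAt (schwarz φ) D w ∧
      ‖D‖ ≤ M * (1 - ‖w‖) ^ (α - 1) := by
  obtain ⟨K, hK, hK'⟩ := aux_kernel α hα
  refine ⟨2 * (C * 2 ^ α) * K, by positivity, ?_⟩
  intro w hw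
  obtain ⟨η, hη, hwη⟩ := exists_eta w hw
  have hc' : ContinuousOn (fun ζ => φ ζ - φ η) (sphere (0:ℂ) 1) := by fun_prop
  have hd := hasDerivAt_circleAverage_herglotzRieszKernel_smul (ci_ofReal hc') hw
  refine ⟨Real.circleAverage (fun ζ ↦ (2 * ζ / (ζ - w) ^ 2) • ((φ ζ - φ η : ℝ) : ℂ)) 0 1, ?_, ?_⟩
  · have := hd.add_const (φ η : ℂ)
    refine this.congr_of_eventuallyEq ?_
    filter_upwards [isOpen_ball.mem_nhds hw] with z hz
    have := schwarz_sub hc (φ η) hz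
    rw [schwarz_eq (fun ζ => φ ζ - φ η)] at this
    simp only at this
    rw [this]; ring
  · have hci : CircleIntegrable (fun ζ => (2 * (C * 2 ^ α)) • ‖ζ - w‖ ^ (α - 2)) 0 1 :=
      (aux_ci α hw).const_smul
    calc _ ≤ Real.circleAverage (fun ζ => (2 * (C * 2 ^ α)) • ‖ζ - w‖ ^ (α - 2)) 0 1 := by
          apply norm_avg_le hci
          intro ζ hζ
          have hb := holder_bound hα.1 hC hφ hw hη hwη hζ
          have hp := sphere_sub_pos hζ hw
          have h0 : 0 < ‖ζ - w‖ := by linarith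
          have hζ1 : ‖ζ‖ = 1 := by simpa using hζ
          rw [norm_smul, norm_div, norm_mul, norm_pow, Complex.norm_real, hζ1, Complex.norm_ofNat, smul_eq_mul]
          rw [div_mul_eq_mul_div, div_le_iff₀ (by positivity)]
          linarith
      _ = 2 * (C * 2 ^ α) * Real.circleAverage (fun ζ => ‖ζ - w‖ ^ (α - 2)) 0 1 := by
          rw [Real.circleAverage_fun_smul, smul_eq_mul]
      _ ≤ _ := by
          rw [mul_assoc _ K]
          gcongr
          exact hK' w hw

lemma re_bound {α C : ℝ} (hα : α ∈ Set.Ioo (0:ℝ) 1) (hC : 0 ≤ C) {φ : ℂ → ℝ}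
    (hc : ContinuousOn φ (sphere (0:ℂ) 1))
    (hφ : ∀ x ∈ sphere (0:ℂ) 1, ∀ y ∈ sphere (0:ℂ) 1, ‖φ x - φ y‖ ≤ C * ‖x - y‖ ^ α) :
    ∃ M : ℝ, ∀ w ∈ ball (0:ℂ) 1, ∀ η ∈ sphere (0:ℂ) 1, ‖w - η‖ ≤ 1 - ‖w‖ →
      |(schwarz φ w).re - φ η| ≤ M * (1 - ‖w‖) ^ α := by
  obtain ⟨K, hK, hK'⟩ := aux_kernel α hα
  refine ⟨2 * (C * 2 ^ α) * K, ?_⟩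
  intro w hw η hη hwη
  have hc' : ContinuousOn (fun ζ => φ ζ - φ η) (sphere (0:ℂ) 1) := by fun_prop
  have e1 : (schwarz φ w).re - φ η = (schwarz (fun ζ => φ ζ - φ η) w).re := by
    rw [schwarz_sub hc _ hw]; simp
  have hr : ‖w‖ < 1 := by simpa using hw
  have hd : 0 < 1 - ‖w‖ := by linarith
  rw [e1, schwarz_eq]
  simp only
  rw [re_circleAverage_herglotzRieszKernel_smul (hc'.circleIntegrable zero_le_one) hw,
    ← poissonKernel_eq_re_herglotzRieszKernel]
  refine Real.abs_circleAverage_le_circleAverage_abs.trans ?_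
  have hpk : ContinuousOn (poissonKernel 0 w) (sphere (0:ℂ) 1) := by
    rw [poissonKernel_eq_re_herglotzRieszKernel]
    have hk : ContinuousOn (herglotzRieszKernel 0 w) (sphere (0:ℂ) |1|) :=
      continuousOn_herglotzRieszKernel_sphere hw
    rw [abs_one] at hk
    exact Complex.continuous_re.comp_continuousOn hk
  calc _ ≤ Real.circleAverage (fun ζ => (2 * (C * 2 ^ α) * (1 - ‖w‖)) • ‖ζ - w‖ ^ (α - 2)) 0 1 := by
        apply Real.circleAverage_mono
        · exact ((hpk.mul hc').abs).circleIntegrable zero_le_one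
        · exact (aux_ci α hw).const_smul
        · intro ζ hζ
          rw [abs_one] at hζ
          have hb := holder_bound hα.1 hC hφ hw hη hwη hζ
          have hp := sphere_sub_pos hζ hw
          have h0 : 0 < ‖ζ - w‖ := by linarith
          have hζ1 : ‖ζ‖ = 1 := by simpa using hζ
          change |poissonKernel 0 w ζ * (φ ζ - φ η)| ≤ _
          simp only [smul_eq_mul, abs_mul, poissonKernel_def, sub_zero, hζ1]
          rw [abs_of_nonneg (by apply div_nonneg _ (by positivity); nlinarith [norm_nonneg w]),
            div_mul_eq_mul_div, div_le_iff₀ (by positivity)]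
          calc (1 ^ 2 - ‖w‖ ^ 2) * |φ ζ - φ η| ≤ (2 * (1 - ‖w‖)) * (C * 2 ^ α * ‖ζ - w‖ ^ (α - 2) * ‖ζ - w‖ ^ 2) := by
                gcongr
                · nlinarith [norm_nonneg w]
                · exact hb
            _ = _ := by ring
    _ = 2 * (C * 2 ^ α) * (1 - ‖w‖) * Real.circleAverage (fun ζ => ‖ζ - w‖ ^ (α - 2)) 0 1 := by
        rw [Real.circleAverage_fun_smul, smul_eq_mul]
    _ ≤ 2 * (C * 2 ^ α) * (1 - ‖w‖) * (K * (1 - ‖w‖) ^ (α - 1)) := by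
        gcongr
        exact hK' w hw
    _ = 2 * (C * 2 ^ α) * K * ((1 - ‖w‖) ^ (1:ℝ) * (1 - ‖w‖) ^ (α - 1)) := by
        rw [Real.rpow_one]; ring
    _ = _ := by rw [← Real.rpow_add hd]; norm_num

lemma hardy_radial {α M : ℝ} (hα : α ∈ Set.Ioo (0:ℝ) 1) (hM : 0 ≤ M) {S : ℂ → ℂ}
    (hS : ∀ w ∈ ball (0:ℂ) 1, ∃ D, HasDerivAt S D w ∧ ‖D‖ ≤ M * (1 - ‖w‖) ^ (α - 1))
    {z : ℂ} (hz : z ∈ ball (0:ℂ) 1) {s : ℝ} (hs : s ∈ Set.Icc (0:ℝ) 1) :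
    ‖S z - S ((1 - s : ℝ) * z)‖ ≤ M / α * s ^ α := by
  have hr : ‖z‖ < 1 := by simpa using hz
  have hα0 := hα.1
  have hmem : ∀ t ∈ Set.Icc (1 - s) 1, (t : ℂ) * z ∈ ball (0:ℂ) 1 := by
    intro t ht
    have : 0 ≤ t := by linarith [ht.1, hs.2]
    simp only [mem_ball, dist_zero_right, norm_mul, Complex.norm_real, Real.norm_of_nonneg this]
    nlinarith [norm_nonneg z, ht.2]
  choose! D hD hDb using hS
  have hder : ∀ t ∈ Set.Icc (1 - s) 1, HasDerivAt (fun t : ℝ => S (t * z) - S ((1 - s : ℝ) * z)) (D (t * z) * z) t := by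
    intro t ht
    have h1 : HasDerivAt (fun t : ℂ => t * z) z (t : ℂ) := by
      simpa using (hasDerivAt_id (t : ℂ)).mul_const z
    have h2 := (hD _ (hmem t ht)).comp (t : ℂ) h1
    exact (h2.comp_ofReal).sub_const _
  have := image_norm_le_of_norm_deriv_right_le_deriv_boundary' (a := 1 - s) (b := 1)
    (f := fun t : ℝ => S (t * z) - S ((1 - s : ℝ) * z)) (f' := fun t => D (t * z) * z)
    (B := fun t => M / α * (s ^ α - (1 - t) ^ α)) (B' := fun t => M * (1 - t) ^ (α - 1))
    (fun t ht => (hder t ht).continuousAt.continuousWithinAt)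
    (fun t ht => (hder t ⟨ht.1, ht.2.le⟩).hasDerivWithinAt)
    (by simp)
    (by
      apply ContinuousOn.mul continuousOn_const
      apply ContinuousOn.sub continuousOn_const
      apply ContinuousOn.rpow_const (by fun_prop)
      intro x _; right; exact hα0.le)
    (by
      intro t ht
      apply HasDerivAt.hasDerivWithinAt
      have h1 : HasDerivAt (fun t : ℝ => 1 - t) (-1) t := by
        simpa using (hasDerivAt_id t).const_sub 1
      have h2 := h1.rpow_const (p := α) (Or.inl (by linarith [ht.2]))
      have h3 := (h2.const_sub (s ^ α)).const_mul (M / α)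
      refine h3.congr_deriv ?_
      have : M / α * α = M := div_mul_cancel₀ _ hα0.ne'
      linear_combination ((1 - t) ^ (α - 1)) * this)
    (by
      intro t ht
      have ht0 : 0 ≤ t := by linarith [ht.1, hs.2]
      have ht1 : t < 1 := ht.2
      have hb := hDb _ (hmem t ⟨ht.1, ht.2.le⟩)
      rw [norm_mul] at hb
      rw [Complex.norm_real, Real.norm_of_nonneg ht0] at hb
      rw [norm_mul]
      calc ‖D (t * z)‖ * ‖z‖ ≤ ‖D (t * z)‖ * 1 := by gcongr
        _ ≤ M * (1 - t * ‖z‖) ^ (α - 1) := by linarith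
        _ ≤ M * (1 - t) ^ (α - 1) := by
          apply mul_le_mul_of_nonneg_left _ hM
          apply Real.rpow_le_rpow_of_nonpos (by linarith) _ (by linarith [hα.2])
          nlinarith [norm_nonneg z])
    (x := 1) ⟨by linarith [hs.1], le_refl _⟩
  simpa [Real.zero_rpow hα0.ne'] using this

lemma hardy {α M : ℝ} (hα : α ∈ Set.Ioo (0:ℝ) 1) (hM : 0 ≤ M) {S : ℂ → ℂ}
    (hS : ∀ w ∈ ball (0:ℂ) 1, ∃ D, HasDerivAt S D w ∧ ‖D‖ ≤ M * (1 - ‖w‖) ^ (α - 1)) :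
    ∃ L, 0 ≤ L ∧ ∀ z ∈ ball (0:ℂ) 1, ∀ w ∈ ball (0:ℂ) 1, ‖S z - S w‖ ≤ L * ‖z - w‖ ^ α := by
  have hα0 := hα.1
  refine ⟨2 * (M / α) + 2 * M, by positivity, ?_⟩
  intro z hz w hw
  rcases eq_or_ne z w with rfl | hne
  · simp [Real.zero_rpow hα0.ne']
  have hz1 : ‖z‖ < 1 := by simpa using hz
  have hw1 : ‖w‖ < 1 := by simpa using hw
  set s := ‖z - w‖ / 2 with hs
  have hs0 : 0 < s := by
    have := norm_pos_iff.2 (sub_ne_zero.2 hne); positivity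
  have hs1 : s ≤ 1 := by
    have := norm_sub_le z w; rw [hs]; linarith
  have e : ‖z - w‖ = 2 * s := by rw [hs]; ring
  have hz2 := hardy_radial hα hM hS hz ⟨hs0.le, hs1⟩
  have hw2 := hardy_radial hα hM hS hw ⟨hs0.le, hs1⟩
  have hsub : ∀ x ∈ closedBall (0:ℂ) (1 - s), x ∈ ball (0:ℂ) 1 := by
    intro x hx
    simp only [mem_closedBall, mem_ball, dist_zero_right] at hx ⊢
    linarith
  choose! D hD hDb using hS
  have hin : ∀ x ∈ ball (0:ℂ) 1, ((1 - s : ℝ) : ℂ) * x ∈ closedBall (0:ℂ) (1 - s) := by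
    intro x hx
    simp only [mem_closedBall, mem_ball, dist_zero_right, norm_mul, Complex.norm_real] at hx ⊢
    rw [Real.norm_of_nonneg (by linarith)]
    nlinarith [norm_nonneg x]
  have hmid := (convex_closedBall (0:ℂ) (1 - s)).norm_image_sub_le_of_norm_hasDerivWithin_le
    (f := S) (f' := D) (C := M * s ^ (α - 1))
    (fun x hx => (hD x (hsub x hx)).hasDerivWithinAt)
    (by
      intro x hx
      refine (hDb x (hsub x hx)).trans ?_
      apply mul_le_mul_of_nonneg_left _ hM
      apply Real.rpow_le_rpow_of_nonpos hs0 _ (by linarith [hα.2])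
      simp only [mem_closedBall, dist_zero_right] at hx
      linarith) (hin w hw) (hin z hz)
  have hmid' : ‖S ((1 - s : ℝ) * z) - S ((1 - s : ℝ) * w)‖ ≤ 2 * M * s ^ α := by
    refine hmid.trans ?_
    rw [← mul_sub, norm_mul, Complex.norm_real, Real.norm_of_nonneg (by linarith), e]
    calc M * s ^ (α - 1) * ((1 - s) * (2 * s)) ≤ M * s ^ (α - 1) * (1 * (2 * s)) := by
          gcongr; linarith
      _ = 2 * M * (s ^ (α - 1) * s ^ (1:ℝ)) := by rw [Real.rpow_one]; ring
      _ = _ := by rw [← Real.rpow_add hs0]; norm_num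
  have e2 : S z - S w = (S z - S ((1 - s : ℝ) * z)) + (S ((1 - s : ℝ) * z) - S ((1 - s : ℝ) * w))
    - (S w - S ((1 - s : ℝ) * w)) := by ring
  calc _ ≤ M / α * s ^ α + 2 * M * s ^ α + M / α * s ^ α := by
        rw [e2]
        refine (norm_sub_le _ _).trans ?_
        have := norm_add_le (S z - S ((1 - s : ℝ) * z)) (S ((1 - s : ℝ) * z) - S ((1 - s : ℝ) * w))
        linarith
    _ = (2 * (M / α) + 2 * M) * s ^ α := by ring
    _ ≤ _ := by
        gcongr
        rw [e]; linarith

lemma cont_of_holder {E F : Type*} [NormedAddCommGroup E] [NormedAddCommGroup F]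
    {α C : ℝ} (hα : 0 < α) {f : E → F} {K : Set E}
    (h : ∀ x ∈ K, ∀ y ∈ K, ‖f x - f y‖ ≤ C * ‖x - y‖ ^ α) : ContinuousOn f K := by
  intro x hx
  rw [ContinuousWithinAt, tendsto_iff_norm_sub_tendsto_zero]
  have ht : Filter.Tendsto (fun y => C * ‖y - x‖ ^ α) (nhdsWithin x K) (nhds 0) := by
    have : Continuous (fun y => C * ‖y - x‖ ^ α) := by
      apply Continuous.mul continuous_const
      apply Continuous.rpow_const (by fun_prop)
      intro _; right; exact hα.le
    have h2 := (this.tendsto x).mono_left (nhdsWithin_le_nhds (s := K))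
    simpa [Real.zero_rpow hα.ne'] using h2
  apply squeeze_zero' _ _ ht
  · filter_upwards with y using norm_nonneg _
  · filter_upwards [self_mem_nhdsWithin] with y hy using h y hy x hx

lemma extend {α L : ℝ} (hα : 0 < α) (hL : 0 ≤ L) {S : ℂ → ℂ}
    (h : ∀ z ∈ ball (0:ℂ) 1, ∀ w ∈ ball (0:ℂ) 1, ‖S z - S w‖ ≤ L * ‖z - w‖ ^ α) :
    ∃ F : ℂ → ℂ, (∀ z ∈ ball (0:ℂ) 1, F z = S z) ∧
      (∀ z ∈ closedBall (0:ℂ) 1, ∀ w ∈ closedBall (0:ℂ) 1, ‖F z - F w‖ ≤ L * ‖z - w‖ ^ α) ∧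
      ∃ r : ℕ → ℝ, (∀ n, 0 ≤ r n ∧ r n < 1) ∧ Filter.Tendsto r Filter.atTop (nhds 1) ∧
       ∀ z ∈ closedBall (0:ℂ) 1, Filter.Tendsto (fun n => S (r n * z)) Filter.atTop (nhds (F z)) := by
  obtain ⟨r, hr0, hr1, hr⟩ : ∃ r : ℕ → ℝ, (∀ n, 0 ≤ r n) ∧ (∀ n, r n < 1) ∧
      Filter.Tendsto r Filter.atTop (nhds 1) := by
    refine ⟨fun n => 1 - 1 / ((n:ℝ) + 1), ?_, ?_, ?_⟩
    · intro n
      have : 1 / ((n:ℝ) + 1) ≤ 1 := by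
        rw [div_le_one (by positivity)]; linarith [Nat.cast_nonneg (α := ℝ) n]
      linarith
    · intro n
      have : 0 < 1 / ((n:ℝ) + 1) := by positivity
      linarith
    · simpa using (tendsto_one_div_add_atTop_nhds_zero_nat (𝕜 := ℝ)).const_sub 1
  have hmem : ∀ n, ∀ z ∈ closedBall (0:ℂ) 1, (r n : ℂ) * z ∈ ball (0:ℂ) 1 := by
    intro n z hz
    simp only [mem_closedBall, mem_ball, dist_zero_right, norm_mul, Complex.norm_real] at hz ⊢
    rw [Real.norm_of_nonneg (hr0 n)]
    nlinarith [norm_nonneg z, hr0 n, hr1 n]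
  have hrc : ∀ z : ℂ, Filter.Tendsto (fun n => (r n : ℂ) * z) Filter.atTop (nhds z) := by
    intro z
    have := ((Complex.continuous_ofReal.tendsto 1).comp hr).mul_const z
    simpa using this
  have hS : ContinuousOn S (ball (0:ℂ) 1) := cont_of_holder hα h
  have hlim : ∀ z ∈ closedBall (0:ℂ) 1, ∃ l, Filter.Tendsto (fun n => S (r n * z)) Filter.atTop (nhds l) := by
    intro z hz
    apply cauchySeq_tendsto_of_complete
    have hcs : CauchySeq (fun n => (r n : ℂ) * z) := (hrc z).cauchySeq
    rw [Metric.cauchySeq_iff] at hcs ⊢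
    intro ε hε
    have hcont : Filter.Tendsto (fun t : ℝ => L * t ^ α) (nhds 0) (nhds 0) := by
      have : Continuous (fun t : ℝ => L * t ^ α) :=
        continuous_const.mul (continuous_id.rpow_const (fun _ => Or.inr hα.le))
      simpa [Real.zero_rpow hα.ne'] using this.tendsto 0
    obtain ⟨δ, hδ, hδ'⟩ := (Metric.tendsto_nhds_nhds.1 hcont) ε hε
    obtain ⟨N, hN⟩ := hcs δ hδ
    refine ⟨N, fun m hm n hn => ?_⟩
    have h1 := hN m hm n hn
    have h2 := hδ' (x := ‖(r m : ℂ) * z - r n * z‖) (by simpa [dist_eq_norm] using h1)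
    rw [dist_eq_norm]
    refine (h _ (hmem m z hz) _ (hmem n z hz)).trans_lt ?_
    rw [Real.dist_eq, sub_zero] at h2
    exact (le_abs_self _).trans_lt h2
  choose! F hF using hlim
  refine ⟨F, ?_, ?_, r, fun n => ⟨hr0 n, hr1 n⟩, hr, hF⟩
  · intro z hz
    refine tendsto_nhds_unique (hF z (ball_subset_closedBall hz)) ?_
    exact ((hS.continuousAt (isOpen_ball.mem_nhds hz)).tendsto).comp (hrc z)
  · intro z hz w hw
    have h1 := ((hF z hz).sub (hF w hw)).norm
    have h2 : Filter.Tendsto (fun n => L * ‖(r n : ℂ) * z - r n * w‖ ^ α) Filter.atTop (nhds (L * ‖z - w‖ ^ α)) :=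
      ((((hrc z).sub (hrc w)).norm).rpow_const (Or.inr hα.le)).const_mul L
    exact le_of_tendsto_of_tendsto' h1 h2 (fun n => h _ (hmem n z hz) _ (hmem n w hw))

/-- for `α ∈ (0,1)` and an `α`-Hölder `φ : ∂𝔻 → ℝ`, the Schwarz integral
`Sφ` is holomorphic on `𝔻`, extends `α`-Hölder continuously to `𝔻̄` with
`Re Sφ = φ` on the unit circle, `Im Sφ(0) = 0`, and `Sφ(0) = (1/2π)∫₀^{2π} φ(e^{iθ}) dθ`. -/
theorem schwarz_integral_properties
    (α : ℝ) (hα : α ∈ Set.Ioo (0 : ℝ) 1)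
    (φ : ℂ → ℝ) (hφ : HolderOn α φ (sphere (0 : ℂ) 1)) :
    DifferentiableOn ℂ (schwarz φ) (ball (0 : ℂ) 1) ∧
    (∃ F : ℂ → ℂ,
      (∀ ζ ∈ ball (0 : ℂ) 1, F ζ = schwarz φ ζ) ∧
      ContinuousOn F (closedBall (0 : ℂ) 1) ∧
      HolderOn α F (closedBall (0 : ℂ) 1) ∧
      (∀ θ : ℝ, (F (Complex.exp (θ * Complex.I))).re = φ (Complex.exp (θ * Complex.I)))) ∧
    (schwarz φ 0).im = 0 ∧
    schwarz φ 0 =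
      ((1 / (2 * Real.pi)) * ∫ θ in (0 : ℝ)..(2 * Real.pi), φ (Complex.exp (θ * Complex.I)) : ℝ) := by
  obtain ⟨C0, hC0⟩ := hφ
  obtain ⟨C, hC, hφ⟩ : ∃ C : ℝ, 0 ≤ C ∧ ∀ x ∈ sphere (0:ℂ) 1, ∀ y ∈ sphere (0:ℂ) 1,
      ‖φ x - φ y‖ ≤ C * ‖x - y‖ ^ α := by
    refine ⟨|C0|, abs_nonneg _, fun x hx y hy => (hC0 x hx y hy).trans ?_⟩
    gcongr
    exact le_abs_self _
  have hc : ContinuousOn φ (sphere (0:ℂ) 1) := cont_of_holder hα.1 hφ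
  obtain ⟨M, hM, hMd⟩ := deriv_bound hα hC hc hφ
  obtain ⟨L, hL, hLh⟩ := hardy hα hM hMd
  obtain ⟨F, hF1, hF2, r, hr01, hr, hF3⟩ := extend hα.1 hL hLh
  obtain ⟨M', hM'⟩ := re_bound hα hC hc hφ
  have h0 : schwarz φ 0 =
      ((1 / (2 * Real.pi)) * ∫ θ in (0 : ℝ)..(2 * Real.pi), φ (Complex.exp (θ * Complex.I)) : ℝ) := by
    simp only [schwarz, add_zero, sub_zero]
    rw [Complex.ofReal_mul, ← intervalIntegral.integral_ofReal]
    push_cast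
    congr 1
    apply intervalIntegral.integral_congr
    intro θ _
    simp [div_self (Complex.exp_ne_zero _)]
  refine ⟨?_, ⟨F, hF1, cont_of_holder hα.1 hF2, ⟨L, hF2⟩, ?_⟩, ?_, h0⟩
  · intro w hw
    obtain ⟨D, hD, _⟩ := hMd w hw
    exact hD.differentiableAt.differentiableWithinAt
  · intro θ
    set η := Complex.exp (θ * Complex.I) with hη
    have hηn : ‖η‖ = 1 := Complex.norm_exp_ofReal_mul_I θ
    have h1 := (Complex.continuous_re.tendsto _).comp (hF3 η (by simp [hηn]))
    refine tendsto_nhds_unique h1 ?_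
    rw [tendsto_iff_norm_sub_tendsto_zero]
    have h2 : Filter.Tendsto (fun n => M' * (1 - r n) ^ α) Filter.atTop (nhds 0) := by
      have := ((hr.const_sub 1).rpow_const (p := α) (Or.inr hα.1.le)).const_mul M'
      simpa [Real.zero_rpow hα.1.ne'] using this
    refine squeeze_zero (fun _ => norm_nonneg _) (fun n => ?_) h2
    have hn : ‖(r n : ℂ) * η‖ = r n := by
      rw [norm_mul, hηn, mul_one, Complex.norm_real, Real.norm_of_nonneg (hr01 n).1]
    have := hM' (r n * η) (by simpa [hηn, abs_of_nonneg (hr01 n).1] using (hr01 n).2) η (by simp [hηn]) (by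
      have e : (r n : ℂ) * η - η = ((r n - 1 : ℝ) : ℂ) * η := by push_cast; ring
      rw [hn, e, norm_mul, hηn, mul_one, Complex.norm_real, Real.norm_eq_abs,
        abs_of_nonpos (by linarith [(hr01 n).2])]
      linarith)
    rw [hn] at this
    exact this
  · rw [h0, Complex.ofReal_im]
end
end

section
/- Let α ∈ (0,1) and let f : 𝔻̄ → ℂ be α-Hölder on the closed unit disc. Then the Cauchy–Green transform Tf is real-differentiable at every point ζ of the open unit disc 𝔻 and solves the ∂̄-equation there: ∂(Tf)/∂ζ̄ (ζ) = f(ζ) for all ζ ∈ 𝔻. -/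
open Metric MeasureTheory

noncomputable section

/-- The Cauchy–Green transform `Tf(ζ) = −(1/π)∬_𝔻 f(ω)/(ω−ζ) dA(ω)`. -/
noncomputable def cauchyGreen (f : ℂ → ℂ) (ζ : ℂ) : ℂ :=
  -(1 / Real.pi : ℂ) * ∫ ω in ball (0 : ℂ) 1, f ω / (ω - ζ)

/-- The Wirtinger derivative `∂f/∂ζ̄ = ½(∂f/∂ξ + i ∂f/∂η)`. -/
noncomputable def wdbar (f : ℂ → ℂ) (ζ : ℂ) : ℂ :=
  (1 / 2 : ℂ) * (fderiv ℝ f ζ 1 + Complex.I * fderiv ℝ f ζ Complex.I)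

theorem cg_int_ball (s : ℝ) (hs : -2 < s) (R : ℝ) :
    IntegrableOn (fun x : ℂ => ‖x‖ ^ s) (ball (0 : ℂ) R) := by
  rw [integrableOn_fun_norm_addHaar volume (f := fun y : ℝ => y ^ s)]
  have h1 : IntegrableOn (fun y : ℝ => y ^ (s + 1)) (Set.Ioo 0 R) := by
    rcases le_or_gt R 0 with h | h
    · simp [Set.Ioo_eq_empty (not_lt.mpr h)]
    · have := (intervalIntegral.intervalIntegrable_rpow' (a := 0) (b := R) (r := s + 1)
        (by linarith))
      rw [intervalIntegrable_iff_integrableOn_Ioo_of_le h.le] at this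
      exact this
  refine h1.congr_fun ?_ measurableSet_Ioo
  intro y hy
  simp only [Complex.finrank_real_complex, smul_eq_mul]
  rw [Real.rpow_add hy.1]
  simp [mul_comm]

theorem cg_int_ball' (s : ℝ) (hs : -2 < s) (ζ : ℂ) (R : ℝ) :
    IntegrableOn (fun x : ℂ => ‖x - ζ‖ ^ s) (ball ζ R) := by
  have h := cg_int_ball s hs R
  rw [← integrable_indicator_iff measurableSet_ball] at h ⊢
  refine (h.comp_sub_right ζ).congr (Filter.Eventually.of_forall fun x => ?_)
  simp [Set.indicator, dist_eq_norm]

theorem cg_int_ball'' (s : ℝ) (hs : -2 < s) (ζ : ℂ) :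
    IntegrableOn (fun x : ℂ => ‖x - ζ‖ ^ s) (ball 0 1) := by
  refine (cg_int_ball' s hs ζ (1 + ‖ζ‖)).mono_set ?_
  intro x hx
  simp only [mem_ball, dist_eq_norm, sub_zero] at hx ⊢
  linarith [norm_sub_le x ζ]

theorem cg_int_plane (α : ℝ) (hα : α ∈ Set.Ioo (0 : ℝ) 1) :
    Integrable (fun v : ℂ => ‖v‖ ^ (α - 2) * ‖v - 1‖⁻¹) := by
  obtain ⟨h0, h1⟩ := hα
  have i1 : Integrable ((ball (0 : ℂ) (1/2)).indicator fun x : ℂ => ‖x‖ ^ (α - 2)) :=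
    (integrable_indicator_iff measurableSet_ball).2 (cg_int_ball (α - 2) (by linarith) _)
  have i2 : Integrable ((ball (1 : ℂ) (1/2)).indicator fun x : ℂ => ‖x - 1‖ ^ (-1 : ℝ)) :=
    (integrable_indicator_iff measurableSet_ball).2 (cg_int_ball' (-1) (by linarith) _ _)
  have i3 : Integrable (fun x : ℂ => (1 + ‖x‖) ^ (-(3 - α))) :=
    integrable_one_add_norm (by simp; linarith)
  refine (((i1.const_mul 2).add (i2.const_mul 4)).add (i3.const_mul 45)).mono' ?_ ?_
  · apply Measurable.aestronglyMeasurable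
    fun_prop
  refine Filter.Eventually.of_forall fun v => ?_
  rw [Real.norm_of_nonneg (by positivity)]
  simp only [Pi.add_apply, Set.indicator, mem_ball, dist_eq_norm, sub_zero]
  have p3 : 0 ≤ (1 + ‖v‖) ^ (-(3 - α)) := by positivity
  have p2 : 0 ≤ ‖v - 1‖ ^ (-1 : ℝ) := by positivity
  have p1 : 0 ≤ ‖v‖ ^ (α - 2) := by positivity
  have t1 : 1 ≤ ‖v‖ + ‖v - 1‖ := by
    have := norm_sub_le v (v - 1); simpa using this
  have t2 : ‖v‖ ≤ ‖v - 1‖ + 1 := by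
    have := norm_add_le (v - 1) 1; simpa using this
  by_cases c1 : ‖v‖ < 1/2
  · have : ‖v - 1‖⁻¹ ≤ 2 := by
      rw [inv_le_comm₀ (by linarith) (by norm_num)]; linarith
    rw [if_pos c1]
    have : ‖v‖ ^ (α - 2) * ‖v - 1‖⁻¹ ≤ ‖v‖ ^ (α - 2) * 2 := by gcongr
    split_ifs <;> nlinarith
  rw [if_neg c1]
  push Not at c1
  by_cases c2 : ‖v - 1‖ < 1/2
  · rw [if_pos c2]
    have : ‖v‖ ^ (α - 2) ≤ 4 := by
      calc ‖v‖ ^ (α - 2) ≤ (1/2 : ℝ) ^ (α - 2) :=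
            Real.rpow_le_rpow_of_nonpos (by norm_num) c1 (by linarith)
        _ ≤ (1/2 : ℝ) ^ (-2 : ℝ) :=
            Real.rpow_le_rpow_of_exponent_ge (by norm_num) (by norm_num) (by linarith)
        _ = 4 := by rw [Real.rpow_neg (by norm_num)]; norm_num
    rw [Real.rpow_neg_one] at *
    nlinarith
  rw [if_neg c2]
  push Not at c2
  have q1 : ‖v‖ ^ (α - 2) ≤ 9 * (1 + ‖v‖) ^ (α - 2) := by
    calc ‖v‖ ^ (α - 2) ≤ ((1/3) * (1 + ‖v‖)) ^ (α - 2) :=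
          Real.rpow_le_rpow_of_nonpos (by positivity) (by linarith) (by linarith)
      _ = (1/3 : ℝ) ^ (α - 2) * (1 + ‖v‖) ^ (α - 2) :=
          Real.mul_rpow (by norm_num) (by positivity)
      _ ≤ (1/3 : ℝ) ^ (-2 : ℝ) * (1 + ‖v‖) ^ (α - 2) := by
          gcongr ?_ * _
          exact Real.rpow_le_rpow_of_exponent_ge (by norm_num) (by norm_num) (by linarith)
      _ = _ := by rw [Real.rpow_neg (by norm_num)]; norm_num
  have q2 : ‖v - 1‖⁻¹ ≤ 5 * (1 + ‖v‖)⁻¹ := by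
    rw [← div_eq_mul_inv, inv_le_iff_one_le_mul₀ (by linarith), div_mul_eq_mul_div,
      le_div_iff₀ (by positivity)]
    linarith
  have q3 : (1 + ‖v‖) ^ (-(3 - α)) = (1 + ‖v‖) ^ (α - 2) * (1 + ‖v‖)⁻¹ := by
    rw [← Real.rpow_neg_one, ← Real.rpow_add (by positivity)]; congr 1; ring
  calc _ ≤ (9 * (1 + ‖v‖) ^ (α - 2)) * (5 * (1 + ‖v‖)⁻¹) := by gcongr
    _ = _ := by rw [q3]; ring

theorem cg_scale (α : ℝ) (hα : α ∈ Set.Ioo (0 : ℝ) 1) (h : ℂ) (hh : h ≠ 0) :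
    Integrable (fun u : ℂ => ‖u‖ ^ (α - 2) * ‖u - h‖⁻¹) ∧ ∫ u : ℂ, ‖u‖ ^ (α - 2) * ‖u - h‖⁻¹ =
      ‖h‖ ^ (α - 1) * ∫ v : ℂ, ‖v‖ ^ (α - 2) * ‖v - 1‖⁻¹ := by
  have hp : 0 < ‖h‖ := norm_pos_iff.2 hh
  set c : Circle := ⟨h / ‖h‖, by simp [Submonoid.unitSphere, hh]⟩ with hc
  have hch : (c : ℂ) * ‖h‖ = h := by
    simp [hc, hh]
  have e0 : ∀ u : ℂ, ‖rotation c u‖ ^ (α - 2) * ‖rotation c u - h‖⁻¹ =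
      ‖u‖ ^ (α - 2) * ‖u - ‖h‖‖⁻¹ := by
    intro u
    rw [(rotation c).norm_map, rotation_apply]
    congr 2
    rw [← one_mul ‖u - ‖h‖‖, ← Circle.norm_coe c, ← norm_mul, mul_sub, hch]
  have e1 : ∫ u : ℂ, ‖u‖ ^ (α - 2) * ‖u - h‖⁻¹ =
      ∫ u : ℂ, ‖u‖ ^ (α - 2) * ‖u - ‖h‖‖⁻¹ := by
    rw [← (rotation c).measurePreserving.integral_comp
      (rotation c).toHomeomorph.measurableEmbedding]
    simp only [e0]
  have e2 := Measure.integral_comp_smul (volume : Measure ℂ)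
    (fun u : ℂ => ‖u‖ ^ (α - 2) * ‖u - ‖h‖‖⁻¹) ‖h‖
  have e3 : ∀ v : ℂ, ‖‖h‖ • v‖ ^ (α - 2) * ‖‖h‖ • v - ‖h‖‖⁻¹ =
      ‖h‖ ^ (α - 3) * (‖v‖ ^ (α - 2) * ‖v - 1‖⁻¹) := by
    intro v
    have : ‖h‖ • v - (‖h‖ : ℂ) = ‖h‖ • (v - 1) := by simp [mul_sub]
    rw [this, norm_smul, norm_smul, norm_norm, Real.mul_rpow (by positivity) (by positivity),
      mul_inv, show α - 3 = (α - 2) + (-1) by ring, Real.rpow_add hp, Real.rpow_neg_one]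
    ring
  refine ⟨?_, ?_⟩
  · rw [← (rotation c).measurePreserving.integrable_comp_emb
      (rotation c).toHomeomorph.measurableEmbedding]
    simp only [Function.comp_def, e0]
    rw [← integrable_comp_smul_iff volume _ hp.ne']
    simp only [e3]
    exact (cg_int_plane α hα).const_mul _
  rw [e1]
  simp only [e3, integral_const_mul, Complex.finrank_real_complex, smul_eq_mul] at e2
  rw [abs_of_pos (by positivity), eq_inv_mul_iff_mul_eq₀ (by positivity)] at e2
  rw [← e2, ← mul_assoc]
  congr 1
  rw [← Real.rpow_natCast, ← Real.rpow_add hp]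
  congr 1; push_cast; ring

theorem cg_polar_integrable (F : ℂ → ℂ) (hF : Integrable F) :
    IntegrableOn (fun p : ℝ × ℝ => p.1 • F (Complex.polarCoord.symm p)) polarCoord.target := by
  have h1 : Integrable (fun p : ℝ × ℝ => F (Complex.measurableEquivRealProd.symm p)) :=
    (Complex.volume_preserving_equiv_real_prod.symm).integrable_comp_of_integrable hF
  have h2 := h1.integrableOn (s := polarCoord.symm '' polarCoord.target)
  rw [integrableOn_image_iff_integrableOn_abs_det_fderiv_smul volume
    polarCoord.open_target.measurableSet
    (fun p _ ↦ (hasFDerivAt_polarCoord_symm p).hasFDerivWithinAt) polarCoord.symm.injOn] at h2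
  refine h2.congr_fun ?_ polarCoord.open_target.measurableSet
  intro p hp
  simp only [det_fderivPolarCoordSymm]
  rw [abs_of_pos hp.1]; rfl

theorem cg_avg_in (ζ : ℂ) (r : ℝ) (hr : 0 < r) (h : r < ‖ζ‖) :
    Real.circleAverage (fun ω => (ω - ζ)⁻¹) 0 r = -ζ⁻¹ := by
  have hne : ∀ z ∈ closedBall (0 : ℂ) |r|, z - ζ ≠ 0 := by
    intro z hz h0
    rw [sub_eq_zero] at h0
    subst h0
    rw [abs_of_pos hr, mem_closedBall, dist_zero_right] at hz
    linarith
  rw [circleAverage_of_differentiable_on_off_countable Set.countable_empty]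
  · rw [zero_sub, inv_neg]
  · exact ContinuousOn.inv₀ (by fun_prop) hne
  · intro z hz
    exact DifferentiableAt.inv (by fun_prop) (hne z (ball_subset_closedBall hz.1))

theorem cg_avg_out (ζ : ℂ) (r : ℝ) (h : ‖ζ‖ < r) :
    Real.circleAverage (fun ω => (ω - ζ)⁻¹) 0 r = 0 := by
  have hr : 0 < r := (norm_nonneg _).trans_lt h
  have hne : ∀ z ∈ closedBall (0 : ℂ) |r|, (r:ℂ)^2 - ζ * starRingEnd ℂ (starRingEnd ℂ z) ≠ 0 := by
    intro z hz h0
    rw [abs_of_pos hr, mem_closedBall, dist_zero_right] at hz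
    simp only [Complex.conj_conj] at h0
    have := congrArg norm (sub_eq_zero.1 h0)
    simp only [norm_pow, Complex.norm_real, norm_mul, Real.norm_of_nonneg hr.le] at this
    nlinarith [norm_nonneg ζ, norm_nonneg z]
  have hne' : ∀ z ∈ closedBall (0 : ℂ) |r|, (r:ℂ)^2 - starRingEnd ℂ ζ * z ≠ 0 := by
    intro z hz h0
    have := hne (starRingEnd ℂ z) (by simpa using hz)
    apply this
    have := congrArg (starRingEnd ℂ) h0
    simpa using this
  have key : Real.circleAverage (fun ω => ω / ((r:ℂ)^2 - starRingEnd ℂ ζ * ω)) 0 r = 0 := by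
    rw [circleAverage_of_differentiable_on_off_countable Set.countable_empty]
    · simp
    · exact ContinuousOn.div₀ (by fun_prop) (by fun_prop) hne'
    · intro z hz
      exact DifferentiableAt.div (by fun_prop) (by fun_prop)
        (hne' z (ball_subset_closedBall hz.1))
  have e : Real.circleAverage (fun ω => (ω - ζ)⁻¹) 0 r =
      starRingEnd ℂ (Real.circleAverage (fun ω => ω / ((r:ℂ)^2 - starRingEnd ℂ ζ * ω)) 0 r) := by
    have : Real.circleAverage (fun ω => (ω - ζ)⁻¹) 0 r =
      Real.circleAverage (fun ω => starRingEnd ℂ (ω / ((r:ℂ)^2 - starRingEnd ℂ ζ * ω))) 0 r := by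
      apply Real.circleAverage_congr_sphere
      intro z hz
      have hz' : ‖z‖ = r := by simpa [abs_of_pos hr] using hz
      have hz2 : z * starRingEnd ℂ z = (r:ℂ)^2 := by rw [Complex.mul_conj']; rw [hz']
      have hz0 : starRingEnd ℂ z ≠ 0 := by
        intro h0
        have h1 : z = 0 := by simpa using h0
        rw [h1, norm_zero] at hz'
        linarith
      simp only [map_div₀, map_sub, map_pow, Complex.conj_ofReal, map_mul, Complex.conj_conj]
      rw [← hz2, ← sub_mul, div_mul_cancel_right₀ hz0]
    rw [this]
    simp only [Real.circleAverage_def]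
    rw [Complex.real_smul, Complex.real_smul, map_mul, Complex.conj_ofReal, intervalIntegral.integral_of_le (by positivity),
      intervalIntegral.integral_of_le (by positivity), integral_conj]
  rw [e, key, map_zero]

theorem cg_one (ζ : ℂ) (hζ : ζ ∈ ball (0 : ℂ) 1)
    (hi : IntegrableOn (fun ω : ℂ => (ω - ζ)⁻¹) (ball 0 1)) :
    ∫ ω in ball (0 : ℂ) 1, (ω - ζ)⁻¹ = -(Real.pi : ℂ) * starRingEnd ℂ ζ := by
  have hζ' : ‖ζ‖ < 1 := by simpa using hζ
  rw [← integral_indicator measurableSet_ball]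
  have hi' := (integrable_indicator_iff measurableSet_ball).2 hi
  have hp := cg_polar_integrable _ hi'
  rw [← Complex.integral_comp_polarCoord_symm]
  rw [polarCoord_target] at *
  rw [Measure.volume_eq_prod] at *
  rw [setIntegral_prod _ hp]
  have inner : ∀ r ∈ Set.Ioi (0:ℝ), r ≠ ‖ζ‖ →
      ∫ θ in Set.Ioo (-Real.pi) Real.pi, r • (ball (0:ℂ) 1).indicator (fun ω => (ω - ζ)⁻¹)
        (Complex.polarCoord.symm (r, θ)) =
      (Set.Ioo 0 ‖ζ‖).indicator (fun r : ℝ => r • (-(2 * Real.pi) * ζ⁻¹ : ℂ)) r := by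
    intro r hr hne
    have hr : 0 < r := hr
    have e0 : ∀ θ : ℝ, Complex.polarCoord.symm (r, θ) = circleMap 0 r θ := by
      intro θ; simp [circleMap, Complex.exp_mul_I]
    have e1 : ∀ θ : ℝ, (ball (0:ℂ) 1).indicator (fun ω => (ω - ζ)⁻¹)
        (Complex.polarCoord.symm (r, θ)) =
        if r < 1 then (circleMap 0 r θ - ζ)⁻¹ else 0 := by
      intro θ
      rw [e0]
      simp [Set.indicator, abs_of_pos hr]
    simp only [e1]
    have e2 : ∫ θ in Set.Ioo (-Real.pi) Real.pi, (circleMap 0 r θ - ζ)⁻¹ =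
        (2 * Real.pi : ℝ) • Real.circleAverage (fun ω => (ω - ζ)⁻¹) 0 r := by
      rw [Real.circleAverage_eq_integral_add (-Real.pi),
        intervalIntegral.integral_comp_add_right (fun θ => (circleMap 0 r θ - ζ)⁻¹),
        smul_inv_smul₀ (by positivity),
        intervalIntegral.integral_of_le (by linarith [Real.pi_pos]), integral_Ioc_eq_integral_Ioo]
      congr 3 <;> ring_nf
    rw [integral_smul]
    rcases lt_or_gt_of_ne hne with h | h
    · rw [Set.indicator_of_mem (by exact ⟨hr, h⟩)]
      simp only [if_pos (h.trans hζ')]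
      rw [e2, cg_avg_in ζ r hr h]
      simp
    · rw [Set.indicator_of_notMem (by simp [h.le])]
      split_ifs
      · rw [e2, cg_avg_out ζ r h]; simp
      · simp
  have hae : ∀ᵐ r : ℝ, r ≠ ‖ζ‖ := by
    simp [ae_iff]
  rw [setIntegral_congr_ae (g := (Set.Ioo 0 ‖ζ‖).indicator
    (fun r : ℝ => r • (-(2 * Real.pi) * ζ⁻¹ : ℂ))) measurableSet_Ioi
    (by filter_upwards [hae] with r h1 h2 using inner r h2 h1)]
  rw [setIntegral_indicator measurableSet_Ioo,
    Set.inter_eq_right.2 (fun x hx => hx.1), integral_smul_const,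
    ← integral_Ioc_eq_integral_Ioo, ← intervalIntegral.integral_of_le (norm_nonneg _),
    integral_id]
  rcases eq_or_ne ζ 0 with rfl | h0
  · simp
  · have : (‖ζ‖ : ℂ)^2 = ζ * starRingEnd ℂ ζ := by rw [Complex.mul_conj']
    rw [Complex.real_smul]
    push_cast
    rw [this]
    field_simp
    ring

theorem cg_inv_int (z : ℂ) : IntegrableOn (fun ω : ℂ => (ω - z)⁻¹) (ball 0 1) := by
  refine (cg_int_ball'' (-1) (by norm_num) z).mono' ?_ ?_
  · exact Measurable.aestronglyMeasurable (by fun_prop)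
  · exact Filter.Eventually.of_forall fun ω => by simp [Real.rpow_neg_one]

theorem cg_deriv (α : ℝ) (hα : α ∈ Set.Ioo (0 : ℝ) 1) (g : ℂ → ℂ) (C : ℝ) (hC : 0 ≤ C) (ζ : ℂ)
    (hm : AEStronglyMeasurable g (volume.restrict (ball 0 1)))
    (hg : ∀ ω ∈ ball (0 : ℂ) 1, ‖g ω‖ ≤ C * ‖ω - ζ‖ ^ α)
    (hgi : ∀ z, IntegrableOn (fun ω => g ω / (ω - z)) (ball 0 1)) :
    HasDerivAt (fun z => ∫ ω in ball (0 : ℂ) 1, g ω / (ω - z))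
      (∫ ω in ball (0 : ℂ) 1, g ω / (ω - ζ) ^ 2) ζ := by
  have h0 := hα.1
  have hpt : ∀ ω ∈ ball (0 : ℂ) 1, ‖g ω / (ω - ζ) ^ 2‖ ≤ C * ‖ω - ζ‖ ^ (α - 2) := by
    intro ω hω
    rcases eq_or_ne ω ζ with rfl | hne
    · simp; positivity
    have hp : 0 < ‖ω - ζ‖ := norm_pos_iff.2 (sub_ne_zero.2 hne)
    rw [norm_div, norm_pow, Real.rpow_sub hp, Real.rpow_two, ← mul_div_assoc]
    gcongr
    exact hg ω hω
  have i2 : IntegrableOn (fun ω => g ω / (ω - ζ) ^ 2) (ball 0 1) := by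
    refine ((cg_int_ball'' (α - 2) (by linarith) ζ).const_mul C).mono' ?_ ?_
    · simp only [div_eq_mul_inv]
      exact hm.mul (Measurable.aestronglyMeasurable (by fun_prop))
    · exact (ae_restrict_iff' measurableSet_ball).2 (Filter.Eventually.of_forall hpt)
  set K : ℝ := ∫ v : ℂ, ‖v‖ ^ (α - 2) * ‖v - 1‖⁻¹ with hK
  have hbound : ∀ h : ℂ, ‖(∫ ω in ball (0 : ℂ) 1, g ω / (ω - (ζ + h))) -
      (∫ ω in ball (0 : ℂ) 1, g ω / (ω - ζ)) -
      h • (∫ ω in ball (0 : ℂ) 1, g ω / (ω - ζ) ^ 2)‖ ≤ (C * K) * ‖h‖ ^ (1 + α) := by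
    intro h
    rcases eq_or_ne h 0 with rfl | hh
    · simp [Real.zero_rpow (by linarith : 1 + α ≠ 0)]
    have hp : 0 < ‖h‖ := norm_pos_iff.2 hh
    obtain ⟨s1, s2⟩ := cg_scale α hα h hh
    have d1 : Integrable (fun ω : ℂ => (C * ‖h‖ ^ 2) *
        (‖ω - ζ‖ ^ (α - 2) * ‖ω - ζ - h‖⁻¹)) := (s1.comp_sub_right ζ).const_mul _
    have d2 : ∫ ω : ℂ, (C * ‖h‖ ^ 2) * (‖ω - ζ‖ ^ (α - 2) * ‖ω - ζ - h‖⁻¹)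
        = (C * K) * ‖h‖ ^ (1 + α) := by
      rw [integral_const_mul,
        integral_sub_right_eq_self (fun u : ℂ => ‖u‖ ^ (α - 2) * ‖u - h‖⁻¹) ζ, s2,
        show 1 + α = 2 + (α - 1) by ring, Real.rpow_add hp, Real.rpow_two]
      ring
    have i3 : IntegrableOn (fun ω => g ω / (ω - (ζ + h)) - g ω / (ω - ζ)) (ball 0 1) :=
      (hgi _).sub (hgi _)
    rw [smul_eq_mul, ← integral_const_mul, ← integral_sub (hgi _) (hgi _),
      ← integral_sub i3 (i2.const_mul h), ← d2]
    refine le_trans (norm_integral_le_of_norm_le d1.integrableOn ?_)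
      (setIntegral_le_integral d1 (Filter.Eventually.of_forall fun ω => by positivity))
    have n1 : ∀ᵐ ω : ℂ, ω ≠ ζ := by simp [ae_iff]
    have n2 : ∀ᵐ ω : ℂ, ω ≠ ζ + h := by simp [ae_iff]
    rw [ae_restrict_iff' measurableSet_ball]
    filter_upwards [n1, n2] with ω a1 a2 hω
    have b1 : ω - ζ ≠ 0 := sub_ne_zero.2 a1
    have b2 : ω - ζ - h ≠ 0 := by rw [sub_sub]; exact sub_ne_zero.2 a2
    have : g ω / (ω - (ζ + h)) - g ω / (ω - ζ) - h * (g ω / (ω - ζ) ^ 2) =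
        h ^ 2 * (g ω / (ω - ζ) ^ 2) * (ω - ζ - h)⁻¹ := by
      rw [← sub_sub]
      field_simp
      ring
    rw [this, norm_mul, norm_mul, norm_pow, norm_inv]
    calc _ ≤ ‖h‖ ^ 2 * (C * ‖ω - ζ‖ ^ (α - 2)) * ‖ω - ζ - h‖⁻¹ := by
          gcongr; exact hpt ω hω
      _ = _ := by ring
  rw [hasDerivAt_iff_isLittleO_nhds_zero]
  refine (Asymptotics.IsBigO.of_bound (C * K) (g := fun h : ℂ => ‖h‖ ^ (1 + α)) ?_).trans_isLittleO ?_
  · refine Filter.Eventually.of_forall fun h => ?_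
    rw [Real.norm_of_nonneg (by positivity : 0 ≤ ‖h‖ ^ (1 + α))]
    exact hbound h
  · rw [Asymptotics.isLittleO_iff]
    intro c hc
    have ht : Filter.Tendsto (fun h : ℂ => ‖h‖ ^ α) (nhds 0) (nhds 0) := by
      have : ContinuousAt (fun h : ℂ => ‖h‖ ^ α) 0 :=
        (continuous_norm.continuousAt).rpow_const (Or.inr h0.le)
      simpa [ContinuousAt, Real.zero_rpow h0.ne'] using this
    filter_upwards [ht.eventually (gt_mem_nhds hc)] with h hh
    rw [Real.norm_of_nonneg (by positivity : 0 ≤ ‖h‖ ^ (1 + α))]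
    rcases eq_or_ne h 0 with rfl | hne
    · simp [Real.zero_rpow (by linarith : 1 + α ≠ 0)]
    rw [Real.rpow_add (norm_pos_iff.2 hne), Real.rpow_one, mul_comm]
    gcongr

/-- for `α`-Hölder `f` on `𝔻̄`, the Cauchy–Green transform `Tf` is
real-differentiable on `𝔻` and solves the `∂̄`-equation: `∂(Tf)/∂ζ̄ = f` on `𝔻`. -/
theorem cauchyGreen_solves_dbar
    (α : ℝ) (hα : α ∈ Set.Ioo (0 : ℝ) 1)
    (f : ℂ → ℂ) (hf : HolderOn α f (closedBall (0 : ℂ) 1)) :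
    ∀ ζ ∈ ball (0 : ℂ) 1,
      DifferentiableAt ℝ (cauchyGreen f) ζ ∧ wdbar (cauchyGreen f) ζ = f ζ := by
  intro ζ hζ
  obtain ⟨C₀, hC₀⟩ := hf
  have h0 := hα.1
  set C := |C₀| with hCdef
  have hC : 0 ≤ C := abs_nonneg _
  have hH : ∀ x ∈ closedBall (0 : ℂ) 1, ∀ y ∈ closedBall (0 : ℂ) 1,
      ‖f x - f y‖ ≤ C * ‖x - y‖ ^ α := fun x hx y hy =>
    (hC₀ x hx y hy).trans (by gcongr; exact le_abs_self _)
  have hcont : ContinuousOn f (closedBall (0 : ℂ) 1) := by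
    intro x hx
    rw [ContinuousWithinAt, tendsto_iff_norm_sub_tendsto_zero]
    have : ContinuousAt (fun y : ℂ => C * ‖y - x‖ ^ α) x := by
      refine ContinuousAt.mul continuousAt_const (ContinuousAt.rpow_const ?_ (Or.inr h0.le))
      fun_prop
    have ht : Filter.Tendsto (fun y : ℂ => C * ‖y - x‖ ^ α) (nhdsWithin x (closedBall 0 1))
        (nhds 0) := by
      have h2 := this.tendsto
      simp only [sub_self, norm_zero, Real.zero_rpow h0.ne', mul_zero] at h2
      exact h2.mono_left nhdsWithin_le_nhds
    refine squeeze_zero' (Filter.Eventually.of_forall fun _ => norm_nonneg _) ?_ ht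
    filter_upwards [self_mem_nhdsWithin] with y hy using hH y hy x hx
  have hζc := ball_subset_closedBall hζ
  have hm : AEStronglyMeasurable (fun ω => f ω - f ζ) (volume.restrict (ball (0 : ℂ) 1)) :=
    ((hcont.mono ball_subset_closedBall).sub continuousOn_const).aestronglyMeasurable
      measurableSet_ball
  have hg : ∀ ω ∈ ball (0 : ℂ) 1, ‖f ω - f ζ‖ ≤ C * ‖ω - ζ‖ ^ α := fun ω hω =>
    hH ω (ball_subset_closedBall hω) ζ hζc
  have hgi : ∀ z, IntegrableOn (fun ω => (f ω - f ζ) / (ω - z)) (ball 0 1) := by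
    intro z
    simp only [div_eq_mul_inv]
    refine (cg_inv_int z).bdd_mul (c := C * 2 ^ α) hm ?_
    rw [ae_restrict_iff' measurableSet_ball]
    refine Filter.Eventually.of_forall fun ω hω => (hg ω hω).trans ?_
    gcongr
    simp only [mem_ball, dist_zero_right] at hω hζ
    linarith [norm_sub_le ω ζ]
  have hd := cg_deriv α hα (fun ω => f ω - f ζ) C hC ζ hm hg hgi
  set D := ∫ ω in ball (0 : ℂ) 1, (f ω - f ζ) / (ω - ζ) ^ 2
  have hpi : (Real.pi : ℂ) ≠ 0 := by exact_mod_cast Real.pi_ne_zero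
  have hev : cauchyGreen f =ᶠ[nhds ζ] fun z =>
      f ζ * starRingEnd ℂ z +
        -(1 / Real.pi : ℂ) * ∫ ω in ball (0 : ℂ) 1, (f ω - f ζ) / (ω - z) := by
    filter_upwards [isOpen_ball.mem_nhds hζ] with z hz
    have e : ∀ ω, f ω / (ω - z) = (f ω - f ζ) / (ω - z) + f ζ * (ω - z)⁻¹ := by
      intro ω; rw [div_eq_mul_inv, div_eq_mul_inv]; ring
    simp only [cauchyGreen, e]
    rw [integral_add (hgi z) ((cg_inv_int z).const_mul _), integral_const_mul,
      cg_one z hz (cg_inv_int z)]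
    field_simp
    ring
  have hfd : HasFDerivAt (cauchyGreen f)
      (f ζ • (Complex.conjCLE : ℂ →L[ℝ] ℂ) +
        ((ContinuousLinearMap.toSpanSingleton ℂ (-(1 / Real.pi : ℂ) * D)).restrictScalars ℝ)) ζ := by
    refine HasFDerivAt.congr_of_eventuallyEq ?_ hev
    exact (Complex.conjCLE.hasFDerivAt.const_smul (f ζ)).add
      ((hd.const_mul (-(1 / Real.pi : ℂ))).hasFDerivAt.restrictScalars ℝ)
  refine ⟨hfd.differentiableAt, ?_⟩
  rw [wdbar, hfd.fderiv]
  simp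
  linear_combination (-(1/2) * f ζ - (1/2) * ((Real.pi : ℂ)⁻¹ * D)) * Complex.I_sq
end
end

section
/- Let α ∈ (0,1) and let φ : ∂𝔻 → ℝ be α-Hölder with φ = 0 on the closed upper semicircle b𝔻⁺ and φ < 0 on the open lower semicircle b𝔻⁻. For t ∈ (0,∞)ⁿ and c ∈ ℝⁿ define the disc z(c,t) : 𝔻̄ → ℂⁿ by z(c,t)(ζ)_j := t_j·Sφ(ζ) + i·c_j (using the continuous extension of Sφ to 𝔻̄), j = 1,…,n. Then: (i) each z(c,t) is holomorphic on 𝔻 and continuous on 𝔻̄; (ii) z(c,t)(𝔻) ⊂ W := {w ∈ ℂⁿ : Re w_j < 0 for all j} and z(c,t)(b𝔻⁻) ⊂ W; (iii) z(c,t)(b𝔻⁺) ⊂ iℝⁿ := {w ∈ ℂⁿ : Re w_j = 0 for all j}; (iv) the evaluation map (c,t) ↦ z(c,t)(0) is a bijection from ℝⁿ × (0,∞)ⁿ onto W, so every point of the wedge W is the centre of exactly one disc of the family. -/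
open Metric

noncomputable section

/-- The closed upper semicircle `b𝔻⁺ = {e^{iθ} : θ ∈ [0,π]}`. -/
def upperArc : Set ℂ := {w | ∃ θ ∈ Set.Icc (0 : ℝ) Real.pi, w = Complex.exp (θ * Complex.I)}

/-- The open lower semicircle `b𝔻⁻ = ∂𝔻 ∖ b𝔻⁺`. -/
def lowerArc : Set ℂ := sphere (0 : ℂ) 1 \ upperArc

/-- The model Bishop disc `z(c,t)(ζ)_j = t_j·F(ζ) + i·c_j`, where `F` is the continuous
extension of the Schwarz integral `Sφ` to the closed disc. -/
def modelDisc {n : ℕ} (F : ℂ → ℂ) (c t : Fin n → ℝ) (ζ : ℂ) : Fin n → ℂ :=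
  fun j => (t j : ℂ) * F ζ + Complex.I * (c j : ℂ)

lemma aux_cont {α : ℝ} (hα : 0 < α) {φ : ℂ → ℝ} (h : HolderOn α φ (sphere (0 : ℂ) 1)) :
    ContinuousOn φ (sphere (0 : ℂ) 1) := by
  obtain ⟨C, hC⟩ := h
  intro x hx
  unfold ContinuousWithinAt
  rw [tendsto_iff_norm_sub_tendsto_zero]
  have h1 : Filter.Tendsto (fun y : ℂ => C * ‖y - x‖ ^ α) (nhdsWithin x (sphere (0 : ℂ) 1))
      (nhds 0) := by
    have : Continuous (fun y : ℂ => C * ‖y - x‖ ^ α) :=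
      continuous_const.mul ((by fun_prop : Continuous fun y : ℂ => ‖y - x‖).rpow_const
        (fun _ => Or.inr hα.le))
    have h2 := this.tendsto x
    simp only [sub_self, norm_zero, Real.zero_rpow hα.ne', mul_zero] at h2
    exact h2.mono_left nhdsWithin_le_nhds
  refine squeeze_zero' (Filter.Eventually.of_forall fun _ => norm_nonneg _) ?_ h1
  filter_upwards [self_mem_nhdsWithin] with y hy
  exact hC y hy x hx

lemma aux_circ {φ : ℂ → ℝ} (h : ContinuousOn φ (sphere (0 : ℂ) 1)) {u : ℂ} (hu : ‖u‖ = 1) :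
    Continuous (fun θ : ℝ => φ (u * Complex.exp (θ * Complex.I))) := by
  refine h.comp_continuous (by fun_prop) ?_
  intro θ
  simp [hu]

lemma aux_ne {ζ : ℂ} (hζ : ‖ζ‖ < 1) (θ : ℝ) : Complex.exp (θ * Complex.I) - ζ ≠ 0 := by
  intro h
  have : Complex.exp (θ * Complex.I) = ζ := sub_eq_zero.mp h
  have h2 := Complex.norm_exp_ofReal_mul_I θ
  rw [this] at h2
  linarith

lemma aux_ker {ζ : ℂ} (hζ : ‖ζ‖ < 1) :
    Continuous (fun θ : ℝ => (Complex.exp (θ * Complex.I) + ζ) / (Complex.exp (θ * Complex.I) - ζ)) :=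
  Continuous.div (by fun_prop) (by fun_prop) (aux_ne hζ)

/-- Schwarz in terms of the Cauchy integral. -/
lemma aux_cauchy {φ : ℂ → ℝ} (h : ContinuousOn φ (sphere (0 : ℂ) 1)) {ζ : ℂ} (hζ : ‖ζ‖ < 1) :
    schwarz φ ζ = 2 * ((2 * Real.pi * Complex.I : ℂ)⁻¹ • ∮ z in C(0, 1), (z - ζ)⁻¹ • (φ z : ℂ))
      - (1 / (2 * Real.pi) : ℂ) * ∫ θ in (0 : ℝ)..(2 * Real.pi),
        (φ (Complex.exp (θ * Complex.I)) : ℂ) := by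
  have hc : Continuous (fun θ : ℝ => (φ (Complex.exp (θ * Complex.I)) : ℂ)) := by
    have := aux_circ h (u := 1) (by simp)
    simp only [one_mul] at this
    exact Complex.continuous_ofReal.comp this
  have hk : Continuous (fun θ : ℝ => Complex.exp (θ * Complex.I) / (Complex.exp (θ * Complex.I) - ζ)) :=
    Continuous.div (by fun_prop) (by fun_prop) (aux_ne hζ)
  have e1 : (∮ z in C(0, 1), (z - ζ)⁻¹ • (φ z : ℂ)) = Complex.I * ∫ θ in (0 : ℝ)..(2 * Real.pi),
      Complex.exp (θ * Complex.I) / (Complex.exp (θ * Complex.I) - ζ) *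
        (φ (Complex.exp (θ * Complex.I)) : ℂ) := by
    rw [circleIntegral, ← intervalIntegral.integral_const_mul]
    refine intervalIntegral.integral_congr fun θ _ => ?_
    simp [circleMap]
    ring
  have e2 : (∫ θ in (0 : ℝ)..(2 * Real.pi),
    ((Complex.exp (θ * Complex.I) + ζ) / (Complex.exp (θ * Complex.I) - ζ)) *
      (φ (Complex.exp (θ * Complex.I)) : ℂ)) = 2 * (∫ θ in (0 : ℝ)..(2 * Real.pi),
      Complex.exp (θ * Complex.I) / (Complex.exp (θ * Complex.I) - ζ) *
        (φ (Complex.exp (θ * Complex.I)) : ℂ)) - ∫ θ in (0 : ℝ)..(2 * Real.pi),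
        (φ (Complex.exp (θ * Complex.I)) : ℂ) := by
    rw [← intervalIntegral.integral_const_mul, ← intervalIntegral.integral_sub]
    · refine intervalIntegral.integral_congr fun θ _ => ?_
      have := aux_ne hζ θ
      field_simp
      ring
    · exact (continuous_const.mul (hk.mul hc)).intervalIntegrable _ _
    · exact hc.intervalIntegrable _ _
  rw [schwarz, e1, e2]
  have := Complex.I_ne_zero
  have : (Real.pi : ℂ) ≠ 0 := by exact_mod_cast Real.pi_ne_zero
  simp only [smul_eq_mul]
  generalize (∫ θ in (0 : ℝ)..(2 * Real.pi),
      Complex.exp (θ * Complex.I) / (Complex.exp (θ * Complex.I) - ζ) *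
        (φ (Complex.exp (θ * Complex.I)) : ℂ)) = A
  generalize (∫ θ in (0 : ℝ)..(2 * Real.pi), (φ (Complex.exp (θ * Complex.I)) : ℂ)) = B
  field_simp

lemma aux_one {ζ : ℂ} (hζ : ‖ζ‖ < 1) : (∫ θ in (0 : ℝ)..(2 * Real.pi),
    ((Complex.exp (θ * Complex.I) + ζ) / (Complex.exp (θ * Complex.I) - ζ))) = 2 * Real.pi := by
  have h := aux_cauchy (φ := fun _ => 1) continuousOn_const hζ
  have h2 := circleIntegral.integral_sub_inv_of_mem_ball (c := 0) (w := ζ) (R := 1) (by simpa using hζ)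
  simp only [schwarz, Complex.ofReal_one, mul_one, smul_eq_mul, h2] at h
  have := Complex.I_ne_zero
  have : (Real.pi : ℂ) ≠ 0 := by exact_mod_cast Real.pi_ne_zero
  simp at h
  field_simp at h
  rw [h, Complex.I_sq]
  ring

lemma aux_diff {φ : ℂ → ℝ} (h : ContinuousOn φ (sphere (0 : ℂ) 1)) :
    DifferentiableOn ℂ (schwarz φ) (ball (0 : ℂ) 1) := by
  have hci : CircleIntegrable (fun z => (φ z : ℂ)) 0 ((1 : NNReal) : ℝ) :=
    ContinuousOn.circleIntegrable (by simp)
      (Complex.continuous_ofReal.comp_continuousOn (by simpa using h))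
  have h1 := (hasFPowerSeriesOn_cauchy_integral hci one_pos).differentiableOn
  have h2 : ball (0 : ℂ) 1 = Metric.eball (0 : ℂ) ((1 : NNReal) : ENNReal) := by
    rw [Metric.eball_coe]; rfl
  rw [h2]
  refine ((h1.const_mul 2).sub_const ((1 / (2 * Real.pi) : ℂ) *
    ∫ θ in (0 : ℝ)..(2 * Real.pi), (φ (Complex.exp (θ * Complex.I)) : ℂ))).congr ?_
  intro ζ hζ
  rw [← h2] at hζ
  exact aux_cauchy h (by simpa using hζ)

lemma aux_lower_s10 {θ : ℝ} (h1 : Real.pi < θ) (h2 : θ < 2 * Real.pi) :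
    Complex.exp (θ * Complex.I) ∈ lowerArc := by
  refine ⟨by simp, ?_⟩
  rintro ⟨x, hx, h⟩
  have := congrArg Complex.im h
  rw [Complex.exp_ofReal_mul_I_im, Complex.exp_ofReal_mul_I_im] at this
  have h3 := Real.sin_nonneg_of_mem_Icc hx
  have h4 : Real.sin (θ - 2 * Real.pi) < 0 :=
    Real.sin_neg_of_neg_of_neg_pi_lt (by linarith) (by linarith)
  rw [Real.sin_sub_two_pi] at h4
  linarith

lemma aux_nonpos {φ : ℂ → ℝ} (hφ0 : ∀ w ∈ upperArc, φ w = 0)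
    (hφneg : ∀ w ∈ lowerArc, φ w < 0) (w : ℂ) (hw : w ∈ sphere (0 : ℂ) 1) : φ w ≤ 0 := by
  by_cases h : w ∈ upperArc
  · exact (hφ0 w h).le
  · exact (hφneg w ⟨hw, h⟩).le

lemma aux_kre (a b : ℂ) : ((a + b) / (a - b)).re = (‖a‖ ^ 2 - ‖b‖ ^ 2) / ‖a - b‖ ^ 2 := by
  have := congrFun (poissonKernel_eq_re_herglotzRieszKernel (c := 0) (w := b)) a
  simpa [poissonKernel, herglotzRieszKernel] using this.symm

lemma aux_neg {φ : ℂ → ℝ} (h : ContinuousOn φ (sphere (0 : ℂ) 1))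
    (hφ0 : ∀ w ∈ upperArc, φ w = 0)
    (hφneg : ∀ w ∈ lowerArc, φ w < 0) {ζ : ℂ} (hζ : ‖ζ‖ < 1) : (schwarz φ ζ).re < 0 := by
  have hc : Continuous (fun θ : ℝ => φ (Complex.exp (θ * Complex.I))) := by
    have := aux_circ h (u := 1) (by simp)
    simpa only [one_mul] using this
  have hk := aux_ker hζ
  have hkp : ∀ θ : ℝ, 0 < ((Complex.exp (θ * Complex.I) + ζ) / (Complex.exp (θ * Complex.I) - ζ)).re := by
    intro θ
    rw [aux_kre, Complex.norm_exp_ofReal_mul_I]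
    have := norm_pos_iff.mpr (aux_ne hζ θ)
    have := norm_nonneg ζ
    apply div_pos <;> nlinarith
  have e : (schwarz φ ζ).re = (1 / (2 * Real.pi)) * ∫ θ in (0 : ℝ)..(2 * Real.pi),
      ((Complex.exp (θ * Complex.I) + ζ) / (Complex.exp (θ * Complex.I) - ζ)).re *
      φ (Complex.exp (θ * Complex.I)) := by
    have e3 : (1 / (2 * Real.pi) : ℂ) = ((1 / (2 * Real.pi) : ℝ) : ℂ) := by push_cast; rfl
    rw [schwarz, e3, Complex.re_ofReal_mul]
    congr 1
    have hi : IntervalIntegrable (fun θ : ℝ => ((Complex.exp (θ * Complex.I) + ζ) / (Complex.exp (θ * Complex.I) - ζ)) *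
      (φ (Complex.exp (θ * Complex.I)) : ℂ)) MeasureTheory.volume 0 (2 * Real.pi) :=
      (hk.mul (Complex.continuous_ofReal.comp hc)).intervalIntegrable _ _
    have := Complex.reCLM.intervalIntegral_comp_comm hi
    simp only [Complex.reCLM_apply, Complex.re_mul_ofReal] at this
    exact this.symm
  rw [e]
  have hpi := Real.pi_pos
  have : 0 < ∫ θ in (0 : ℝ)..(2 * Real.pi),
      -(((Complex.exp (θ * Complex.I) + ζ) / (Complex.exp (θ * Complex.I) - ζ)).re *
      φ (Complex.exp (θ * Complex.I))) := by
    apply intervalIntegral.integral_pos (by positivity)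
    · exact ((Complex.continuous_re.comp hk).mul hc).neg.continuousOn
    · intro θ _
      have := aux_nonpos hφ0 hφneg (Complex.exp (θ * Complex.I)) (by simp)
      nlinarith [hkp θ]
    · refine ⟨3 / 2 * Real.pi, ⟨by positivity, by linarith⟩, ?_⟩
      have := hφneg _ (aux_lower_s10 (θ := 3 / 2 * Real.pi) (by linarith) (by linarith))
      nlinarith [hkp (3 / 2 * Real.pi)]
  rw [intervalIntegral.integral_neg] at this
  have : 0 < 1 / (2 * Real.pi) := by positivity
  nlinarith

/-- The regularised rotated integrand. -/
def auxH (φ : ℂ → ℝ) (r : ℝ) (u : ℂ) (θ : ℝ) : ℂ :=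
  ((Complex.exp (θ * Complex.I) + r) / (Complex.exp (θ * Complex.I) - r)) *
    ((φ (u * Complex.exp (θ * Complex.I)) - φ u : ℝ) : ℂ)

/-- The regularised Schwarz integral in polar coordinates. -/
def auxG (φ : ℂ → ℝ) (r : ℝ) (u : ℂ) : ℂ :=
  φ u + (1 / (2 * Real.pi) : ℂ) * ∫ θ in (-Real.pi)..Real.pi, auxH φ r u θ

lemma aux_shift (P : ℝ → ℂ) (hP : Function.Periodic P (2 * Real.pi)) (ψ : ℝ) :
    ∫ θ in (0 : ℝ)..(2 * Real.pi), P θ = ∫ θ in (-Real.pi)..Real.pi, P (θ + ψ) := by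
  rw [intervalIntegral.integral_comp_add_right]
  have := hP.intervalIntegral_add_eq 0 (-Real.pi + ψ)
  rw [zero_add] at this
  rw [this]
  congr 1
  ring

lemma aux_exp_per : Function.Periodic (fun θ : ℝ => Complex.exp (θ * Complex.I)) (2 * Real.pi) := by
  intro θ
  have := Complex.exp_periodic (θ * Complex.I)
  simp only [Complex.ofReal_add, Complex.ofReal_mul, Complex.ofReal_ofNat]
  rw [add_mul]
  exact this

lemma aux_polar {φ : ℂ → ℝ} (h : ContinuousOn φ (sphere (0 : ℂ) 1)) {r : ℝ} (h0 : 0 ≤ r)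
    (h1 : r < 1) {u : ℂ} (hu : ‖u‖ = 1) : schwarz φ (r * u) = auxG φ r u := by
  obtain ⟨ψ, rfl⟩ : ∃ ψ : ℝ, u = Complex.exp (ψ * Complex.I) := by
    refine ⟨Complex.arg u, ?_⟩
    have := Complex.norm_mul_exp_arg_mul_I u
    rw [hu] at this
    simpa using this.symm
  set u := Complex.exp (ψ * Complex.I) with hudef
  have hr : ‖(r : ℂ)‖ < 1 := by simpa [abs_of_nonneg h0] using h1
  have hu0 : u ≠ 0 := Complex.exp_ne_zero _
  have hper := aux_exp_per
  have k1 : (∫ θ in (-Real.pi)..Real.pi,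
      (Complex.exp (θ * Complex.I) + r) / (Complex.exp (θ * Complex.I) - r)) = 2 * Real.pi := by
    rw [← aux_one hr, aux_shift _ _ 0]
    · simp
    · intro θ
      have := hper θ
      simp only at this ⊢
      rw [this]
  have k2 : (∫ θ in (0 : ℝ)..(2 * Real.pi),
      ((Complex.exp (θ * Complex.I) + r * u) / (Complex.exp (θ * Complex.I) - r * u)) *
      (φ (Complex.exp (θ * Complex.I)) : ℂ)) = ∫ θ in (-Real.pi)..Real.pi,
      ((Complex.exp (θ * Complex.I) + r) / (Complex.exp (θ * Complex.I) - r)) *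
      (φ (u * Complex.exp (θ * Complex.I)) : ℂ) := by
    rw [aux_shift _ _ ψ]
    · refine intervalIntegral.integral_congr fun θ _ => ?_
      have e : Complex.exp (((θ + ψ : ℝ) : ℂ) * Complex.I) = u * Complex.exp (θ * Complex.I) := by
        rw [hudef, ← Complex.exp_add]
        congr 1
        push_cast
        ring
      simp only [e]
      congr 1
      rw [← mul_div_mul_left (Complex.exp (θ * Complex.I) + r) _ hu0]
      congr 1 <;> ring
    · intro θ
      have := hper θ
      simp only at this ⊢
      rw [this]
  have c1 := aux_ker hr
  have c2 := Complex.continuous_ofReal.comp (aux_circ h hu)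
  have k3 : (∫ θ in (-Real.pi)..Real.pi, auxH φ r u θ) = (∫ θ in (-Real.pi)..Real.pi,
      ((Complex.exp (θ * Complex.I) + r) / (Complex.exp (θ * Complex.I) - r)) *
      (φ (u * Complex.exp (θ * Complex.I)) : ℂ)) - 2 * Real.pi * φ u := by
    rw [← k1, ← intervalIntegral.integral_mul_const, ← intervalIntegral.integral_sub]
    · refine intervalIntegral.integral_congr fun θ _ => ?_
      simp only [auxH]
      push_cast
      ring
    · exact (c1.mul c2).intervalIntegrable _ _
    · exact (c1.mul continuous_const).intervalIntegrable _ _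
  rw [schwarz, auxG, k2, k3]
  have : (Real.pi : ℂ) ≠ 0 := by exact_mod_cast Real.pi_ne_zero
  generalize (∫ θ in (-Real.pi)..Real.pi,
      ((Complex.exp (θ * Complex.I) + r) / (Complex.exp (θ * Complex.I) - r)) *
      (φ (u * Complex.exp (θ * Complex.I)) : ℂ)) = A
  field_simp
  ring

lemma aux_bound {α C : ℝ} (hα : α ∈ Set.Ioo (0 : ℝ) 1) {φ : ℂ → ℝ} (hC0 : 0 ≤ C)
    (hC : ∀ x ∈ sphere (0 : ℂ) 1, ∀ y ∈ sphere (0 : ℂ) 1, ‖φ x - φ y‖ ≤ C * ‖x - y‖ ^ α)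
    {r : ℝ} (h0 : 0 ≤ r) (h1 : r ≤ 1) {u : ℂ} (hu : ‖u‖ = 1) {θ : ℝ} (hθ : |θ| ≤ Real.pi) :
    ‖auxH φ r u θ‖ ≤ 4 * C * (2 / Real.pi) ^ (α - 1) * |θ| ^ (α - 1) := by
  have hpi := Real.pi_pos
  by_cases hθ0 : θ = 0
  · have : auxH φ r u θ = 0 := by simp [auxH, hθ0]
    rw [this, norm_zero]
    positivity
  set e := Complex.exp (θ * Complex.I) with he
  have hen : ‖e‖ = 1 := Complex.norm_exp_ofReal_mul_I θ
  set s := ‖e - 1‖ with hs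
  have hs1 : 2 / Real.pi * |θ| ≤ s := by
    rw [hs, he, mul_comm (θ : ℂ), Complex.norm_exp_I_mul_ofReal_sub_one, norm_mul,
      Real.norm_eq_abs, Real.norm_eq_abs]
    have h2 : |θ / 2| = |θ| / 2 := by rw [abs_div]; norm_num
    have := Real.mul_abs_le_abs_sin (x := θ / 2) (by rw [h2]; linarith)
    rw [h2] at this
    rw [abs_of_pos (by norm_num : (0 : ℝ) < 2)]
    linarith
  have hθp : 0 < |θ| := abs_pos.mpr hθ0
  have hsp : 0 < s := lt_of_lt_of_le (by positivity) hs1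
  have hrn : ‖(r : ℂ)‖ = r := by simp [abs_of_nonneg h0]
  have hd1 : 1 - r ≤ ‖e - r‖ := by
    have := norm_sub_norm_le e (r : ℂ)
    rwa [hen, hrn] at this
  have hd2 : s ≤ 2 * ‖e - r‖ := by
    have h3 : s ≤ ‖e - r‖ + ‖((r : ℂ) - 1)‖ := by
      have := norm_add_le (e - r) ((r : ℂ) - 1)
      simpa [hs] using this
    have h4 : ‖((r : ℂ) - 1)‖ = 1 - r := by
      rw [← Complex.ofReal_one, ← Complex.ofReal_sub, Complex.norm_real, Real.norm_eq_abs,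
        abs_sub_comm, abs_of_nonneg (by linarith)]
    linarith
  have hnum : ‖e + r‖ ≤ 2 := by
    have := norm_add_le e (r : ℂ)
    rw [hen, hrn] at this
    linarith
  have hk : ‖(e + r) / (e - r)‖ ≤ 4 / s := by
    rw [norm_div, div_le_div_iff₀ (by linarith) hsp]
    nlinarith [norm_nonneg (e + r), norm_nonneg (e - r)]
  have hph : ‖((φ (u * e) - φ u : ℝ) : ℂ)‖ ≤ C * s ^ α := by
    rw [Complex.norm_real]
    have := hC (u * e) (by simp [hu, hen]) u (by simp [hu])
    have e2 : u * e - u = u * (e - 1) := by ring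
    rwa [e2, norm_mul, hu, one_mul] at this
  calc ‖auxH φ r u θ‖ ≤ (4 / s) * (C * s ^ α) := by
        rw [auxH, norm_mul]
        exact mul_le_mul hk hph (norm_nonneg _) (by positivity)
    _ = 4 * C * s ^ (α - 1) := by
        rw [Real.rpow_sub_one hsp.ne']
        ring
    _ ≤ 4 * C * (2 / Real.pi * |θ|) ^ (α - 1) := by
        apply mul_le_mul_of_nonneg_left _ (by positivity)
        exact Real.rpow_le_rpow_of_nonpos (by positivity) hs1 (by linarith [hα.2])
    _ = _ := by
        rw [Real.mul_rpow (by positivity) (by positivity)]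
        ring

lemma aux_Gcont {α : ℝ} (hα : α ∈ Set.Ioo (0 : ℝ) 1) {φ : ℂ → ℝ}
    (hH : HolderOn α φ (sphere (0 : ℂ) 1)) :
    ContinuousOn (fun p : ℝ × ℂ => auxG φ p.1 p.2) (Set.Icc 0 1 ×ˢ sphere (0 : ℂ) 1) := by
  have hc := aux_cont hα.1 hH
  obtain ⟨C, hC'⟩ := hH
  have hC : ∀ x ∈ sphere (0 : ℂ) 1, ∀ y ∈ sphere (0 : ℂ) 1, ‖φ x - φ y‖ ≤ |C| * ‖x - y‖ ^ α :=
    fun x hx y hy => (hC' x hx y hy).trans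
      (mul_le_mul_of_nonneg_right (le_abs_self C) (by positivity))
  have hu : ContinuousOn (fun p : ℝ × ℂ => φ p.2) (Set.Icc 0 1 ×ˢ sphere (0 : ℂ) 1) :=
    hc.comp continuous_snd.continuousOn (fun p hp => hp.2)
  have hpi := Real.pi_pos
  unfold auxG
  refine (Complex.continuous_ofReal.comp_continuousOn hu).add (continuousOn_const.mul ?_)
  intro p hp
  refine intervalIntegral.continuousWithinAt_of_dominated_interval
    (bound := fun θ => 4 * |C| * (2 / Real.pi) ^ (α - 1) * |θ| ^ (α - 1)) ?_ ?_ ?_ ?_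
  · filter_upwards [self_mem_nhdsWithin] with q hq
    have c2 := aux_circ hc (u := q.2) (by simpa using hq.2)
    have m1 : Measurable (fun θ : ℝ => (Complex.exp (θ * Complex.I) + q.1) /
        (Complex.exp (θ * Complex.I) - q.1)) :=
      (by fun_prop : Continuous fun θ : ℝ => Complex.exp (θ * Complex.I) + q.1).measurable.div
        (by fun_prop : Continuous fun θ : ℝ => Complex.exp (θ * Complex.I) - q.1).measurable
    exact (m1.mul (Complex.continuous_ofReal.comp
      (c2.sub continuous_const)).measurable).aestronglyMeasurable
  · filter_upwards [self_mem_nhdsWithin] with q hq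
    refine Filter.Eventually.of_forall fun θ hθ => ?_
    rw [Set.uIoc_of_le (by linarith)] at hθ
    exact aux_bound hα (abs_nonneg C) hC hq.1.1 hq.1.2 (by simpa using hq.2)
      (abs_le.mpr ⟨hθ.1.le, hθ.2⟩)
  · apply IntervalIntegrable.const_mul
    apply intervalIntegrable_of_even
    · intro x; simp
    · intro x hx
      refine (intervalIntegral.intervalIntegrable_rpow' (r := α - 1) (by linarith [hα.1])).congr ?_
      intro y hy
      rw [Set.uIoc_of_le hx.le] at hy
      simp [abs_of_pos hy.1]
    · exact enorm_ne_top
    · exact enorm_ne_top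
  · have : ∀ᵐ θ : ℝ, θ ≠ 0 := by
      simp [MeasureTheory.ae_iff]
    filter_upwards [this] with θ hθ0 hθ
    rw [Set.uIoc_of_le (by linarith)] at hθ
    have hne : Complex.exp (θ * Complex.I) - p.1 ≠ 0 := by
      intro h
      rw [sub_eq_zero] at h
      have h2 := congrArg Complex.im h
      rw [Complex.exp_ofReal_mul_I_im, Complex.ofReal_im] at h2
      have h3 := congrArg Complex.re h
      rw [Complex.exp_ofReal_mul_I_re, Complex.ofReal_re] at h3
      rcases lt_or_eq_of_le hθ.2 with h4 | h4
      · exact hθ0 ((Real.sin_eq_zero_iff_of_lt_of_lt hθ.1 h4).mp h2)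
      · rw [h4, Real.cos_pi] at h3
        linarith [hp.1.1]
    unfold auxH
    refine ContinuousWithinAt.mul (ContinuousWithinAt.div ?_ ?_ hne) ?_
    · exact (by fun_prop : Continuous fun q : ℝ × ℂ =>
        Complex.exp (θ * Complex.I) + q.1).continuousWithinAt
    · exact (by fun_prop : Continuous fun q : ℝ × ℂ =>
        Complex.exp (θ * Complex.I) - q.1).continuousWithinAt
    · have c3 : ContinuousOn (fun q : ℝ × ℂ => φ (q.2 * Complex.exp (θ * Complex.I)))
          (Set.Icc 0 1 ×ˢ sphere (0 : ℂ) 1) :=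
        hc.comp (by fun_prop) (fun q hq => by simpa using hq.2)
      exact (Complex.continuous_ofReal.comp_continuousOn (c3.sub hu)) p hp

lemma aux_Gre (φ : ℂ → ℝ) (u : ℂ) : (auxG φ 1 u).re = φ u := by
  have key : ∀ θ, auxH φ 1 u θ = Complex.I * ((auxH φ 1 u θ).im : ℂ) := by
    intro θ
    have : (auxH φ 1 u θ).re = 0 := by
      rw [auxH, Complex.re_mul_ofReal, aux_kre, Complex.norm_exp_ofReal_mul_I]
      simp
    apply Complex.ext <;> simp [this]
  have e : (∫ θ in (-Real.pi)..Real.pi, auxH φ 1 u θ) =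
      Complex.I * ((∫ θ in (-Real.pi)..Real.pi, (auxH φ 1 u θ).im : ℝ) : ℂ) := by
    rw [← intervalIntegral.integral_ofReal, ← intervalIntegral.integral_const_mul]
    exact intervalIntegral.integral_congr fun θ _ => key θ
  have e3 : (1 / (2 * Real.pi) : ℂ) = ((1 / (2 * Real.pi) : ℝ) : ℂ) := by push_cast; rfl
  rw [auxG, e, e3, Complex.add_re, Complex.re_ofReal_mul]
  simp

open Classical in
lemma aux_main {α : ℝ} (hα : α ∈ Set.Ioo (0 : ℝ) 1) {φ : ℂ → ℝ}
    (hH : HolderOn α φ (sphere (0 : ℂ) 1)) :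
    ∃ F : ℂ → ℂ, ContinuousOn F (closedBall (0 : ℂ) 1) ∧
      (∀ ζ ∈ ball (0 : ℂ) 1, F ζ = schwarz φ ζ) ∧ ∀ ζ ∈ sphere (0 : ℂ) 1, (F ζ).re = φ ζ := by
  have hc := aux_cont hα.1 hH
  let F : ℂ → ℂ := fun ζ => if ‖ζ‖ < 1 then schwarz φ ζ else auxG φ 1 ζ
  have hF1 : ∀ ζ ∈ ball (0 : ℂ) 1, F ζ = schwarz φ ζ := by
    intro ζ hζ
    simp only [mem_ball_zero_iff] at hζ
    simp [F, hζ]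
  have hF2 : ∀ ζ ∈ sphere (0 : ℂ) 1, F ζ = auxG φ 1 ζ := by
    intro ζ hζ
    simp only [mem_sphere_zero_iff_norm] at hζ
    simp [F, hζ]
  refine ⟨F, ?_, hF1, fun ζ hζ => by rw [hF2 ζ hζ, aux_Gre]⟩
  have hA : ContinuousOn F (closedBall (0 : ℂ) 1 \ {0}) := by
    have hcomp : ContinuousOn (fun ζ : ℂ => auxG φ ‖ζ‖ (ζ / ‖ζ‖)) (closedBall (0 : ℂ) 1 \ {0}) := by
      refine (aux_Gcont hα hH).comp (f := fun ζ : ℂ => (‖ζ‖, ζ / (‖ζ‖ : ℂ))) ?_ ?_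
      · refine continuous_norm.continuousOn.prodMk (continuousOn_id.div ?_ ?_)
        · exact (Complex.continuous_ofReal.comp continuous_norm).continuousOn
        · intro ζ hζ
          simpa using hζ.2
      · intro ζ hζ
        have h0 : ‖ζ‖ ≠ 0 := by simpa using hζ.2
        refine ⟨⟨norm_nonneg _, by simpa using hζ.1⟩, ?_⟩
        simp [h0]
    refine hcomp.congr ?_
    intro ζ hζ
    have h0 : ‖ζ‖ ≠ 0 := by simpa using hζ.2
    have h0' : (‖ζ‖ : ℂ) ≠ 0 := by exact_mod_cast h0
    have h1 : ‖ζ‖ ≤ 1 := by simpa using hζ.1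
    rcases lt_or_eq_of_le h1 with h | h
    · show F ζ = auxG φ ‖ζ‖ (ζ / ‖ζ‖)
      rw [hF1 ζ (by simpa using h), ← aux_polar hc (norm_nonneg ζ) h (by simp [h0])]
      congr 1
      field_simp
    · rw [hF2 ζ (by simpa using h)]
      simp [h]
  intro ζ hζ
  by_cases h : ζ = 0
  · have : ContinuousOn F (ball (0 : ℂ) 1) := (aux_diff hc).continuousOn.congr hF1
    exact (this.continuousAt (isOpen_ball.mem_nhds (by simp [h]))).continuousWithinAt
  · have := hA ζ ⟨hζ, h⟩
    refine this.mono_of_mem_nhdsWithin ?_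
    exact Filter.inter_mem self_mem_nhdsWithin
      (mem_nhdsWithin_of_mem_nhds (isOpen_compl_singleton.mem_nhds h))


/-- the model family of Bishop discs `z(c,t) = (t_j Sφ + i c_j)_j` attached
to `iℝⁿ` along `b𝔻⁺`: each disc is holomorphic on `𝔻` and continuous on `𝔻̄`, maps `𝔻`
and `b𝔻⁻` into the wedge `W = {Re w_j < 0 ∀j}`, maps `b𝔻⁺` into the edge `iℝⁿ`, and the
evaluation map `(c,t) ↦ z(c,t)(0)` is a bijection from `ℝⁿ × (0,∞)ⁿ` onto `W`. -/
theorem model_bishop_family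
    (n : ℕ) (α : ℝ) (hα : α ∈ Set.Ioo (0 : ℝ) 1)
    (φ : ℂ → ℝ)
    (hφH : HolderOn α φ (sphere (0 : ℂ) 1))
    (hφ0 : ∀ w ∈ upperArc, φ w = 0)
    (hφneg : ∀ w ∈ lowerArc, φ w < 0) :
    ∃ F : ℂ → ℂ,
      ContinuousOn F (closedBall (0 : ℂ) 1) ∧
      (∀ ζ ∈ ball (0 : ℂ) 1, F ζ = schwarz φ ζ) ∧
      -- (i) each disc is holomorphic on 𝔻 and continuous on 𝔻̄
      (∀ c t : Fin n → ℝ,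
        DifferentiableOn ℂ (modelDisc F c t) (ball (0 : ℂ) 1) ∧
        ContinuousOn (modelDisc F c t) (closedBall (0 : ℂ) 1)) ∧
      -- (ii) each disc maps 𝔻 and b𝔻⁻ into the wedge W
      (∀ c t : Fin n → ℝ, (∀ j, 0 < t j) →
        (∀ ζ ∈ ball (0 : ℂ) 1, ∀ j, (modelDisc F c t ζ j).re < 0) ∧
        (∀ ζ ∈ lowerArc, ∀ j, (modelDisc F c t ζ j).re < 0)) ∧
      -- (iii) each disc maps b𝔻⁺ into the edge iℝⁿ
      (∀ c t : Fin n → ℝ, ∀ ζ ∈ upperArc, ∀ j, (modelDisc F c t ζ j).re = 0) ∧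
      -- (iv) evaluation at the centre is a bijection onto W
      (∀ w : Fin n → ℂ, (∀ j, (w j).re < 0) →
        ∃! p : {p : (Fin n → ℝ) × (Fin n → ℝ) // ∀ j, 0 < p.2 j},
          modelDisc F p.1.1 p.1.2 0 = w) := by
  have hc := aux_cont hα.1 hφH
  obtain ⟨F, hF, hFs, hFr⟩ := aux_main hα hφH
  have hre : ∀ (c t : Fin n → ℝ) (ζ : ℂ) (j : Fin n),
      (modelDisc F c t ζ j).re = t j * (F ζ).re := by
    intro c t ζ j
    simp [modelDisc]
  have him : ∀ (c t : Fin n → ℝ) (ζ : ℂ) (j : Fin n),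
      (modelDisc F c t ζ j).im = t j * (F ζ).im + c j := by
    intro c t ζ j
    simp [modelDisc]
  have hneg : ∀ ζ ∈ ball (0 : ℂ) 1, (F ζ).re < 0 := by
    intro ζ hζ
    rw [hFs ζ hζ]
    exact aux_neg hc hφ0 hφneg (by simpa using hζ)
  refine ⟨F, hF, hFs, ?_, ?_, ?_, ?_⟩
  · intro c t
    constructor
    · rw [differentiableOn_pi]
      intro j
      exact (((aux_diff hc).congr hFs).const_mul _).add_const _
    · rw [continuousOn_pi]
      intro j
      exact (continuousOn_const.mul hF).add continuousOn_const
  · intro c t ht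
    constructor
    · intro ζ hζ j
      rw [hre]
      exact mul_neg_of_pos_of_neg (ht j) (hneg ζ hζ)
    · intro ζ hζ j
      rw [hre, hFr ζ hζ.1]
      exact mul_neg_of_pos_of_neg (ht j) (hφneg ζ hζ)
  · intro c t ζ hζ j
    have hs : ζ ∈ sphere (0 : ℂ) 1 := by
      obtain ⟨θ, _, rfl⟩ := hζ
      simp
    rw [hre, hFr ζ hs, hφ0 ζ hζ, mul_zero]
  · intro w hw
    have h0 := hneg 0 (by simp)
    refine ⟨⟨(fun j => (w j).im - (w j).re / (F 0).re * (F 0).im,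
      fun j => (w j).re / (F 0).re), fun j => div_pos_of_neg_of_neg (hw j) h0⟩, ?_, ?_⟩
    · funext j
      apply Complex.ext
      · rw [hre]
        exact div_mul_cancel₀ _ h0.ne
      · rw [him]
        simp
    · rintro ⟨⟨c, t⟩, ht⟩ h
      have ht' : ∀ j, t j = (w j).re / (F 0).re := by
        intro j
        rw [eq_div_iff h0.ne, ← hre c t 0 j]
        exact congrArg Complex.re (congrFun h j)
      apply Subtype.ext
      apply Prod.ext
      · funext j
        have := him c t 0 j
        rw [show modelDisc F c t 0 j = w j from congrFun h j, ht' j] at this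
        simp only
        linarith
      · funext j
        exact ht' j
end
end

section
/- Let u : 𝔻 → [−∞,∞) be subharmonic on the open unit disc, and suppose that for every boundary point ζ₀ = e^{iθ} with θ ∈ (0,π) one has u(ζ) → −∞ as 𝔻 ∋ ζ → ζ₀. Then u ≡ −∞ on 𝔻. -/
open Metric MeasureTheory Filter

noncomputable section

/-- Subharmonicity on a set `U ⊆ ℂ` for `[−∞,∞)`-valued functions, encoded with `EReal`:
`u` is upper semicontinuous, never `+∞`, and satisfies the sub-mean-value inequality
`u(a) ≤ (1/2π)∫₀^{2π} u(a+re^{iθ}) dθ` whenever the closed disc of centre `a` and radius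
`r` lies in `U`. The possibly `−∞`-valued mean is expressed through all real truncations
`max(u, −m)`: since the truncated means decrease to the mean as `m → ∞`, requiring the
bound for every `m` is equivalent to the usual inequality. -/
def SubharmonicOn (u : ℂ → EReal) (U : Set ℂ) : Prop :=
  UpperSemicontinuousOn u U ∧ (∀ z ∈ U, u z ≠ ⊤) ∧
  ∀ a : ℂ, ∀ r : ℝ, 0 < r → closedBall a r ⊆ U → ∀ m : ℝ,
    u a ≤ (((1 / (2 * Real.pi)) * ∫ θ in (0:ℝ)..(2 * Real.pi),
      (max (u (a + r * Complex.exp (θ * Complex.I))) ((-m : ℝ) : EReal)).toReal : ℝ) : EReal)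

lemma circ_mem {a : ℂ} {r : ℝ} (hr : 0 < r) (θ : ℝ) :
    a + r * Complex.exp (θ * Complex.I) ∈ closedBall a r := by
  simp [Complex.norm_exp_ofReal_mul_I, abs_of_pos hr]

lemma mean_le {u : ℂ → EReal} (hsub : SubharmonicOn u (ball (0 : ℂ) 1)) {a : ℂ} {r : ℝ}
    (hr : 0 < r) (hb : closedBall a r ⊆ ball (0 : ℂ) 1) (m : ℝ) (G : ℝ → ℝ)
    (hG : IntervalIntegrable G volume 0 (2 * Real.pi))
    (h1 : ∀ θ : ℝ, u (a + r * Complex.exp (θ * Complex.I)) ≤ (G θ : EReal))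
    (h2 : ∀ θ : ℝ, -m ≤ G θ) :
    u a ≤ (((1 / (2 * Real.pi)) * ∫ θ in (0:ℝ)..(2 * Real.pi), G θ : ℝ) : EReal) := by
  obtain ⟨husc, -, hmean⟩ := hsub
  refine (hmean a r hr hb m).trans ?_
  rw [EReal.coe_le_coe_iff]
  have hpi := Real.pi_pos
  have hcont : Continuous (fun θ : ℝ => a + r * Complex.exp (θ * Complex.I)) := by fun_prop
  have hmeas : Measurable (fun θ : ℝ => u (a + r * Complex.exp (θ * Complex.I))) := by
    apply UpperSemicontinuous.measurable
    intro θ y hy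
    have hmem := hb (circ_mem (a := a) hr θ)
    have h := husc _ hmem y hy
    rw [isOpen_ball.nhdsWithin_eq hmem] at h
    exact hcont.continuousAt.eventually h
  have hub : ∀ θ : ℝ, (max (u (a + r * Complex.exp (θ * Complex.I))) ((-m : ℝ) : EReal)).toReal
      ≤ G θ := by
    intro θ
    have h : max (u (a + r * Complex.exp (θ * Complex.I))) ((-m : ℝ) : EReal) ≤ (G θ : EReal) :=
      max_le (h1 θ) (EReal.coe_le_coe_iff.2 (h2 θ))
    have h' := EReal.toReal_le_toReal h
      (ne_of_gt (lt_of_lt_of_le (EReal.bot_lt_coe _) (le_max_right _ _))) (EReal.coe_ne_top _)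
    simpa using h'
  have hlb : ∀ θ : ℝ, -m ≤
      (max (u (a + r * Complex.exp (θ * Complex.I))) ((-m : ℝ) : EReal)).toReal := by
    intro θ
    have h : max (u (a + r * Complex.exp (θ * Complex.I))) ((-m : ℝ) : EReal) ≤ (G θ : EReal) :=
      max_le (h1 θ) (EReal.coe_le_coe_iff.2 (h2 θ))
    have h' := EReal.toReal_le_toReal (le_max_right (u (a + r * Complex.exp (θ * Complex.I)))
      ((-m : ℝ) : EReal)) (EReal.coe_ne_bot _) (ne_top_of_le_ne_top (EReal.coe_ne_top _) h)
    simpa using h'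
  apply mul_le_mul_of_nonneg_left _ (by positivity)
  apply intervalIntegral.integral_mono (by positivity) _ hG hub
  have hG' : IntervalIntegrable (fun θ => |G θ| + |m|) volume 0 (2 * Real.pi) :=
    hG.abs.add intervalIntegrable_const
  refine hG'.mono_fun ?_ ?_
  · exact ((hmeas.max measurable_const).ereal_toReal).aestronglyMeasurable
  · refine Eventually.of_forall fun θ => ?_
    simp only [Real.norm_eq_abs]
    refine le_trans ?_ (le_abs_self _)
    refine abs_le.2 ⟨?_, ?_⟩
    · have := hlb θ
      have := neg_abs_le m
      have := le_abs_self m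
      have := abs_nonneg (G θ)
      linarith
    · have := hub θ
      have := le_abs_self (G θ)
      have := abs_nonneg m
      linarith

lemma exists_real_bound {u : ℂ → EReal} {K : Set ℂ} (hK : IsCompact K)
    (hu : UpperSemicontinuousOn u K) (ht : ∀ z ∈ K, u z ≠ ⊤) :
    ∃ C : ℝ, 0 ≤ C ∧ ∀ z ∈ K, u z ≤ (C : EReal) := by
  rcases K.eq_empty_or_nonempty with h | h
  · exact ⟨0, le_rfl, by simp [h]⟩
  obtain ⟨b, hb, hmax⟩ := hu.exists_isMaxOn h hK
  refine ⟨max 0 (u b).toReal, le_max_left _ _, fun z hz => (hmax hz).trans ?_⟩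
  refine (EReal.le_coe_toReal (ht b hb)).trans ?_
  exact EReal.coe_le_coe_iff.2 (le_max_right _ _)

lemma propagate {u : ℂ → EReal} (hsub : SubharmonicOn u (ball (0 : ℂ) 1)) {V : Set ℂ}
    (hV : IsOpen V) (hVu : ∀ z ∈ V, u z = ⊥) {a : ℂ} {r : ℝ}
    (hr : 0 < r) (hb : closedBall a r ⊆ ball (0 : ℂ) 1) (p : ℂ) (hp : ‖p - a‖ = r)
    (hpV : p ∈ V) : u a = ⊥ := by
  have hpi := Real.pi_pos
  obtain ⟨C, hC0, hC⟩ := exists_real_bound (isCompact_closedBall a r) (hsub.1.mono hb)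
    (fun z hz => hsub.2.1 z (hb hz))
  have hcont : Continuous (fun θ : ℝ => a + r * Complex.exp (θ * Complex.I)) := by fun_prop
  set T : Set ℝ := (fun θ : ℝ => a + r * Complex.exp (θ * Complex.I)) ⁻¹' V with hT
  have hTo : IsOpen T := hV.preimage hcont
  obtain ⟨θ₀, hθ₀, hθT⟩ : ∃ θ₀ ∈ Set.Icc 0 (2 * Real.pi), θ₀ ∈ T := by
    have harg : (r : ℂ) * Complex.exp (Complex.arg (p - a) * Complex.I) = p - a := by
      rw [← hp]; exact Complex.norm_mul_exp_arg_mul_I _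
    have h1 := Complex.neg_pi_lt_arg (p - a)
    have h2 := Complex.arg_le_pi (p - a)
    rcases le_or_gt 0 (Complex.arg (p - a)) with h | h
    · refine ⟨_, ⟨h, by linarith⟩, ?_⟩
      simp only [hT, Set.mem_preimage, harg]; simpa using hpV
    · refine ⟨Complex.arg (p - a) + 2 * Real.pi, ⟨by linarith, by linarith⟩, ?_⟩
      simp only [hT, Set.mem_preimage]
      have : Complex.exp (((Complex.arg (p - a) + 2 * Real.pi : ℝ) : ℂ) * Complex.I)
          = Complex.exp (Complex.arg (p - a) * Complex.I) := by
        push_cast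
        rw [add_mul, Complex.exp_add, Complex.exp_two_pi_mul_I, mul_one]
      rw [this, harg]; simpa using hpV
  have hpos : 0 < volume (T ∩ Set.Ioo 0 (2 * Real.pi)) := by
    apply (hTo.inter isOpen_Ioo).measure_pos volume
    have : θ₀ ∈ closure (Set.Ioo 0 (2 * Real.pi)) := by
      rw [closure_Ioo (by positivity)]; exact hθ₀
    exact mem_closure_iff.1 this T hTo hθT
  set S := T ∩ Set.Ioo 0 (2 * Real.pi) with hS
  have hSm : MeasurableSet S := (hTo.inter isOpen_Ioo).measurableSet
  have hSfin : volume S < ⊤ := lt_of_le_of_lt (measure_mono Set.inter_subset_right) measure_Ioo_lt_top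
  set δ := volume.real S with hδ
  have hδ0 : 0 < δ := ENNReal.toReal_pos hpos.ne' hSfin.ne
  have key : ∀ m : ℝ, 0 ≤ m → u a ≤
      ((1 / (2 * Real.pi)) * (2 * Real.pi * C - (m + C) * δ) : ℝ) := by
    intro m hm
    have hind : IntervalIntegrable (S.indicator fun _ => m + C) volume 0 (2 * Real.pi) := by
      rw [intervalIntegrable_iff_integrableOn_Ioc_of_le (by positivity)]
      exact (integrable_const (m+C)).indicator hSm
    have := mean_le hsub hr hb m (fun θ => C - S.indicator (fun _ => m + C) θ)
      (intervalIntegrable_const.sub hind) ?_ ?_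
    · rw [intervalIntegral.integral_sub intervalIntegrable_const hind] at this
      have h3 : ∫ θ in (0:ℝ)..(2 * Real.pi), S.indicator (fun _ => m + C) θ = (m + C) * δ := by
        rw [intervalIntegral.integral_of_le (by positivity), integral_indicator hSm,
          Measure.restrict_restrict hSm]
        have : S ∩ Set.Ioc 0 (2 * Real.pi) = S :=
          Set.inter_eq_left.2 (fun x hx => ⟨hx.2.1, hx.2.2.le⟩)
        rw [this]; simp [hδ, mul_comm]
      rw [h3] at this
      simpa using this
    · intro θ
      by_cases h : θ ∈ S
      · rw [hVu _ h.1]; exact bot_le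
      · simpa [h] using hC _ (circ_mem hr θ)
    · intro θ
      by_cases h : θ ∈ S
      · simp [h]
      · simp [h]; linarith
  rw [EReal.eq_bot_iff_forall_lt]
  intro y
  set m := max 0 ((2 * Real.pi * (C - y + 1)) / δ) with hmd
  refine lt_of_le_of_lt (key m (le_max_left _ _)) (EReal.coe_lt_coe_iff.2 ?_)
  have h1 : (2 * Real.pi * (C - y + 1)) ≤ m * δ := by
    rw [← div_le_iff₀ hδ0]; exact le_max_right _ _
  rw [one_div, ← div_eq_inv_mul, div_lt_iff₀ (by positivity)]
  nlinarith [mul_nonneg hC0 hδ0.le]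

def vext (u : ℂ → EReal) : ℂ → EReal :=
  open Classical in fun z => if z ∈ ball (0 : ℂ) 1 then u z else ⊥

def KK : Set ℂ := closedBall (0 : ℂ) 1 ∩ {z | 1 / 2 ≤ z.im}

lemma KK_compact : IsCompact KK :=
  (isCompact_closedBall _ _).inter_right (isClosed_le continuous_const Complex.continuous_im)

lemma vext_usc {u : ℂ → EReal} (hsub : SubharmonicOn u (ball (0 : ℂ) 1))
    (hlim : ∀ θ ∈ Set.Ioo (0 : ℝ) Real.pi,
      Tendsto u (nhdsWithin (Complex.exp (θ * Complex.I)) (ball (0 : ℂ) 1)) (nhds ⊥)) :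
    UpperSemicontinuousOn (vext u) KK := by
  intro z hz y hy
  apply mem_nhdsWithin_of_mem_nhds
  by_cases hzb : z ∈ ball (0 : ℂ) 1
  · simp only [vext, hzb, if_true] at hy
    have h := hsub.1 z hzb y hy
    rw [isOpen_ball.nhdsWithin_eq hzb] at h
    filter_upwards [h, isOpen_ball.mem_nhds hzb] with x hx hxb
    simpa [vext, hxb] using hx
  · have hy' : ⊥ < y := lt_of_le_of_lt bot_le hy
    have hn : ‖z‖ = 1 := by
      have h1 := hz.1
      simp at h1 hzb
      linarith
    have him : 1 / 2 ≤ z.im := hz.2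
    have harg : Complex.exp (Complex.arg z * Complex.I) = z := by
      have := Complex.norm_mul_exp_arg_mul_I z
      rw [hn] at this; simpa using this
    have h0 : 0 ≤ Complex.arg z := Complex.arg_nonneg_iff.2 (by linarith)
    have hI : Complex.arg z ∈ Set.Ioo (0 : ℝ) Real.pi := by
      constructor
      · refine lt_of_le_of_ne h0 fun h => ?_
        have := (Complex.arg_eq_zero_iff.1 h.symm).2
        linarith
      · refine lt_of_le_of_ne (Complex.arg_le_pi z) fun h => ?_
        have := (Complex.arg_eq_pi_iff.1 h).2
        linarith
    have h := hlim _ hI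
    rw [harg] at h
    have h2 := h.eventually (gt_mem_nhds hy')
    rw [eventually_nhdsWithin_iff] at h2
    filter_upwards [h2] with x hx
    by_cases hxb : x ∈ ball (0 : ℂ) 1
    · simpa [vext, hxb] using hx hxb
    · simpa [vext, hxb] using hy'

def gg (M : ℝ) (z : ℂ) : ℝ := M * (z.im - 1 / 2) + Complex.normSq z

lemma gg_cont (M : ℝ) : Continuous (gg M) := by
  unfold gg
  have := Complex.continuous_normSq
  fun_prop

lemma gg_circ (M : ℝ) (a : ℂ) (r θ : ℝ) : gg M (a + r * Complex.exp (θ * Complex.I)) =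
    (gg M a + r ^ 2) + ((M * r + 2 * r * a.im) * Real.sin θ + (2 * r * a.re) * Real.cos θ) := by
  have h1 : (Complex.exp (θ * Complex.I)).re = Real.cos θ := Complex.exp_ofReal_mul_I_re θ
  have h2 : (Complex.exp (θ * Complex.I)).im = Real.sin θ := Complex.exp_ofReal_mul_I_im θ
  simp only [gg, Complex.normSq_apply, Complex.add_re, Complex.add_im, Complex.mul_re,
    Complex.mul_im, Complex.ofReal_re, Complex.ofReal_im, h1, h2]
  linear_combination r ^ 2 * Real.sin_sq_add_cos_sq θ

lemma lens {u : ℂ → EReal} (hsub : SubharmonicOn u (ball (0 : ℂ) 1))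
    (hlim : ∀ θ ∈ Set.Ioo (0 : ℝ) Real.pi,
      Tendsto u (nhdsWithin (Complex.exp (θ * Complex.I)) (ball (0 : ℂ) 1)) (nhds ⊥))
    (z : ℂ) (hz : z ∈ ball (0 : ℂ) 1) (him : 1 / 2 < z.im) : u z = ⊥ := by
  have hpi := Real.pi_pos
  have hv := vext_usc hsub hlim
  have hvt : ∀ z, vext u z ≠ ⊤ := by
    intro z
    by_cases h : z ∈ ball (0 : ℂ) 1
    · simpa [vext, h] using hsub.2.1 z h
    · simp [vext, h]
  have hzK : z ∈ KK := ⟨ball_subset_closedBall hz, him.le⟩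
  obtain ⟨C, hC0, hC⟩ := exists_real_bound KK_compact hv (fun z _ => hvt z)
  have key : ∀ M : ℝ, u z + (gg M z : EReal) ≤ ((C + 1 : ℝ) : EReal) := by
    intro M
    have hw : UpperSemicontinuousOn (fun z => vext u z + (gg M z : EReal)) KK := by
      apply hv.add'
      · exact ((continuous_coe_real_ereal.comp (gg_cont M)).upperSemicontinuous).upperSemicontinuousOn _
      · intro x _
        exact EReal.continuousAt_add (by simp) (by simp)
    obtain ⟨a, haK, hmax⟩ := hw.exists_isMaxOn ⟨z, hzK⟩ KK_compact
    have hza := hmax hzK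
    simp only [Set.mem_ofPred_eq] at hza
    have hvz : vext u z = u z := by simp only [vext, hz, if_true]
    rw [hvz] at hza
    refine hza.trans ?_
    by_cases hab : a ∈ ball (0 : ℂ) 1
    swap
    · simp [vext, hab]
    have hva : vext u a = u a := by simp only [vext, hab, if_true]
    have haim : 1 / 2 ≤ a.im := haK.2
    rcases haim.eq_or_lt with he | hlt
    · have h1 : gg M a ≤ 1 := by
        have : ‖a‖ < 1 := by simpa using hab
        simp only [gg, ← he, Complex.normSq_eq_norm_sq]
        nlinarith [norm_nonneg a]
      rw [EReal.coe_add]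
      exact add_le_add (hC a haK) (by exact_mod_cast h1)
    · by_cases hub : u a = ⊥
      · simp [hva, hub]
      exfalso
      lift u a to ℝ using ⟨hsub.2.1 a hab, hub⟩ with t ht
      have hopen : IsOpen (ball (0 : ℂ) 1 ∩ {z | 1 / 2 < z.im}) :=
        isOpen_ball.inter (isOpen_lt continuous_const Complex.continuous_im)
      obtain ⟨r, hr, hrs⟩ := Metric.nhds_basis_closedBall.mem_iff.1 (hopen.mem_nhds ⟨hab, hlt⟩)
      have hle : ∀ x ∈ closedBall a r, u x ≤ ((t + gg M a - gg M x : ℝ) : EReal) := by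
        intro x hx
        have hxb := hrs hx
        have hxi : 1 / 2 < x.im := hxb.2
        have h := hmax (show x ∈ KK from ⟨ball_subset_closedBall hxb.1, hxi.le⟩)
        have hvx : vext u x = u x := by simp only [vext, hxb.1, if_true]
        simp only [Set.mem_ofPred_eq, hvx, hva] at h
        by_cases hxbot : u x = ⊥
        · simp [hxbot]
        have hxt := hsub.2.1 x hxb.1
        lift u x to ℝ using ⟨hxt, hxbot⟩ with s hs
        norm_cast at h ⊢
        linarith
      obtain ⟨m, hm⟩ : ∃ m : ℝ, ∀ x ∈ closedBall a r, gg M x ≤ m := by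
        obtain ⟨m, hm⟩ := (isCompact_closedBall a r).bddAbove_image (gg_cont M).continuousOn
        exact ⟨m, fun x hx => hm ⟨x, hx, rfl⟩⟩
      have hcont : Continuous (fun θ : ℝ =>
          t + gg M a - gg M (a + r * Complex.exp (θ * Complex.I))) := by
        have := gg_cont M
        fun_prop
      have := mean_le hsub hr (fun x hx => (hrs hx).1) (m - t - gg M a)
        (fun θ => t + gg M a - gg M (a + r * Complex.exp (θ * Complex.I)))
        (hcont.intervalIntegrable _ _)
        (fun θ => hle _ (circ_mem hr θ))
        (fun θ => by have := hm _ (circ_mem hr θ); linarith)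
      rw [← ht, EReal.coe_le_coe_iff] at this
      have hint : ∫ θ in (0:ℝ)..(2 * Real.pi),
          (t + gg M a - gg M (a + r * Complex.exp (θ * Complex.I)))
          = 2 * Real.pi * (t - r ^ 2) := by
        have hc1 : IntervalIntegrable (fun θ => (M * r + 2 * r * a.im) * Real.sin θ) volume 0
          (2 * Real.pi) := (by fun_prop : Continuous _).intervalIntegrable _ _
        have hc2 : IntervalIntegrable (fun θ => (2 * r * a.re) * Real.cos θ) volume 0
          (2 * Real.pi) := (by fun_prop : Continuous _).intervalIntegrable _ _
        have : ∀ θ : ℝ, t + gg M a - gg M (a + r * Complex.exp (θ * Complex.I)) =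
          (t - r ^ 2) - ((M * r + 2 * r * a.im) * Real.sin θ + (2 * r * a.re) * Real.cos θ) := by
          intro θ; rw [gg_circ]; ring
        simp_rw [this]
        rw [intervalIntegral.integral_sub intervalIntegrable_const (hc1.add hc2),
          intervalIntegral.integral_add hc1 hc2]
        simp
        ring
      rw [hint] at this
      have h5 : (1 / (2 * Real.pi)) * (2 * Real.pi * (t - r ^ 2)) = t - r ^ 2 := by
        field_simp
      rw [h5] at this
      nlinarith
  by_contra hbot
  have ht := hsub.2.1 z hz
  lift u z to ℝ using ⟨ht, hbot⟩ with t
  have h := key ((C + 2 - t) / (z.im - 1 / 2))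
  norm_cast at h
  have hne : z.im - 1 / 2 ≠ 0 := by linarith
  rw [gg, div_mul_cancel₀ _ hne] at h
  have := Complex.normSq_nonneg z
  linarith

/-- a subharmonic function on the unit disc which tends to `−∞` at every
point of the open upper semicircle is identically `−∞`. -/
theorem subharmonic_boundary_uniqueness
    (u : ℂ → EReal)
    (hsub : SubharmonicOn u (ball (0 : ℂ) 1))
    (hlim : ∀ θ ∈ Set.Ioo (0 : ℝ) Real.pi,
      Tendsto u (nhdsWithin (Complex.exp (θ * Complex.I)) (ball (0 : ℂ) 1)) (nhds ⊥)) :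
    ∀ z ∈ ball (0 : ℂ) 1, u z = ⊥ := by
  have hcb : ∀ (a : ℂ) (r : ℝ), ‖a‖ + r < 1 → closedBall a r ⊆ ball (0 : ℂ) 1 := by
    intro a r h
    apply closedBall_subset_ball'
    rw [dist_zero_right]; linarith
  have hopen : IsOpen (ball (0 : ℂ) 1 ∩ {z | 1 / 2 < z.im}) :=
    isOpen_ball.inter (isOpen_lt continuous_const Complex.continuous_im)
  have hstart : ∀ z ∈ ball (0 : ℂ) (1 / 4), u z = ⊥ := by
    intro a ha
    have ha' : ‖a‖ < 1 / 4 := by simpa using ha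
    refine propagate hsub hopen (fun z hz => lens hsub hlim z hz.1 hz.2) (a := a) (r := 3 / 4)
      (by norm_num) (hcb _ _ (by linarith)) (a + (3 / 4 : ℝ) * Complex.I) ?_ ⟨?_, ?_⟩
    · simp
    · have := norm_add_le a ((3 / 4 : ℝ) * Complex.I)
      have h2 : ‖((3 / 4 : ℝ) : ℂ) * Complex.I‖ = 3 / 4 := by simp
      rw [mem_ball_zero_iff]
      linarith
    · have := (abs_le.1 (Complex.abs_im_le_norm a)).1
      simp only [Set.mem_ofPred_eq, Complex.add_im, Complex.re_ofReal_mul, Complex.im_ofReal_mul,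
        Complex.I_im]
      linarith
  have hstep : ∀ R : ℝ, 1 / 4 ≤ R → R < 1 → (∀ z ∈ ball (0 : ℂ) R, u z = ⊥) →
      ∀ z ∈ ball (0 : ℂ) ((1 + R) / 2), u z = ⊥ := by
    intro R hR hR1 h a ha
    by_cases haR : a ∈ ball (0 : ℂ) R
    · exact h a haR
    have h1 : ‖a‖ < (1 + R) / 2 := by simpa using ha
    have h2 : R ≤ ‖a‖ := by simpa using haR
    have h0 : 0 < ‖a‖ := by linarith
    have hne : (‖a‖ : ℂ) ≠ 0 := by exact_mod_cast h0.ne'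
    refine propagate hsub isOpen_ball h (a := a) (r := (1 - R) / 2)
      (by linarith) (hcb _ _ (by linarith)) (((‖a‖ - (1 - R) / 2) / ‖a‖ : ℝ) * a) ?_ ?_
    · have : (((‖a‖ - (1 - R) / 2) / ‖a‖ : ℝ) : ℂ) * a - a
          = ((-((1 - R) / 2) / ‖a‖ : ℝ) : ℂ) * a := by
        push_cast; field_simp; ring
      rw [this, norm_mul, Complex.norm_real, Real.norm_eq_abs, abs_div, abs_norm, abs_neg,
        abs_of_pos (by linarith : 0 < (1 - R) / 2)]
      field_simp
    · rw [mem_ball_zero_iff, norm_mul, Complex.norm_real, Real.norm_eq_abs, abs_div, abs_norm,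
        div_mul_cancel₀ _ h0.ne', abs_lt]
      constructor <;> linarith
  have hall : ∀ n : ℕ, ∀ z ∈ ball (0 : ℂ) (1 - 3 / 4 * (1 / 2) ^ n), u z = ⊥ := by
    intro n
    induction n with
    | zero => norm_num at hstart ⊢; exact hstart
    | succ n ih =>
      have h1 : (0:ℝ) < (1 / 2) ^ n := by positivity
      have h2 : ((1:ℝ) / 2) ^ n ≤ 1 := pow_le_one₀ (by norm_num) (by norm_num)
      have := hstep _ (by linarith) (by linarith) ih
      have he : (1 - 3 / 4 * (1 / 2) ^ (n + 1) : ℝ) = (1 + (1 - 3 / 4 * (1 / 2) ^ n)) / 2 := by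
        rw [pow_succ]; ring
      rw [he]; exact this
  intro z hz
  have hz' : ‖z‖ < 1 := by simpa using hz
  obtain ⟨n, hn⟩ := exists_pow_lt_of_lt_one (show 0 < 1 - ‖z‖ by linarith)
    (show (1 / 2 : ℝ) < 1 by norm_num)
  refine hall n z ?_
  rw [mem_ball_zero_iff]
  have h1 : (0:ℝ) < (1 / 2) ^ n := by positivity
  linarith
end
end

section
/- (Boundary uniqueness, general wedge, standard structure) Let ρ₁,…,ρₙ be real C² functions on an open neighborhood Ω of a point p ∈ ℂⁿ with ρ_j(p) = 0 for all j and with ∂ρ₁,…,∂ρₙ ℂ-linearly independent at every point of E := {z ∈ Ω : ρ₁(z) = … = ρₙ(z) = 0}. Let W := {z ∈ Ω : ρ_j(z) < 0 for j = 1,…,n}, and let u be plurisubharmonic on W such that for every q ∈ E, u(z) → −∞ as W ∋ z → q. Then for every δ > 0 there exists an open neighborhood U of p such that u ≡ −∞ on { z ∈ U : ρ_j(z) − δ·Σ_{k≠j} ρ_k(z) < 0 for j = 1,…,n }. -/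
open Metric MeasureTheory Filter

noncomputable section

/-- Plurisubharmonicity on a set `Ω ⊆ ℂⁿ`. -/
def PlurisubharmonicOn {n : ℕ} (u : (Fin n → ℂ) → EReal) (Ω : Set (Fin n → ℂ)) : Prop :=
  UpperSemicontinuousOn u Ω ∧ (∀ z ∈ Ω, u z ≠ ⊤) ∧
  ∀ a V : Fin n → ℂ, SubharmonicOn (fun ζ : ℂ => u (a + ζ • V)) {ζ : ℂ | a + ζ • V ∈ Ω}

/-- The complex-linear part `∂ρ(p)` of the differential of a real function `ρ` on `ℂⁿ`:
`∂ρ(p)(V) = ½( dρ(p)(V) − i·dρ(p)(iV) )`. -/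
noncomputable def delC {n : ℕ} (ρ : (Fin n → ℂ) → ℝ) (p V : Fin n → ℂ) : ℂ :=
  (1 / 2 : ℂ) * ((fderiv ℝ ρ p V : ℂ) - Complex.I * (fderiv ℝ ρ p (Complex.I • V) : ℂ))

lemma delC_eq_sum {n : ℕ} (ρ : (Fin n → ℂ) → ℝ) (z V : Fin n → ℂ) :
    delC ρ z V = ∑ k, delC ρ z (Pi.single k 1) * V k := by
  have hadd : ∀ a b, delC ρ z (a + b) = delC ρ z a + delC ρ z b := by
    intro a b; simp only [delC, smul_add, map_add]; push_cast; ring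
  have hsm : ∀ (c : ℂ) a, delC ρ z (c • a) = c * delC ρ z a := by
    intro c a
    have h1 : c • a = (c.re : ℝ) • a + (c.im : ℝ) • (Complex.I • a) := by
      ext i
      simp only [Pi.smul_apply, Pi.add_apply, smul_eq_mul, Complex.real_smul]
      conv_lhs => rw [← Complex.re_add_im c]
      ring
    have h2 : Complex.I • (c • a) = (c.re : ℝ) • (Complex.I • a) + (-c.im : ℝ) • a := by
      ext i
      simp only [Pi.smul_apply, Pi.add_apply, smul_eq_mul, Complex.real_smul]
      conv_lhs => rw [← Complex.re_add_im c]
      push_cast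
      linear_combination (c.im * a i : ℂ) * Complex.I_sq
    simp only [delC]
    rw [h2, h1]
    simp only [map_add, map_smul, smul_eq_mul]
    push_cast
    conv_rhs => rw [← Complex.re_add_im c]
    linear_combination ((1/2 : ℂ) * c.im * (fderiv ℝ ρ z (Complex.I • a) : ℂ)) * Complex.I_sq
  have h0 : delC ρ z 0 = 0 := by simp [delC]
  let L : (Fin n → ℂ) →ₗ[ℂ] ℂ := ⟨⟨delC ρ z, hadd⟩, hsm⟩
  have : L V = ∑ k, L (Pi.single k 1) * V k := by
    conv_lhs => rw [pi_eq_sum_univ' V]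
    rw [map_sum]
    refine Finset.sum_congr rfl fun k _ => ?_
    rw [map_smul, smul_eq_mul, mul_comm]
  exact this

lemma geom_solve {n : ℕ} (p : Fin n → ℂ) (ρ : Fin n → ((Fin n → ℂ) → ℝ))
    (hρ : ∀ j, ContDiffAt ℝ 2 (ρ j) p)
    (hindep : ∀ a : Fin n → ℂ, (∀ V : Fin n → ℂ, (∑ j, a j * delC (ρ j) p V) = 0) → a = 0) :
    ∃ C : ℝ, 0 ≤ C ∧ ∀ᶠ z in nhds p, ∃ V : Fin n → ℂ, (∀ k, ‖V k‖ ≤ C * ∑ j, |ρ j z|) ∧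
      ∀ j, fderiv ℝ (ρ j) z V = ρ j z ∧ fderiv ℝ (ρ j) z (Complex.I • V) = 0 := by
  let M : (Fin n → ℂ) → Matrix (Fin n) (Fin n) ℂ := fun z =>
    Matrix.of fun j k => delC (ρ j) z (Pi.single k 1)
  have hdet : (M p).det ≠ 0 := by
    intro h
    obtain ⟨v, hv, hv2⟩ := Matrix.exists_vecMul_eq_zero_iff.mpr h
    apply hv
    apply hindep
    intro V
    have : ∀ k, ∑ j, v j * delC (ρ j) p (Pi.single k 1) = 0 := by
      intro k
      have := congrFun hv2 k
      simpa [Matrix.vecMul, dotProduct, M] using this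
    calc _ = ∑ j, ∑ k, v j * delC (ρ j) p (Pi.single k 1) * V k := by
          refine Finset.sum_congr rfl fun j _ => ?_
          rw [delC_eq_sum, Finset.mul_sum]
          refine Finset.sum_congr rfl fun k _ => by ring
      _ = ∑ k, (∑ j, v j * delC (ρ j) p (Pi.single k 1)) * V k := by
          rw [Finset.sum_comm]
          refine Finset.sum_congr rfl fun k _ => by rw [Finset.sum_mul]
      _ = 0 := by simp [this]
  have hcd : ∀ j, ContinuousAt (fun z => fderiv ℝ (ρ j) z) p := fun j =>
    ((hρ j).fderiv_right (m := 1) (by norm_num)).continuousAt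
  have hMc : ContinuousAt M p := by
    refine continuousAt_pi.2 fun j => continuousAt_pi.2 fun k => ?_
    simp only [M, Matrix.of_apply, delC]
    have h1 : ∀ v, ContinuousAt (fun z => fderiv ℝ (ρ j) z v) p := fun v =>
      (hcd j).clm_apply continuousAt_const
    have h2 : ∀ v, ContinuousAt (fun z => ((fderiv ℝ (ρ j) z v : ℝ) : ℂ)) p := fun v =>
      Complex.continuous_ofReal.continuousAt.comp (h1 v)
    exact continuousAt_const.mul ((h2 _).sub (continuousAt_const.mul (h2 _)))
  have hinv : ContinuousAt (fun z => (M z)⁻¹) p := by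
    have : ContinuousAt Inv.inv (M p) := by
      apply continuousAt_matrix_inv
      rw [Ring.inverse_eq_inv']
      exact continuousAt_inv₀ hdet
    exact ContinuousAt.comp (f := M) this hMc
  have hdete : ∀ᶠ z in nhds p, (M z).det ≠ 0 := by
    have : ContinuousAt (fun z => (M z).det) p :=
      ContinuousAt.comp (f := M) (g := fun A => A.det) (Continuous.matrix_det continuous_id).continuousAt hMc
    exact this.eventually_ne hdet
  have hb : ∀ j k, ∀ᶠ z in nhds p, ‖(M z)⁻¹ j k‖ < ‖(M p)⁻¹ j k‖ + 1 := by
    intro j k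
    have : ContinuousAt (fun z => ‖(M z)⁻¹ j k‖) p :=
      ((continuousAt_pi.1 (continuousAt_pi.1 hinv j)) k).norm
    exact this.eventually_lt continuousAt_const (by simp)
  have hb' := eventually_all.2 fun j => eventually_all.2 (hb j)
  have hC : ∀ j k, ‖(M p)⁻¹ j k‖ + 1 ≤ ∑ j, ∑ k, (‖(M p)⁻¹ j k‖ + 1) := by
    intro j k
    refine le_trans ?_ (Finset.single_le_sum (f := fun j => ∑ k, (‖(M p)⁻¹ j k‖ + 1))
      (fun i _ => by positivity) (Finset.mem_univ j))
    exact Finset.single_le_sum (f := fun k => (‖(M p)⁻¹ j k‖ + 1))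
      (fun i _ => by positivity) (Finset.mem_univ k)
  refine ⟨∑ j, ∑ k, (‖(M p)⁻¹ j k‖ + 1), by positivity, ?_⟩
  filter_upwards [hdete, hb'] with z hz hbz
  refine ⟨(M z)⁻¹.mulVec (fun j => ((1/2 * ρ j z : ℝ) : ℂ)), ?_, ?_⟩
  · intro k
    rw [Finset.mul_sum]
    rw [Matrix.mulVec, dotProduct]
    refine (norm_sum_le _ _).trans (Finset.sum_le_sum fun j _ => ?_)
    rw [norm_mul, Complex.norm_real, Real.norm_eq_abs, abs_mul]
    refine mul_le_mul ((hbz k j).le.trans (hC k j)) ?_ (by positivity) (by positivity)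
    have := abs_nonneg (ρ j z)
    rw [abs_of_pos (by norm_num : (0:ℝ) < 1/2)]; linarith
  · intro j
    set V := (M z)⁻¹.mulVec (fun j => ((1/2 * ρ j z : ℝ) : ℂ)) with hV
    have h1 : (M z).mulVec V = fun j => ((1/2 * ρ j z : ℝ) : ℂ) := by
      rw [hV, Matrix.mulVec_mulVec, Matrix.mul_nonsing_inv _ (isUnit_iff_ne_zero.2 hz), Matrix.one_mulVec]
    have h2 : delC (ρ j) z V = ((1/2 * ρ j z : ℝ) : ℂ) := by
      rw [delC_eq_sum, ← congrFun h1 j]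
      rfl
    rw [delC] at h2
    have hre := congrArg Complex.re h2
    have him := congrArg Complex.im h2
    simp at hre him
    exact ⟨hre, him⟩

lemma geom {n : ℕ} (Ω : Set (Fin n → ℂ)) (hΩ : IsOpen Ω)
    (p : Fin n → ℂ) (hp : p ∈ Ω) (ρ : Fin n → ((Fin n → ℂ) → ℝ))
    (hρ : ∀ j, ContDiffOn ℝ 2 (ρ j) Ω)
    (hindep : ∀ a : Fin n → ℂ, (∀ V : Fin n → ℂ, (∑ j, a j * delC (ρ j) p V) = 0) → a = 0) :
    ∃ r : ℝ, 0 < r ∧ ∃ C : ℝ, 0 ≤ C ∧ closedBall p r ⊆ Ω ∧ ∀ z ∈ closedBall p r,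
      ∃ V : Fin n → ℂ, (∀ k, ‖V k‖ ≤ C * ∑ j, |ρ j z|) ∧
      ∀ ζ : ℂ, z + ζ • V ∈ closedBall p r → ∀ j,
        |ρ j (z + ζ • V) - (1 + ζ.re) * ρ j z| ≤ C * (∑ j, |ρ j z|) ^ 2 * ‖ζ‖ ^ 2 := by
  have hat : ∀ j, ContDiffAt ℝ 2 (ρ j) p := fun j => (hρ j).contDiffAt (hΩ.mem_nhds hp)
  obtain ⟨C, hC, hV⟩ := geom_solve p ρ hat hindep
  have hL : ∀ j, ∃ K : NNReal, ∃ t ∈ nhds p, LipschitzOnWith K (fderiv ℝ (ρ j)) t := fun j =>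
    ((hat j).fderiv_right (m := 1) (by norm_num)).exists_lipschitzOnWith
  choose K t ht hK using hL
  have hall : ∀ᶠ z in nhds p, z ∈ Ω ∧ (∀ j, z ∈ t j) ∧ ∃ V : Fin n → ℂ, (∀ k, ‖V k‖ ≤ C * ∑ j, |ρ j z|) ∧
      ∀ j, fderiv ℝ (ρ j) z V = ρ j z ∧ fderiv ℝ (ρ j) z (Complex.I • V) = 0 :=
    Filter.Eventually.and (hΩ.mem_nhds hp) ((eventually_all.2 ht).and hV)
  obtain ⟨r, hr, hball⟩ := Metric.nhds_basis_closedBall.eventually_iff.1 hall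
  have hKn : ∀ j, (K j : ℝ) ≤ ∑ j, (K j : ℝ) := fun j =>
    Finset.single_le_sum (f := fun j => (K j : ℝ)) (fun i _ => (K i).2) (Finset.mem_univ j)
  have hKn0 : 0 ≤ ∑ j, (K j : ℝ) := Finset.sum_nonneg fun j _ => (K j).2
  refine ⟨r, hr, C + (∑ j, (K j : ℝ)) * C ^ 2, by positivity, fun z hz => (hball hz).1, ?_⟩
  intro z hz
  obtain ⟨hzΩ, hzt, V, hVn, hVd⟩ := hball hz
  have hs0 : 0 ≤ ∑ j, |ρ j z| := Finset.sum_nonneg fun _ _ => abs_nonneg _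
  refine ⟨V, fun k => (hVn k).trans ?_, ?_⟩
  · have : 0 ≤ (∑ j, (K j : ℝ)) * C ^ 2 := by positivity
    nlinarith
  intro ζ hζ j
  have hd : fderiv ℝ (ρ j) z (ζ • V) = ζ.re * ρ j z := by
    have h1 : ζ • V = (ζ.re : ℝ) • V + (ζ.im : ℝ) • (Complex.I • V) := by
      ext i
      simp only [Pi.smul_apply, Pi.add_apply, smul_eq_mul, Complex.real_smul]
      conv_lhs => rw [← Complex.re_add_im ζ]
      ring
    rw [h1, map_add, map_smul, map_smul, (hVd j).1, (hVd j).2]; simp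
  have hVnorm : ‖V‖ ≤ C * ∑ j, |ρ j z| := (pi_norm_le_iff_of_nonneg (by positivity)).2 hVn
  have hmv := Convex.norm_image_sub_le_of_norm_fderiv_le' (𝕜 := ℝ) (f := ρ j)
    (s := segment ℝ z (z + ζ • V)) (C := K j * ‖ζ • V‖) (φ := fderiv ℝ (ρ j) z)
    (x := z) (y := z + ζ • V) ?_ ?_ (convex_segment _ _) (left_mem_segment _ _ _) (right_mem_segment _ _ _)
  · rw [add_sub_cancel_left, hd, Real.norm_eq_abs] at hmv
    have e : ρ j (z + ζ • V) - (1 + ζ.re) * ρ j z = ρ j (z + ζ • V) - ρ j z - ζ.re * ρ j z := by ring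
    rw [e]
    refine hmv.trans ?_
    rw [norm_smul]
    have h3 : ‖V‖ ^ 2 ≤ (C * ∑ j, |ρ j z|) ^ 2 := by gcongr
    have h4 : (K j : ℝ) * ‖V‖ ^ 2 ≤ (∑ j, (K j : ℝ)) * (C * ∑ j, |ρ j z|) ^ 2 := by
      exact mul_le_mul (hKn j) h3 (by positivity) hKn0
    have h5 : (K j : ℝ) * ‖V‖ ^ 2 ≤ (C + (∑ j, (K j : ℝ)) * C ^ 2) * (∑ j, |ρ j z|) ^ 2 := by
      have : 0 ≤ C * (∑ j, |ρ j z|) ^ 2 := by positivity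
      nlinarith
    calc (K j : ℝ) * (‖ζ‖ * ‖V‖) * (‖ζ‖ * ‖V‖) = ((K j : ℝ) * ‖V‖ ^ 2) * ‖ζ‖ ^ 2 := by ring
      _ ≤ _ := by gcongr
  · intro x hx
    have hxb := (convex_closedBall p r).segment_subset hz hζ hx
    exact ((hρ j).contDiffAt (hΩ.mem_nhds (hball hxb).1)).differentiableAt (by norm_num)
  · intro x hx
    have hxb := (convex_closedBall p r).segment_subset hz hζ hx
    have := (hK j).norm_sub_le ((hball hxb).2.1 j) (hzt j)
    refine this.trans ?_
    gcongr
    have := norm_sub_le_of_mem_segment hx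
    simpa using this

lemma sqrt_bound (s s' x η : ℝ) (hs : 0 < s) (hx : |x| ≤ 1/4) (hη : 0 ≤ η) (hη1 : η ≤ 1/4)
    (h : s' ≤ s * (1 + x + η)) :
    Real.sqrt s' ≤ Real.sqrt s * (1 + x/2 - x^2/32 + η) := by
  obtain ⟨h1, h2⟩ := abs_le.1 hx
  have h3 : (1 + x + η) ≤ (1 + x/2 - x^2/32 + η)^2 := by
    nlinarith [sq_nonneg x, mul_nonneg (sq_nonneg x) (by linarith : 0 ≤ 1/4 - x), mul_nonneg hη (by linarith : 0 ≤ 1 + x), sq_nonneg (x^2/32), mul_nonneg hη (sub_nonneg.2 (by nlinarith : x^2 ≤ 1)), sq_nonneg η]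
  have h4 : 0 ≤ 1 + x/2 - x^2/32 + η := by nlinarith
  calc Real.sqrt s' ≤ Real.sqrt (s * (1 + x/2 - x^2/32 + η)^2) := by
        apply Real.sqrt_le_sqrt; exact h.trans (by gcongr)
    _ = _ := by rw [Real.sqrt_mul hs.le, Real.sqrt_sq h4]

lemma ratio_bound (ε s s' y y' x τ : ℝ) (hs : 0 < s) (hy : 0 < y) (hε : 0 ≤ ε) (hεy : ε * s ≤ y)
    (hx : |x| ≤ 1/4) (hτ : 0 ≤ τ) (hτ1 : τ ≤ 1/4)
    (h : s' ≤ s * (1 + x + τ)) (h' : y * (1 + x - τ) ≤ y') :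
    ε * s' / y' ≤ ε * s / y + 8 * τ := by
  obtain ⟨h1, h2⟩ := abs_le.1 hx
  have hp : 0 < 1 + x - τ := by linarith
  have hyp : 0 < y * (1 + x - τ) := by positivity
  have hy' : 0 < y' := hyp.trans_le h'
  have hle : ε * s / y ≤ 1 := (div_le_one hy).2 hεy
  have h0 : 0 ≤ ε * s / y := by positivity
  have : ε * s' ≤ (ε * s / y + 8 * τ) * (y * (1 + x - τ)) := by
    have e : ε * s = (ε * s / y) * y := by field_simp
    have a1 : ε * s' ≤ ε * s * (1 + x + τ) := by nlinarith
    set q := ε * s / y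
    rw [e] at a1
    have : q * (1 + x + τ) ≤ (q + 8 * τ) * (1 + x - τ) := by nlinarith
    nlinarith
  rw [div_le_iff₀ hy']
  refine this.trans ?_
  gcongr

/-- the barrier -/
def phi {n : ℕ} (p : Fin n → ℂ) (ρ : Fin n → ((Fin n → ℂ) → ℝ)) (ε A K : ℝ) (z : Fin n → ℂ) : ℝ :=
  -1 + ∑ j, ε * (-∑ k, ρ k z) / (-ρ j z) + A * Real.sqrt (-∑ k, ρ k z)
    + K * ∑ j, Complex.normSq (z j - p j)

set_option maxHeartbeats 1600000 in
lemma phi_bound {n : ℕ} (p : Fin n → ℂ) (ρ : Fin n → ((Fin n → ℂ) → ℝ)) (ε A K C : ℝ)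
    (hC : 0 ≤ C) (hε : 0 < ε) (hε1 : ε ≤ 1) (hK : 0 ≤ K) (hA : 0 ≤ A)
    (z V : Fin n → ℂ) (ζ : ℂ) (s : ℝ) (hsdef : s = -∑ k, ρ k z) (hs : 0 < s) (hs1 : s ≤ 1)
    (hsn : n * C * s ≤ 1/512)
    (hA1 : 512 * (8 * n * (n * C / ε) + K * n * C ^ 2) ≤ A)
    (hneg : ∀ j, ρ j z < 0) (hcone : ∀ j, ε * s ≤ - ρ j z)
    (hV : ∀ k, ‖V k‖ ≤ C * s)
    (hρ : ∀ j, |ρ j (z + ζ • V) - (1 + ζ.re) * ρ j z| ≤ C * s ^ 2 * ‖ζ‖ ^ 2)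
    (hζ : ‖ζ‖ ≤ 1/4) (hζ2 : (n * C / ε) * s * ‖ζ‖^2 ≤ 1/4) (hn : 1 ≤ n) :
    phi p ρ ε A K (z + ζ • V) ≤ phi p ρ ε A K z
      + (A * Real.sqrt s / 2 + 2 * K * (∑ j, (V j * (starRingEnd ℂ) (z j - p j))).re) * ζ.re
      + (- 2 * K * (∑ j, (V j * (starRingEnd ℂ) (z j - p j))).im) * ζ.im
      - (A * Real.sqrt s / 32) * ζ.re ^ 2 + (A * Real.sqrt s / 32) / 4 * ‖ζ‖ ^ 2 := by
  set x := ζ.re with hx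
  set t := ‖ζ‖ with ht
  have ht0 : 0 ≤ t := norm_nonneg _
  have hxt : |x| ≤ 1/4 := (Complex.abs_re_le_norm ζ).trans hζ
  set s' := -∑ k, ρ k (z + ζ • V) with hs'
  have hn1 : (1:ℝ) ≤ n := by exact_mod_cast hn
  have hs'b : |s' - (1 + x) * s| ≤ n * C * s ^ 2 * t ^ 2 := by
    have : s' - (1 + x) * s = - ∑ k, (ρ k (z + ζ • V) - (1 + x) * ρ k z) := by
      rw [Finset.sum_sub_distrib, ← Finset.mul_sum, hs', hsdef]; ring
    rw [this, abs_neg]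
    refine (Finset.abs_sum_le_sum_abs _ _).trans ?_
    refine (Finset.sum_le_sum fun j _ => hρ j).trans ?_
    simp; apply le_of_eq; ring
  have hs'1 : s' ≤ s * (1 + x + n * C * s * t ^ 2) := by
    have := (abs_le.1 hs'b).2; nlinarith
  have hCε : n * C ≤ n * C / ε := by
    rw [le_div_iff₀ hε]; nlinarith [mul_nonneg (by linarith : (0:ℝ) ≤ n) hC]
  set c := n * C / ε with hc
  have hc0 : 0 ≤ c := by positivity
  set τ := c * s * t ^ 2 with hτ
  have hτ0 : 0 ≤ τ := by positivity
  have hητ : n * C * s * t ^ 2 ≤ τ := by rw [hτ]; gcongr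
  have hη0 : 0 ≤ n * C * s * t ^ 2 := by positivity
  have hsq := sqrt_bound s s' x _ hs hxt hη0 (hητ.trans hζ2) hs'1
  have hrat : ∀ j, ε * s' / (-ρ j (z + ζ • V)) ≤ ε * s / (-ρ j z) + 8 * τ := by
    intro j
    refine ratio_bound ε s s' (-ρ j z) _ x τ hs (by linarith [hneg j]) hε.le (hcone j) hxt hτ0 hζ2
      (hs'1.trans (by gcongr)) ?_
    have h1 := (abs_le.1 (hρ j)).2
    have h2 : C * s ^ 2 * t ^ 2 ≤ (-ρ j z) * τ := by
      have e1 : c * ε = n * C := by rw [hc]; field_simp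
      have : ε * s * τ ≤ (-ρ j z) * τ := mul_le_mul_of_nonneg_right (hcone j) hτ0
      refine le_trans ?_ this
      have e2 : ε * s * τ = n * (C * s ^ 2 * t ^ 2) := by rw [hτ]; linear_combination (s^2 * t^2) * e1
      rw [e2]
      have : 0 ≤ C * s ^ 2 * t ^ 2 := by positivity
      nlinarith
    nlinarith
  have hratS : ∑ j, ε * s' / (-ρ j (z + ζ • V)) ≤ ∑ j, ε * s / (-ρ j z) + 8 * n * τ := by
    refine (Finset.sum_le_sum fun j _ => hrat j).trans ?_
    rw [Finset.sum_add_distrib]; simp; apply le_of_eq; ring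
  have hquad : ∑ j, Complex.normSq ((z + ζ • V) j - p j) ≤ ∑ j, Complex.normSq (z j - p j)
      + 2 * (x * (∑ j, (V j * (starRingEnd ℂ) (z j - p j))).re
      - ζ.im * (∑ j, (V j * (starRingEnd ℂ) (z j - p j))).im) + n * C ^ 2 * s ^ 2 * t ^ 2 := by
    have e : ∀ j, Complex.normSq ((z + ζ • V) j - p j) ≤ Complex.normSq (z j - p j)
      + 2 * (x * (V j * (starRingEnd ℂ) (z j - p j)).re
      - ζ.im * (V j * (starRingEnd ℂ) (z j - p j)).im) + C ^ 2 * s ^ 2 * t ^ 2 := by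
      intro j
      have h1 : Complex.normSq (ζ * V j) ≤ C ^ 2 * s ^ 2 * t ^ 2 := by
        rw [Complex.normSq_mul, Complex.normSq_eq_norm_sq, Complex.normSq_eq_norm_sq]
        have : ‖V j‖ ^ 2 ≤ (C * s) ^ 2 := by gcongr; exact hV j
        calc _ ≤ t ^ 2 * (C * s) ^ 2 := by gcongr
          _ = _ := by ring
      have h2 : (z + ζ • V) j - p j = (z j - p j) + ζ * V j := by simp; ring
      rw [h2, Complex.normSq_add]
      have h3 : ((z j - p j) * (starRingEnd ℂ) (ζ * V j)).re =
        (x * (V j * (starRingEnd ℂ) (z j - p j)).re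
      - ζ.im * (V j * (starRingEnd ℂ) (z j - p j)).im) := by
        simp [hx]; ring
      linarith
    refine (Finset.sum_le_sum fun j _ => e j).trans ?_
    rw [Complex.re_sum, Complex.im_sum]
    simp only [Finset.sum_add_distrib, ← Finset.mul_sum, Finset.sum_sub_distrib]
    simp; apply le_of_eq; ring
  have hss : s ≤ Real.sqrt s := by
    apply Real.le_sqrt_of_sq_le; nlinarith
  have hsq0 : 0 ≤ Real.sqrt s := Real.sqrt_nonneg s
  have k1 : A * Real.sqrt s' ≤ A * Real.sqrt s + A * Real.sqrt s / 2 * x - A * Real.sqrt s / 32 * x ^ 2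
      + A * Real.sqrt s * t ^ 2 / 512 := by
    have : n * C * s * t ^ 2 ≤ 1 / 512 * t ^ 2 := by gcongr
    have h1 : Real.sqrt s' ≤ Real.sqrt s * (1 + x/2 - x^2/32 + 1 / 512 * t ^ 2) :=
      hsq.trans (by gcongr)
    calc A * Real.sqrt s' ≤ A * (Real.sqrt s * (1 + x/2 - x^2/32 + 1 / 512 * t ^ 2)) := by gcongr
      _ = _ := by ring
  have k2 : 8 * n * τ + K * (n * C ^ 2 * s ^ 2 * t ^ 2) ≤ A * Real.sqrt s * t ^ 2 / 512 := by
    have hs2 : s ^ 2 ≤ s := by nlinarith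
    have : 8 * n * τ + K * (n * C ^ 2 * s ^ 2 * t ^ 2) ≤ (8 * n * c + K * n * C ^ 2) * s * t ^ 2 := by
      have : K * (n * C ^ 2 * s ^ 2 * t ^ 2) ≤ K * (n * C ^ 2 * s * t ^ 2) := by gcongr
      rw [hτ]; linarith
    refine this.trans ?_
    have h0 : 0 ≤ (8 * n * c + K * n * C ^ 2) := by positivity
    calc (8 * n * c + K * n * C ^ 2) * s * t ^ 2 ≤ (A / 512) * Real.sqrt s * t ^ 2 := by
          gcongr; linarith
      _ = _ := by ring
  have k3 : 0 ≤ A * Real.sqrt s * t ^ 2 := by positivity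
  have k4 := mul_le_mul_of_nonneg_left hquad hK
  unfold phi
  rw [← hsdef, ← hs']
  linarith

lemma submean {g : ℂ → EReal} {S : Set ℂ} (hg : SubharmonicOn g S) (t : ℝ) (ht : 0 < t)
    (hS : closedBall (0:ℂ) t ⊆ S) (b α β κ : ℝ) (hκ : 0 < κ)
    (hle : ∀ ζ ∈ closedBall (0:ℂ) t, ‖ζ‖ = t →
      g ζ ≤ ((b + α * ζ.re + β * ζ.im - κ * ζ.re ^ 2 + κ / 4 * ‖ζ‖ ^ 2 : ℝ) : EReal)) :
    g 0 < (b : EReal) := by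
  obtain ⟨husc, -, hmean⟩ := hg
  set m : ℝ := |b| + |α| * t + |β| * t + κ * t ^ 2 with hm
  set P : ℝ → ℝ := fun θ => b + κ / 4 * t ^ 2 + (α * t) * Real.cos θ + (β * t) * Real.sin θ
    - (κ * t ^ 2) * Real.cos θ ^ 2 with hP
  have key := hmean 0 t ht hS m
  set c : ℝ → ℂ := fun θ => 0 + t * Complex.exp (θ * Complex.I) with hc
  have hcn : ∀ θ, ‖c θ‖ = t := by
    intro θ; simp [hc, Complex.norm_exp_ofReal_mul_I, abs_of_pos ht]
  have hcS : ∀ θ, c θ ∈ closedBall (0:ℂ) t := by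
    intro θ; rw [mem_closedBall_zero_iff, hcn]
  have hcre : ∀ θ, (c θ).re = t * Real.cos θ := by
    intro θ; simp [hc, Complex.exp_ofReal_mul_I_re]
  have hcim : ∀ θ, (c θ).im = t * Real.sin θ := by
    intro θ; simp [hc, Complex.exp_ofReal_mul_I_im]
  have hgP : ∀ θ, g (c θ) ≤ (P θ : EReal) := by
    intro θ
    refine (hle _ (hcS θ) (hcn θ)).trans (le_of_eq ?_)
    rw [hcre, hcim, hcn, hP]; congr 1; ring
  have hPm : ∀ θ, -m ≤ P θ := by
    intro θ
    have h1 := neg_abs_le b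
    have h2 : -(|α| * t) ≤ (α * t) * Real.cos θ := by
      have : |(α * t) * Real.cos θ| ≤ |α| * t := by
        rw [abs_mul, abs_mul, abs_of_pos ht]
        exact mul_le_of_le_one_right (by positivity) (Real.abs_cos_le_one θ)
      linarith [neg_abs_le ((α * t) * Real.cos θ)]
    have h3 : -(|β| * t) ≤ (β * t) * Real.sin θ := by
      have : |(β * t) * Real.sin θ| ≤ |β| * t := by
        rw [abs_mul, abs_mul, abs_of_pos ht]
        exact mul_le_of_le_one_right (by positivity) (Real.abs_sin_le_one θ)
      linarith [neg_abs_le ((β * t) * Real.sin θ)]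
    have h4 : (κ * t ^ 2) * Real.cos θ ^ 2 ≤ κ * t ^ 2 :=
      mul_le_of_le_one_right (by positivity) (Real.cos_sq_le_one θ)
    have h5 : 0 ≤ κ / 4 * t ^ 2 := by positivity
    simp only [hP, hm]; linarith
  set F : ℝ → ℝ := fun θ => (max (g (c θ)) ((-m : ℝ) : EReal)).toReal with hF
  have hmax : ∀ θ, max (g (c θ)) ((-m : ℝ) : EReal) ≤ (P θ : EReal) := fun θ =>
    max_le (hgP θ) (EReal.coe_le_coe_iff.2 (hPm θ))
  have hmaxbot : ∀ θ, max (g (c θ)) ((-m : ℝ) : EReal) ≠ ⊥ := fun θ h => by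
    have := le_max_right (g (c θ)) ((-m : ℝ) : EReal)
    rw [h] at this; simp at this
  have hmaxtop : ∀ θ, max (g (c θ)) ((-m : ℝ) : EReal) ≠ ⊤ := fun θ h => by
    have := hmax θ
    rw [h] at this; simp at this
  have hFP : ∀ θ, F θ ≤ P θ := fun θ => by
    rw [← EReal.coe_le_coe_iff, hF, EReal.coe_toReal (hmaxtop θ) (hmaxbot θ)]; exact hmax θ
  have hFm : ∀ θ, -m ≤ F θ := fun θ => by
    rw [← EReal.coe_le_coe_iff, hF, EReal.coe_toReal (hmaxtop θ) (hmaxbot θ)]; exact le_max_right _ _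
  have hccont : Continuous c := by rw [hc]; fun_prop
  have hmeas : Measurable F := by
    have h1 : UpperSemicontinuous (fun θ => g (c θ)) := by
      rw [← upperSemicontinuousOn_univ_iff]
      exact husc.comp hccont.continuousOn (fun θ _ => hS (hcS θ))
    exact (h1.measurable.max measurable_const).ereal_toReal
  have hPc : Continuous P := by rw [hP]; fun_prop
  have hPi : IntervalIntegrable P volume 0 (2 * Real.pi) := hPc.intervalIntegrable _ _
  have hFi : IntervalIntegrable F volume 0 (2 * Real.pi) := by
    have h2 : IntervalIntegrable (fun θ => |P θ| + |m|) volume 0 (2 * Real.pi) :=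
      (hPc.abs.add continuous_const).intervalIntegrable _ _
    refine h2.mono_fun hmeas.aestronglyMeasurable (Eventually.of_forall fun θ => ?_)
    show ‖F θ‖ ≤ ‖|P θ| + |m|‖
    rw [Real.norm_eq_abs, Real.norm_eq_abs, abs_of_nonneg (by positivity : 0 ≤ |P θ| + |m|), abs_le]
    have := hFP θ; have := hFm θ
    have := le_abs_self (P θ); have := le_abs_self m
    have := abs_nonneg (P θ); have := abs_nonneg m
    constructor <;> linarith
  have hint : ∫ θ in (0:ℝ)..(2 * Real.pi), F θ ≤ ∫ θ in (0:ℝ)..(2 * Real.pi), P θ :=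
    intervalIntegral.integral_mono (by positivity) hFi hPi hFP
  have hPint : ∫ θ in (0:ℝ)..(2 * Real.pi), P θ = 2 * Real.pi * (b - κ * t ^ 2 / 4) := by
    have ii : ∀ f : ℝ → ℝ, Continuous f → IntervalIntegrable f volume 0 (2 * Real.pi) :=
      fun f hf => hf.intervalIntegrable _ _
    rw [hP]
    rw [intervalIntegral.integral_sub (ii _ (by fun_prop)) (ii _ (by fun_prop)),
      intervalIntegral.integral_add (ii _ (by fun_prop)) (ii _ (by fun_prop)),
      intervalIntegral.integral_add (ii _ (by fun_prop)) (ii _ (by fun_prop)),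
      intervalIntegral.integral_const_mul, intervalIntegral.integral_const_mul,
      intervalIntegral.integral_const_mul, integral_cos_sq, integral_cos, integral_sin]
    simp; ring
  refine lt_of_le_of_lt key ?_
  rw [EReal.coe_lt_coe_iff]
  have hpi := Real.pi_pos
  calc 1 / (2 * Real.pi) * ∫ θ in (0:ℝ)..(2 * Real.pi), F θ
      ≤ 1 / (2 * Real.pi) * (2 * Real.pi * (b - κ * t ^ 2 / 4)) := by
        rw [← hPint]; gcongr
    _ = b - κ * t ^ 2 / 4 := by field_simp
    _ < b := by have : 0 < κ * t ^ 2 := by positivity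
                linarith

lemma usc_glue {X : Type*} [TopologicalSpace X] (W D : Set X) (hW : IsOpen W) (u : X → EReal)
    (husc : UpperSemicontinuousOn u W) (htop : ∀ z ∈ W, u z ≠ ⊤)
    (hlim : ∀ q ∈ D, q ∉ W → Tendsto u (nhdsWithin q W) (nhds ⊥))
    (G : X → ℝ) (hG : ContinuousOn G W) (B : ℝ) (hB : ∀ z ∈ W, G z ≤ B)
    (f : X → EReal) (hf1 : ∀ z ∈ W, f z = u z + (G z : EReal)) (hf2 : ∀ z, z ∉ W → f z = ⊥) :
    UpperSemicontinuousOn f D := by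
  intro q hq
  by_cases hqW : q ∈ W
  · have h1 : UpperSemicontinuousWithinAt (fun z => u z + (G z : EReal)) W q := by
      refine UpperSemicontinuousWithinAt.add' (husc q hqW) ?_ ?_
      · exact (continuous_coe_real_ereal.continuousAt.comp_continuousWithinAt
          (hG q hqW)).upperSemicontinuousWithinAt
      · exact EReal.continuousAt_add (Or.inr (by simp)) (Or.inr (by simp))
    intro y hy
    rw [hf1 q hqW] at hy
    have h2 := h1 y hy
    rw [hW.nhdsWithin_eq hqW] at h2
    have h3 : ∀ᶠ z in nhds q, z ∈ W := hW.mem_nhds hqW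
    refine nhdsWithin_le_nhds ?_
    filter_upwards [h2, h3] with z hz hzW
    rw [hf1 z hzW]; exact hz
  · intro y hy
    rw [hf2 q hqW] at hy
    obtain ⟨T, -, hT⟩ := EReal.lt_iff_exists_real_btwn.1 hy
    have h1 : ∀ᶠ z in nhdsWithin q W, u z < ((T - B : ℝ) : EReal) :=
      (hlim q hq hqW).eventually (Iio_mem_nhds (EReal.bot_lt_coe _))
    rw [eventually_nhdsWithin_iff] at h1
    refine nhdsWithin_le_nhds ?_
    filter_upwards [h1] with z hz
    by_cases hzW : z ∈ W
    · rw [hf1 z hzW]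
      have h2 := hz hzW
      refine lt_trans ?_ hT
      have h3 := hB z hzW
      generalize u z = a at *
      induction a with
      | bot => simp
      | top => simp at h2
      | coe a =>
        rw [← EReal.coe_add, EReal.coe_lt_coe_iff]
        rw [EReal.coe_lt_coe_iff] at h2
        linarith
    · rw [hf2 z hzW]; exact hy

lemma phi_contOn {n : ℕ} (p : Fin n → ℂ) (ρ : Fin n → ((Fin n → ℂ) → ℝ)) (ε A K : ℝ)
    (W : Set (Fin n → ℂ)) (hρ : ∀ j, ContinuousOn (ρ j) W) (hW : ∀ z ∈ W, ∀ j, ρ j z < 0) :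
    ContinuousOn (phi p ρ ε A K) W := by
  have hs : ContinuousOn (fun z => -∑ k, ρ k z) W :=
    (continuousOn_finsetSum _ fun k _ => hρ k).neg
  unfold phi
  refine ContinuousOn.add (ContinuousOn.add (continuousOn_const.add ?_) ?_) ?_
  · refine continuousOn_finsetSum _ fun j _ => ?_
    exact (continuousOn_const.mul hs).div (hρ j).neg fun z hz => by have := hW z hz j; linarith
  · exact continuousOn_const.mul (Real.continuous_sqrt.comp_continuousOn hs)
  · refine Continuous.continuousOn ?_
    have : Continuous Complex.normSq := Complex.continuous_normSq
    fun_prop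

lemma phi_parts {n : ℕ} (p : Fin n → ℂ) (ρ : Fin n → ((Fin n → ℂ) → ℝ)) (ε A K : ℝ)
    (hε : 0 ≤ ε) (hA : 0 ≤ A) (hK : 0 ≤ K) (z : Fin n → ℂ) (hz : ∀ j, ρ j z < 0) :
    -1 ≤ phi p ρ ε A K z ∧ (phi p ρ ε A K z < 0 →
      (∀ j, ε * (-∑ k, ρ k z) < - ρ j z) ∧ K * ∑ j, Complex.normSq (z j - p j) < 1) := by
  have hs : 0 ≤ -∑ k, ρ k z := by
    rw [← Finset.sum_neg_distrib]; exact Finset.sum_nonneg fun k _ => by linarith [hz k]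
  have h1 : ∀ j, 0 ≤ ε * (-∑ k, ρ k z) / (-ρ j z) := fun j =>
    div_nonneg (mul_nonneg hε hs) (by linarith [hz j])
  have h2 : 0 ≤ A * Real.sqrt (-∑ k, ρ k z) := by positivity
  have h3 : 0 ≤ K * ∑ j, Complex.normSq (z j - p j) :=
    mul_nonneg hK (Finset.sum_nonneg fun j _ => Complex.normSq_nonneg _)
  have h4 := Finset.sum_nonneg fun j (_ : j ∈ Finset.univ) => h1 j
  unfold phi
  refine ⟨by linarith, fun h => ⟨fun j => ?_, by linarith⟩⟩
  have h5 := Finset.single_le_sum (fun j _ => h1 j) (Finset.mem_univ j)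
  have h6 : ε * (-∑ k, ρ k z) / (-ρ j z) < 1 := by linarith
  rwa [div_lt_one (by linarith [hz j])] at h6

lemma main_pos
    (n : ℕ) (hn : 1 ≤ n) (Ω : Set (Fin n → ℂ)) (hΩ : IsOpen Ω)
    (p : Fin n → ℂ) (hp : p ∈ Ω)
    (ρ : Fin n → ((Fin n → ℂ) → ℝ))
    (hρ : ∀ j, ContDiffOn ℝ 2 (ρ j) Ω)
    (hρp : ∀ j, ρ j p = 0)
    (hindep : ∀ a : Fin n → ℂ, (∀ V : Fin n → ℂ, (∑ j, a j * delC (ρ j) p V) = 0) → a = 0)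
    (u : (Fin n → ℂ) → EReal) (W : Set (Fin n → ℂ)) (hWdef : W = {z ∈ Ω | ∀ j, ρ j z < 0})
    (hpsh : PlurisubharmonicOn u W)
    (hlim : ∀ q ∈ Ω, (∀ j, ρ j q = 0) → Tendsto u (nhdsWithin q W) (nhds ⊥))
    (δ : ℝ) (hδ : 0 < δ) : ∃ U : Set (Fin n → ℂ), IsOpen U ∧ p ∈ U ∧ U ⊆ Ω ∧
      ∀ z ∈ U, (∀ j, ρ j z < 0) →
        (∀ j, ρ j z - δ * ∑ k ∈ Finset.univ.erase j, ρ k z < 0) → u z = ⊥ := by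
  obtain ⟨r0, hr0, C, hC, hr0Ω, hgeom⟩ := geom Ω hΩ p hp ρ hρ hindep
  have hn1 : (1:ℝ) ≤ n := by exact_mod_cast hn
  have hn0 : (0:ℝ) < n := by linarith
  have hcont : ∀ j, ContinuousOn (ρ j) Ω := fun j => (hρ j).continuousOn
  have hcat : ∀ j z, z ∈ Ω → ContinuousAt (ρ j) z := fun j z hz =>
    (hcont j).continuousAt (hΩ.mem_nhds hz)
  have hWmem : ∀ z, z ∈ W ↔ z ∈ Ω ∧ ∀ j, ρ j z < 0 := fun z => by rw [hWdef]; rfl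
  have hWo : IsOpen W := by
    rw [isOpen_iff_mem_nhds]
    intro z hz
    rw [hWmem] at hz
    have h1 : ∀ᶠ w in nhds z, ∀ j, ρ j w < 0 :=
      eventually_all.2 fun j => (hcat j z hz.1).eventually (Iio_mem_nhds (hz.2 j))
    filter_upwards [hΩ.mem_nhds hz.1, h1] with w hw1 hw2
    exact (hWmem w).2 ⟨hw1, hw2⟩
  have hscont : ContinuousAt (fun z => ∑ j, |ρ j z|) p :=
    tendsto_finsetSum _ fun j _ => (hcat j p hp).abs
  have hsp : ∑ j, |ρ j p| = 0 := by simp [hρp]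
  -- choice of constants
  set ε : ℝ := δ / (4 * n * (1 + δ)) with hεdef
  have hε : 0 < ε := by positivity
  have hε1 : ε ≤ 1 := by
    rw [hεdef, div_le_one (by positivity)]; nlinarith
  set σ : ℝ := 1 / (512 * (n * C + 1)) with hσdef
  have hnC : 0 ≤ n * C := by positivity
  have hσ : 0 < σ := by positivity
  have hσe : σ * (512 * (n * C + 1)) = 1 := by rw [hσdef]; field_simp
  obtain ⟨r, hr, hball⟩ : ∃ r, 0 < r ∧ ∀ z ∈ closedBall p r, z ∈ closedBall p r0 ∧ ∑ j, |ρ j z| < σ := by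
    have h1 : ∀ᶠ z in nhds p, z ∈ closedBall p r0 ∧ ∑ j, |ρ j z| < σ :=
      Filter.Eventually.and (closedBall_mem_nhds p hr0)
        (hscont.eventually (Iio_mem_nhds (by beta_reduce; rw [hsp]; exact hσ)))
    obtain ⟨r, hr, h⟩ := Metric.nhds_basis_closedBall.eventually_iff.1 h1
    exact ⟨r, hr, fun z hz => h hz⟩
  set K : ℝ := 1 / r ^ 2 with hKdef
  have hK : 0 < K := by positivity
  set A : ℝ := 512 * (8 * n * (n * C / ε) + K * n * C ^ 2) + 1 with hAdef
  have hA : 0 < A := by positivity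
  have hUev : ∀ᶠ z in nhds p, z ∈ ball p r ∧
      A * Real.sqrt (∑ j, |ρ j z|) + K * ∑ j, Complex.normSq (z j - p j) < 1/2 := by
    refine Filter.Eventually.and (ball_mem_nhds p hr) ?_
    have h1 : ContinuousAt (fun z : Fin n → ℂ =>
        A * Real.sqrt (∑ j, |ρ j z|) + K * ∑ j, Complex.normSq (z j - p j)) p := by
      refine ContinuousAt.add (continuousAt_const.mul
        (Real.continuous_sqrt.continuousAt.comp hscont)) ?_
      refine Continuous.continuousAt ?_
      have : Continuous Complex.normSq := Complex.continuous_normSq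
      fun_prop
    refine h1.eventually (Iio_mem_nhds ?_)
    beta_reduce; rw [hsp]; simp
  obtain ⟨U, hU, hUo, hpU⟩ := _root_.eventually_nhds_iff.1 hUev
  refine ⟨U, hUo, hpU, fun z hz => hr0Ω (hball z (ball_subset_closedBall (hU z hz).1)).1, ?_⟩
  intro z0 hz0 hz0neg hz0cone
  by_contra hbot
  have habs : ∀ z, (∀ j, ρ j z ≤ 0) → ∑ j, |ρ j z| = -∑ k, ρ k z := by
    intro z hz
    rw [← Finset.sum_neg_distrib]
    exact Finset.sum_congr rfl fun j _ => abs_of_nonpos (hz j)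
  set φ := phi p ρ ε A K with hφdef
  -- value at z0
  have hz0s : 0 < -∑ k, ρ k z0 := by
    rw [← Finset.sum_neg_distrib]
    exact Finset.sum_pos (fun k _ => by linarith [hz0neg k]) ⟨⟨0, hn⟩, Finset.mem_univ _⟩
  have hc0 : ∀ j, δ * (-∑ k, ρ k z0) ≤ (1 + δ) * (-ρ j z0) := by
    intro j
    have h1 := hz0cone j
    have h2 := Finset.add_sum_erase Finset.univ (fun k => ρ k z0) (Finset.mem_univ j)
    rw [← h2]; nlinarith
  have hterm0 : ∀ j, ε * (-∑ k, ρ k z0) / (-ρ j z0) ≤ 1 / (4 * n) := by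
    intro j
    have h1 : 0 < -ρ j z0 := by linarith [hz0neg j]
    rw [div_le_iff₀ h1, hεdef]
    calc δ / (4 * n * (1 + δ)) * (-∑ k, ρ k z0)
        = (δ * (-∑ k, ρ k z0)) / (4 * n * (1 + δ)) := by ring
      _ ≤ ((1 + δ) * (-ρ j z0)) / (4 * n * (1 + δ)) := div_le_div_of_nonneg_right (hc0 j) (by positivity)
      _ = _ := by field_simp
  have hφ0 : φ z0 ≤ -1/4 := by
    have h1 := (hU z0 hz0).2
    rw [habs z0 fun j => (hz0neg j).le] at h1
    have h2 : ∑ j, ε * (-∑ k, ρ k z0) / (-ρ j z0) ≤ 1/4 := by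
      refine (Finset.sum_le_sum fun j _ => hterm0 j).trans (le_of_eq ?_)
      simp; field_simp
    rw [hφdef, phi]; linarith
  -- compact set
  let T : Set (Fin n → ℝ) := {y | ∀ j, 0 ≤ y j ∧ ε * ∑ k, y k ≤ y j}
  have hT : IsClosed T := by
    have e : T = ⋂ j, ({y : Fin n → ℝ | 0 ≤ y j} ∩ {y : Fin n → ℝ | ε * ∑ k, y k ≤ y j}) := by
      ext y; simp [T]
    rw [e]
    refine isClosed_iInter fun j => ?_
    have h1 : Continuous fun y : Fin n → ℝ => y j := by fun_prop
    have h2 : Continuous fun y : Fin n → ℝ => ε * ∑ k, y k := by fun_prop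
    exact (isClosed_le continuous_const h1).inter (isClosed_le h2 h1)
  let D : Set (Fin n → ℂ) := closedBall p r ∩ (fun z j => - ρ j z) ⁻¹' T
  have hballΩ : closedBall p r ⊆ Ω := fun z hz => hr0Ω (hball z hz).1
  have hDc : IsCompact D := by
    refine (isCompact_closedBall p r).of_isClosed_subset ?_ Set.inter_subset_left
    refine ContinuousOn.preimage_isClosed_of_isClosed ?_ isClosed_closedBall hT
    exact continuousOn_pi.2 fun j => ((hcont j).mono hballΩ).neg
  have hDE : ∀ q ∈ D, q ∉ W → Tendsto u (nhdsWithin q W) (nhds ⊥) := by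
    intro q hq hqW
    refine hlim q (hballΩ hq.1) ?_
    have hq2 : ∀ j, 0 ≤ - ρ j q ∧ ε * ∑ k, - ρ k q ≤ - ρ j q := hq.2
    have hs0 : ∑ k, - ρ k q ≤ 0 := by
      by_contra hcon
      push Not at hcon
      refine hqW ((hWmem q).2 ⟨hballΩ hq.1, fun j => ?_⟩)
      have := (hq2 j).2
      have : 0 < ε * ∑ k, - ρ k q := mul_pos hε hcon
      linarith
    intro j
    have := Finset.single_le_sum (fun k _ => (hq2 k).1) (Finset.mem_univ j)
    have := (hq2 j).1
    linarith
  have hz0Ω : z0 ∈ Ω := hballΩ (ball_subset_closedBall (hU z0 hz0).1)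
  have hz0W : z0 ∈ W := (hWmem z0).2 ⟨hz0Ω, hz0neg⟩
  have hDof : ∀ z, z ∈ closedBall p r → (∀ j, ρ j z < 0) → (∀ j, ε * (-∑ k, ρ k z) ≤ -ρ j z) → z ∈ D := by
    intro z hz h1 h2
    refine ⟨hz, fun j => ⟨by linarith [h1 j], ?_⟩⟩
    rw [Finset.sum_neg_distrib]; exact h2 j
  have hpp : ∀ z ∈ W, _ := fun z hz => phi_parts p ρ ε A K hε.le hA.le hK.le z ((hWmem z).1 hz).2
  have hz0D : z0 ∈ D := hDof z0 (ball_subset_closedBall (hU z0 hz0).1) hz0neg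
    fun j => (((hpp z0 hz0W).2 (by linarith)).1 j).le
  have hφc : ContinuousOn φ W := phi_contOn p ρ ε A K W
    (fun j => (hcont j).mono fun z hz => ((hWmem z).1 hz).1) fun z hz => ((hWmem z).1 hz).2
  classical
  -- upper bound
  obtain ⟨M, hM⟩ : ∃ M : ℝ, ∀ z ∈ D, z ∈ W → u z ≤ (M : EReal) := by
    let f : (Fin n → ℂ) → EReal := fun z => if z ∈ W then u z + ((0:ℝ) : EReal) else ⊥
    have hf : UpperSemicontinuousOn f D := usc_glue W D hWo u hpsh.1 hpsh.2.1 hDE (fun _ => 0)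
      continuousOn_const 0 (fun _ _ => le_rfl) f (fun z hz => by simp [f, hz]) (fun z hz => by simp [f, hz])
    obtain ⟨z1, hz1, hmax⟩ := hf.exists_isMaxOn ⟨z0, hz0D⟩ hDc
    refine ⟨(f z1).toReal, fun z hz hzW => ?_⟩
    have h1 : f z ≤ f z1 := hmax hz
    have h2 : f z1 ≠ ⊤ := by
      by_cases h : z1 ∈ W
      · simp only [f, h, if_true]; simpa using hpsh.2.1 z1 h
      · simp [f, h]
    have h3 : f z = u z := by simp [f, hzW]
    rw [← h3]
    exact h1.trans (EReal.le_coe_toReal h2)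
  obtain ⟨b, hb⟩ : ∃ b : ℝ, u z0 = b := ⟨(u z0).toReal, (EReal.coe_toReal (hpsh.2.1 z0 hz0W) hbot).symm⟩
  set N : ℝ := 4 * (|M| + |b| + 1) with hN
  have hN0 : 0 < N := by positivity
  have hbN : M < b + N / 4 := by
    have := le_abs_self M; have := neg_abs_le b; rw [hN]; linarith
  let f : (Fin n → ℂ) → EReal := fun z => if z ∈ W then u z + ((-N * φ z : ℝ) : EReal) else ⊥
  have hfW : ∀ z ∈ W, f z = u z + ((-N * φ z : ℝ) : EReal) := fun z hz => by simp only [f, hz, if_true]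
  have hf : UpperSemicontinuousOn f D := usc_glue W D hWo u hpsh.1 hpsh.2.1 hDE (fun z => -N * φ z)
    (continuousOn_const.mul hφc) N (fun z hz => by have := (hpp z hz).1; nlinarith) f hfW
    (fun z hz => by simp [f, hz])
  obtain ⟨z1, hz1, hmax⟩ := hf.exists_isMaxOn ⟨z0, hz0D⟩ hDc
  have hfz1 : (M : EReal) < f z1 := by
    refine lt_of_lt_of_le ?_ (hmax hz0D : f z0 ≤ f z1)
    rw [hfW z0 hz0W, hb, ← EReal.coe_add, EReal.coe_lt_coe_iff]
    nlinarith
  have hz1W : z1 ∈ W := by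
    by_contra h
    simp [f, h] at hfz1
  obtain ⟨hz1Ω, hz1neg⟩ := (hWmem z1).1 hz1W
  obtain ⟨b1, hb1⟩ : ∃ b1 : ℝ, u z1 = b1 := by
    refine ⟨(u z1).toReal, (EReal.coe_toReal (hpsh.2.1 z1 hz1W) ?_).symm⟩
    intro h
    rw [hfW z1 hz1W, h] at hfz1
    simp at hfz1
  have hφ1 : φ z1 < 0 := by
    have h1 := hM z1 hz1 hz1W
    rw [hfW z1 hz1W, hb1, ← EReal.coe_add, EReal.coe_lt_coe_iff] at hfz1
    rw [hb1, EReal.coe_le_coe_iff] at h1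
    by_contra hcon
    push Not at hcon
    nlinarith
  obtain ⟨hcone1, hquad1⟩ := (hpp z1 hz1W).2 hφ1
  have hz1ball : z1 ∈ ball p r := by
    rw [mem_ball, dist_pi_lt_iff hr]
    intro j
    rw [dist_eq_norm]
    have h1 : ∑ j, Complex.normSq (z1 j - p j) < r ^ 2 := by
      rw [hKdef, one_div, inv_mul_lt_iff₀ (by positivity)] at hquad1
      linarith
    have h2 := Finset.single_le_sum (fun k _ => Complex.normSq_nonneg (z1 k - p k)) (Finset.mem_univ j)
    have h3 : ‖z1 j - p j‖ ^ 2 < r ^ 2 := by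
      rw [← Complex.normSq_eq_norm_sq]; linarith
    exact lt_of_pow_lt_pow_left₀ 2 hr.le h3
  have hnhds : ∀ᶠ w in nhds z1, w ∈ D ∧ w ∈ W ∧ w ∈ closedBall p r0 := by
    have h1 : ∀ᶠ w in nhds z1, ∀ j, ε * (-∑ k, ρ k w) < - ρ j w := by
      refine eventually_all.2 fun j => ?_
      have hc : ContinuousAt (fun w => ∑ k, ρ k w) z1 :=
        tendsto_finsetSum _ fun k _ => hcat k z1 hz1Ω
      exact (continuousAt_const.mul hc.neg).eventually_lt (hcat j z1 hz1Ω).neg (hcone1 j)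
    filter_upwards [h1, hWo.mem_nhds hz1W, isOpen_ball.mem_nhds hz1ball] with w hw1 hw2 hw3
    have hw4 := ball_subset_closedBall hw3
    exact ⟨hDof w hw4 ((hWmem w).1 hw2).2 fun j => (hw1 j).le, hw2, (hball w hw4).1⟩
  obtain ⟨V, hVn, hVρ⟩ := hgeom z1 (hball z1 (ball_subset_closedBall hz1ball)).1
  rw [habs z1 fun j => (hz1neg j).le] at hVn hVρ
  have hsσ := (hball z1 (ball_subset_closedBall hz1ball)).2
  rw [habs z1 fun j => (hz1neg j).le] at hsσ
  set s := -∑ k, ρ k z1 with hs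
  have hs0 : 0 < s := by
    rw [hs, ← Finset.sum_neg_distrib]
    exact Finset.sum_pos (fun k _ => by linarith [hz1neg k]) ⟨⟨0, hn⟩, Finset.mem_univ _⟩
  have hev : ∀ᶠ ζ in nhds (0:ℂ), (z1 + ζ • V ∈ D ∧ z1 + ζ • V ∈ W ∧ z1 + ζ • V ∈ closedBall p r0) ∧
      ‖ζ‖ < 1/4 ∧ (n * C / ε) * s * ‖ζ‖ ^ 2 < 1/4 := by
    refine Filter.Eventually.and ?_ (Filter.Eventually.and ?_ ?_)
    · have hc : Continuous fun ζ : ℂ => z1 + ζ • V := by fun_prop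
      have := hc.tendsto 0
      simp only [zero_smul, add_zero] at this
      exact this.eventually hnhds
    · have hc : Continuous fun ζ : ℂ => ‖ζ‖ := by fun_prop
      exact (hc.tendsto 0).eventually (Iio_mem_nhds (by simp))
    · have hc : Continuous fun ζ : ℂ => (n * C / ε) * s * ‖ζ‖ ^ 2 := by fun_prop
      exact (hc.tendsto 0).eventually (Iio_mem_nhds (by simp))
  obtain ⟨t, ht, hev⟩ := Metric.nhds_basis_closedBall.eventually_iff.1 hev
  have hsub := hpsh.2.2 z1 V
  have hs1 : s ≤ 1 := by nlinarith
  have hsn : n * C * s ≤ 1 / 512 := by nlinarith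
  have hκ : 0 < N * (A * Real.sqrt s / 32) := by
    have := Real.sqrt_pos.2 hs0; positivity
  have hfin := submean hsub t ht (fun ζ hζ => (hev hζ).1.2.1) b1
    (N * (A * Real.sqrt s / 2 + 2 * K * (∑ j, (V j * (starRingEnd ℂ) (z1 j - p j))).re))
    (N * (- 2 * K * (∑ j, (V j * (starRingEnd ℂ) (z1 j - p j))).im))
    (N * (A * Real.sqrt s / 32)) hκ ?_
  · simp only [zero_smul, add_zero, hb1, lt_self_iff_false] at hfin
  intro ζ hζ _
  obtain ⟨⟨hD, hw, hw0⟩, hζ1, hζ2⟩ := hev hζ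
  have hpb := phi_bound p ρ ε A K C hC hε hε1 hK.le hA.le z1 V ζ s hs hs0 hs1 hsn (by rw [hAdef]; linarith)
    hz1neg (fun j => (hcone1 j).le) hVn (hVρ ζ hw0) hζ1.le hζ2.le hn
  have hle : f (z1 + ζ • V) ≤ f z1 := hmax hD
  rw [hfW _ hw, hfW z1 hz1W, hb1] at hle
  have hle2 : u (z1 + ζ • V) ≤ ((b1 + N * (φ (z1 + ζ • V) - φ z1) : ℝ) : EReal) := by
    have htop := hpsh.2.1 _ hw
    generalize u (z1 + ζ • V) = a at *
    induction a with
    | bot => simp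
    | top => simp at htop
    | coe a =>
      rw [← EReal.coe_add, ← EReal.coe_add, EReal.coe_le_coe_iff] at hle
      rw [EReal.coe_le_coe_iff]; linarith
  refine hle2.trans ?_
  rw [EReal.coe_le_coe_iff]
  have := mul_le_mul_of_nonneg_left hpb hN0.le
  rw [← hφdef] at this
  linarith

/-- boundary uniqueness, general wedge, standard structure: if
`E = {ρ₁ = … = ρₙ = 0}` is a totally real edge (the complex-linear parts `∂ρ_j` are
ℂ-linearly independent along `E`) and `u` is plurisubharmonic on the wedge
`W = {ρ_j < 0 ∀j}` with `u → −∞` at every point of `E`, then for every `δ > 0` the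
function `u` is `−∞` on the truncated wedge `{ρ_j − δ·Σ_{k≠j} ρ_k < 0 ∀j}` near `p`. -/
theorem boundary_uniqueness_general_wedge
    (n : ℕ) (Ω : Set (Fin n → ℂ)) (hΩ : IsOpen Ω)
    (p : Fin n → ℂ) (hp : p ∈ Ω)
    (ρ : Fin n → ((Fin n → ℂ) → ℝ))
    (hρ : ∀ j, ContDiffOn ℝ 2 (ρ j) Ω)
    (hρp : ∀ j, ρ j p = 0)
    (hindep : ∀ z ∈ Ω, (∀ j, ρ j z = 0) →
      ∀ a : Fin n → ℂ, (∀ V : Fin n → ℂ, (∑ j, a j * delC (ρ j) z V) = 0) → a = 0)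
    (u : (Fin n → ℂ) → EReal)
    (hpsh : PlurisubharmonicOn u {z ∈ Ω | ∀ j, ρ j z < 0})
    (hlim : ∀ q ∈ Ω, (∀ j, ρ j q = 0) →
      Tendsto u (nhdsWithin q {z ∈ Ω | ∀ j, ρ j z < 0}) (nhds ⊥)) :
    ∀ δ : ℝ, 0 < δ → ∃ U : Set (Fin n → ℂ), IsOpen U ∧ p ∈ U ∧ U ⊆ Ω ∧
      ∀ z ∈ U, (∀ j, ρ j z < 0) →
        (∀ j, ρ j z - δ * ∑ k ∈ Finset.univ.erase j, ρ k z < 0) → u z = ⊥ := by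
  intro δ hδ
  rcases Nat.eq_zero_or_pos n with rfl | hn
  · refine ⟨Ω, hΩ, hp, subset_rfl, ?_⟩
    intro z hz h1 _
    have h := hlim z hz (fun j => j.elim0)
    have h2 : pure z ≤ nhdsWithin z {z ∈ Ω | ∀ j, ρ j z < 0} := pure_le_nhdsWithin ⟨hz, h1⟩
    have h3 := h.mono_left h2
    exact tendsto_nhds_unique (tendsto_pure_nhds u z) h3
  · exact main_pos n hn Ω hΩ p hp ρ hρ hρp (hindep p hp hρp) u _ rfl hpsh hlim δ hδ
end
end
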